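/- Let ℍ be a simple self-aiding X-net of G (all arcs simple, and ℍ equals its own aiding net) and let Y be an ℍ-wild set with ℓ(Y,ℍ,G) ≥ 3. If G[X∪Y] is sapling-free, then Y is ℍ-podded for G. -/

import Mathlib

attribute [local instance] Classical.propDecidable

namespace ThreeInATree

variable {V : Type*}

/-- A leaf of a simple graph: a vertex with exactly one neighbor. -/
def IsLeaf (G : SimpleGraph V) (v : V) : Prop := ∃! w, G.Adj v w

/-- A vertex set inducing a path graph (a tree of maximum degree at most two). -/
def IsPathSet (G : SimpleGraph V) (P : Set V) : Prop :=
  (G.induce P).IsTree ∧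
    ∀ v ∈ P, ∀ a ∈ P, ∀ b ∈ P, ∀ c ∈ P,
      G.Adj v a → G.Adj v b → G.Adj v c → a = b ∨ a = c ∨ b = c

/-- `v` is an end-vertex of the path with vertex set `P`: it has at most one
neighbor inside `P`. -/
def IsEndOf (G : SimpleGraph V) (P : Set V) (v : V) : Prop :=
  v ∈ P ∧ ∀ a ∈ P, ∀ b ∈ P, G.Adj v a → G.Adj v b → a = b

/-- A `UW`-path: either a single vertex in `U ∩ W`, or an (induced) path with one
end-vertex in `U` and the other in `W`. -/
def IsUWPath (G : SimpleGraph V) (U W P : Set V) : Prop :=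
  (∃ x, x ∈ U ∧ x ∈ W ∧ P = {x}) ∨
  (IsPathSet G P ∧ ∃ u w, u ≠ w ∧ u ∈ U ∧ w ∈ W ∧ IsEndOf G P u ∧ IsEndOf G P w)

/-- A `UW`-rung of `G[A]`: a vertex-minimal induced `UW`-path inside `A`. -/
def IsRungIn (G : SimpleGraph V) (A U W P : Set V) : Prop :=
  P ⊆ A ∧ IsUWPath G U W P ∧ ∀ Q, Q ⊆ A → IsUWPath G U W Q → P.ncard ≤ Q.ncard

/-- A sapling: an induced tree containing all (three) leaves of `G`. -/
def IsSapling (G : SimpleGraph V) (T : Set V) : Prop :=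
  (G.induce T).IsTree ∧ ∀ v, IsLeaf G v → v ∈ T

def SaplingFree (G : SimpleGraph V) : Prop := ¬ ∃ T, IsSapling G T

/-- A multigraph whose nodes and arcs are vertex sets; each arc `E` has the two
end-nodes `fst E` and `snd E`. -/
structure Net (V : Type*) where
  nodes : Set (Set V)
  arcs : Set (Set V)
  fst : Set V → Set V
  snd : Set V → Set V

namespace Net

/-- The node `N` is an end-node of the arc `E`. -/
def EndsAt (H : Net V) (E N : Set V) : Prop := H.fst E = N ∨ H.snd E = N

/-- Two nodes joined by some arc. -/
def AdjNodes (H : Net V) (U W : Set V) : Prop :=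
  U ≠ W ∧ ∃ E ∈ H.arcs, (H.fst E = U ∧ H.snd E = W) ∨ (H.fst E = W ∧ H.snd E = U)

/-- A leaf node of the net: a node incident to exactly one arc. -/
def IsLeafNode (H : Net V) (N : Set V) : Prop :=
  N ∈ H.nodes ∧ ∃! E, E ∈ H.arcs ∧ H.EndsAt E N

/-- The underlying simple graph of the net on node sets. -/
def graph (H : Net V) : SimpleGraph (Set V) :=
  SimpleGraph.fromRel (fun U W => U ∈ H.nodes ∧ W ∈ H.nodes ∧ H.AdjNodes U W)

/-- `∇(ℍ)`: the net together with an edge between each pair of its leaf nodes. -/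
def nabla (H : Net V) : SimpleGraph (Set V) :=
  SimpleGraph.fromRel (fun U W =>
    (U ∈ H.nodes ∧ W ∈ H.nodes ∧ H.AdjNodes U W) ∨ (H.IsLeafNode U ∧ H.IsLeafNode W))

end Net

/-- A biconnected graph: connected, and still connected after deleting any vertex. -/
def IsBiconnected {α : Type*} (H : SimpleGraph α) : Prop :=
  H.Connected ∧ ∀ v : α, (H.induce {w | w ≠ v}).Connected

/-- Conditions (N1)–(N6): `H` is an `X`-net of `G`. -/
structure IsNet (G : SimpleGraph V) (X : Set V) (H : Net V) : Prop where
  nodes_sub : ∀ N ∈ H.nodes, N ⊆ X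
  fst_mem : ∀ E ∈ H.arcs, H.fst E ∈ H.nodes
  snd_mem : ∀ E ∈ H.arcs, H.snd E ∈ H.nodes
  ends_ne : ∀ E ∈ H.arcs, H.fst E ≠ H.snd E
  conn : (H.graph.induce H.nodes).Connected
  bicon : IsBiconnected (H.nabla.induce H.nodes)
  arcs_nonempty : H.arcs.Nonempty
  arcs_disjoint : ∀ E ∈ H.arcs, ∀ F ∈ H.arcs, E ≠ F → E ∩ F = ∅
  arcs_cover : ⋃₀ H.arcs = X
  leaf_count : {N | H.IsLeafNode N}.ncard = 3
  leaf_single : ∀ N, H.IsLeafNode N → ∃ v, IsLeaf G v ∧ N = {v}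
  rungs : ∀ E ∈ H.arcs, ∀ x ∈ E, ∃ P, x ∈ P ∧ IsRungIn G E (H.fst E) (H.snd E) P
  meets_iff : ∀ E ∈ H.arcs, ∀ N ∈ H.nodes, ((E ∩ N).Nonempty ↔ H.EndsAt E N)
  adj_iff : ∀ E ∈ H.arcs, ∀ F ∈ H.arcs, E ≠ F → ∀ u ∈ E, ∀ v ∈ F,
      (G.Adj u v ↔ ∃ N ∈ H.nodes, H.EndsAt E N ∧ H.EndsAt F N ∧ u ∈ N ∧ v ∈ N)

/-- An arc `E` is simple if `G[E]` is itself a rung between its end-nodes. -/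
def SimpleArc (G : SimpleGraph V) (H : Net V) (E : Set V) : Prop :=
  IsRungIn G E (H.fst E) (H.snd E) E

/-- An `(S,V1,V2)`-sprout inside `G[A]`, of one of the three Types S1, S2, S3. -/
def IsSproutIn (G : SimpleGraph V) (A S V1 V2 T : Set V) : Prop :=
  T ⊆ A ∧
  (((G.induce T).IsTree ∧ (T ∩ S).ncard = 1 ∧ (T ∩ V1).ncard = 1 ∧ (T ∩ V2).ncard = 1) ∨
   (∃ P Q, T = P ∪ Q ∧ P ∩ Q = ∅ ∧
      IsRungIn G A S V1 P ∧ P ∩ V2 = ∅ ∧ IsRungIn G A S V2 Q ∧ Q ∩ V1 = ∅) ∨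
   (∃ P Q, T = P ∪ Q ∧ P ∩ Q = ∅ ∧
      IsRungIn G A V1 V2 P ∧ P ∩ S = ∅ ∧ IsRungIn G A S (V1 ∪ V2) Q))

/-- An arc `E` is flexible if `G[E]` contains an `(S, fst E, snd E)`-sprout for
every nonempty `S ⊆ E`. -/
def FlexibleArc (G : SimpleGraph V) (H : Net V) (E : Set V) : Prop :=
  ∀ S : Set V, S.Nonempty → S ⊆ E → ∃ T, IsSproutIn G E S (H.fst E) (H.snd E) T

/-- An `X`-web: an `X`-net all of whose arcs are simple or flexible. -/
def IsWeb (G : SimpleGraph V) (X : Set V) (H : Net V) : Prop :=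
  IsNet G X H ∧ ∀ E ∈ H.arcs, SimpleArc G H E ∨ FlexibleArc G H E

/-- `{U, W}` is a cutset of `∇(ℍ)` (restricted to the nodes). -/
def Net.CutPairNabla (H : Net V) (U W : Set V) : Prop :=
  U ∈ H.nodes ∧ W ∈ H.nodes ∧ U ≠ W ∧
    Nat.card ((H.nabla.induce (H.nodes \ {U, W})).ConnectedComponent) >
      Nat.card ((H.nabla.induce H.nodes).ConnectedComponent)

/-- `U` and `W` do not form a cutset of the subgraph `Gs`. -/
def NoCutPair {α : Type*} {Γ : SimpleGraph α} (Gs : Γ.Subgraph) (U W : α) : Prop :=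
  Nat.card ((Gs.deleteVerts {U, W}).coe.ConnectedComponent) ≤
    Nat.card (Gs.coe.ConnectedComponent)

/-- `A` is the arc set of a split component of `ℍ` with split pair `{U, W}`:
either a single arc with end-nodes `U` and `W`, or the arcs of a maximal
subgraph `Gs` of `∇(ℍ)` containing the cutset `{U, W}` of `∇(ℍ)` in which `U`
and `W` are nonadjacent and do not form a cutset. -/
def IsSplitCompArcs (H : Net V) (U W : Set V) (A : Set (Set V)) : Prop :=
  (∃ E ∈ H.arcs, A = {E} ∧
     ((H.fst E = U ∧ H.snd E = W) ∨ (H.fst E = W ∧ H.snd E = U))) ∨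
  (H.CutPairNabla U W ∧
   ∃ Gs : (H.nabla).Subgraph,
     U ∈ Gs.verts ∧ W ∈ Gs.verts ∧ ¬ Gs.Adj U W ∧ NoCutPair Gs U W ∧
     (∀ Gs' : (H.nabla).Subgraph, Gs ≤ Gs' → U ∈ Gs'.verts → W ∈ Gs'.verts →
        ¬ Gs'.Adj U W → NoCutPair Gs' U W → Gs' = Gs) ∧
     A = {E | E ∈ H.arcs ∧ Gs.Adj (H.fst E) (H.snd E)})

/-- `C` is a `UW`-chunk of `ℍ`: the union of the arcs of one or more split
components sharing the split pair `{U, W}`. -/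
def IsChunk (H : Net V) (U W : Set V) (C : Set V) : Prop :=
  ∃ 𝒜 : Set (Set (Set V)), 𝒜.Nonempty ∧
    (∀ A ∈ 𝒜, IsSplitCompArcs H U W A) ∧ C = ⋃₀ (⋃₀ 𝒜)

def IsChunkOf (H : Net V) (C : Set V) : Prop := ∃ U W, IsChunk H U W C

/-- A maximal chunk: a chunk not properly contained in any other chunk. -/
def IsMaxChunk (H : Net V) (C : Set V) : Prop :=
  IsChunkOf H C ∧ ∀ C', IsChunkOf H C' → C ⊆ C' → C' = C

/-- The operation `merge(C)` for a `V1V2`-chunk `C`: replace all arcs meeting `C`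
by a single arc `C` with end-nodes `V1, V2`, and delete the nodes all of whose
incident arcs were deleted. -/
noncomputable def Net.merge (H : Net V) (V1 V2 C : Set V) : Net V where
  nodes := {N | N ∈ H.nodes ∧
    ((∃ E ∈ H.arcs, E ∩ C = ∅ ∧ (H.fst E = N ∨ H.snd E = N)) ∨ N = V1 ∨ N = V2)}
  arcs := {E | E ∈ H.arcs ∧ E ∩ C = ∅} ∪ {C}
  fst := fun E => if E = C then V1 else H.fst E
  snd := fun E => if E = C then V2 else H.snd E

/-- A split pair for the chunk `C` (chosen arbitrarily). -/
noncomputable def chunkEnds (H : Net V) (C : Set V) : Set V × Set V :=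
  if h : ∃ p : Set V × Set V, IsChunk H p.1 p.2 C then h.choose else (∅, ∅)

/-- The aiding net `ℍ†` of `ℍ`, obtained by merging every maximal chunk: its arcs
are the maximal chunks of `ℍ` and its nodes are the maximal split nodes of `ℍ`. -/
noncomputable def Net.aiding (H : Net V) : Net V where
  nodes := {N | ∃ C, IsMaxChunk H C ∧ ((chunkEnds H C).1 = N ∨ (chunkEnds H C).2 = N)}
  arcs := {C | IsMaxChunk H C}
  fst := fun C => (chunkEnds H C).1
  snd := fun C => (chunkEnds H C).2

/-- A set `S ⊆ X` is `ℍ`-tamed: every two of its vertices lie in a common arc or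
in a common node of `ℍ`. -/
def Tamed (H : Net V) (S : Set V) : Prop :=
  ∀ u ∈ S, ∀ v ∈ S,
    (∃ E ∈ H.arcs, u ∈ E ∧ v ∈ E) ∨ (∃ N ∈ H.nodes, u ∈ N ∧ v ∈ N)

/-- `N_G(Y, X)`: the neighbors of `Y` inside `X`. -/
def NX (G : SimpleGraph V) (X Y : Set V) : Set V := {x ∈ X | ∃ y ∈ Y, G.Adj y x}

/-- A set `Y ⊆ V(G) ∖ X` is `ℍ`-tamed if `N(Y) ∩ X` is `ℍ`-tamed. -/
def TamedOut (G : SimpleGraph V) (X : Set V) (H : Net V) (Y : Set V) : Prop :=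
  Tamed H (NX G X Y)

/-- `ℍ` is taming: every connected `Y ⊆ V(G) ∖ X` is `ℍ`-tamed. -/
def Taming (G : SimpleGraph V) (X : Set V) (H : Net V) : Prop :=
  ∀ Y : Set V, Y ⊆ Xᶜ → (G.induce Y).Connected → TamedOut G X H Y

/-- An `ℍ`-wild set: a minimally `ℍ`-untamed `Y ⊆ V(G) ∖ X` inducing a path. -/
def Wild (G : SimpleGraph V) (X : Set V) (H : Net V) (Y : Set V) : Prop :=
  Y ⊆ Xᶜ ∧ IsPathSet G Y ∧ ¬ TamedOut G X H Y ∧ ∀ Z, Z ⊂ Y → TamedOut G X H Z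

/-- An `ℍ`-solid subset of `X`: a node of `ℍ`, or a subset `S` of an arc `E`
such that `G[E]` contains no `(S, fst E, snd E)`-sprout. -/
def SolidSet (G : SimpleGraph V) (H : Net V) (S : Set V) : Prop :=
  S ∈ H.nodes ∨
    ∃ E ∈ H.arcs, S ⊆ E ∧ ¬ ∃ T, IsSproutIn G E S (H.fst E) (H.snd E) T

/-- An `ℍ`-solid set `Y ⊆ V(G) ∖ X` inducing a path: `N(Y) ∩ X` is the union of
two `ℍ`-solid sets and no internal vertex of the path has a neighbor in `X`. -/
def SolidOut (G : SimpleGraph V) (X : Set V) (H : Net V) (Y : Set V) : Prop :=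
  (∃ S1 S2, SolidSet G H S1 ∧ SolidSet G H S2 ∧ NX G X Y = S1 ∪ S2) ∧
    ∀ y ∈ Y, ¬ IsEndOf G Y y → NX G X {y} = ∅

/-- `C` is a pod of `Y` in `ℍ`: a `V1V2`-chunk satisfying Conditions P1 and P2. -/
def IsPodOf (G : SimpleGraph V) (X : Set V) (H : Net V) (Y C : Set V) : Prop :=
  ∃ V1 V2, IsChunk H V1 V2 C ∧
    NX G X Y ⊆ V1 ∪ C ∪ V2 ∧
    (∃ y, IsEndOf G Y y ∧ ({v ∈ V1 | G.Adj y v} ⊆ C ∨ V1 ⊆ C ∪ {v | G.Adj y v})) ∧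
    (∃ y, IsEndOf G Y y ∧ ({v ∈ V2 | G.Adj y v} ⊆ C ∨ V2 ⊆ C ∪ {v | G.Adj y v}))

def Podded (G : SimpleGraph V) (X : Set V) (H : Net V) (Y : Set V) : Prop :=
  ∃ C, IsPodOf G X H Y C

def Sticky (G : SimpleGraph V) (X : Set V) (H : Net V) (Y : Set V) : Prop :=
  SolidOut G X H Y ∨ Podded G X H Y

/-- A triad of `ℍ`: `Δ(V1,V2,V3)` for three nodes inducing a triangle in `ℍ`. -/
def IsTriad (H : Net V) (T : Set V) : Prop :=
  ∃ V1 V2 V3, V1 ∈ H.nodes ∧ V2 ∈ H.nodes ∧ V3 ∈ H.nodes ∧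
    H.AdjNodes V1 V2 ∧ H.AdjNodes V2 V3 ∧ H.AdjNodes V1 V3 ∧
    T = (V1 ∩ V2) ∪ (V2 ∩ V3) ∪ (V3 ∩ V1)

/-- A set `S ⊆ X` is `ℍ`-local: contained in a node, an arc, or a triad. -/
def LocalSet (H : Net V) (S : Set V) : Prop :=
  (∃ N ∈ H.nodes, S ⊆ N) ∨ (∃ E ∈ H.arcs, S ⊆ E) ∨ ∃ T, IsTriad H T ∧ S ⊆ T

/-- `ℍ` is local: every connected `Y ⊆ V(G) ∖ X` is `ℍ`-local. -/
def LocalNet (G : SimpleGraph V) (X : Set V) (H : Net V) : Prop :=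
  ∀ Y : Set V, Y ⊆ Xᶜ → (G.induce Y).Connected → LocalSet H (NX G X Y)

/-- `ℍ` has no parallel arcs. -/
def NoParallel (H : Net V) : Prop :=
  ∀ E ∈ H.arcs, ∀ F ∈ H.arcs, E ≠ F →
    ({H.fst E, H.snd E} : Set (Set V)) ≠ {H.fst F, H.snd F}

/-- `ℓ(Y, ℍ, G)`: the minimum number of `ℍ`-tamed subsets of `X` whose union is
`N_G(Y, X)`. -/
noncomputable def ell (G : SimpleGraph V) (X : Set V) (H : Net V) (Y : Set V) : ℕ :=
  sInf {k | ∃ F : Finset (Set V), F.card = k ∧ (∀ S ∈ F, S ⊆ X ∧ Tamed H S) ∧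
    ⋃₀ (↑F : Set (Set V)) = NX G X Y}


section CoreGraph
variable {W : Type*}

def Rc (K : SimpleGraph W) (C : Set W) (u v : W) : Prop :=
  Relation.ReflTransGen (fun p q => K.Adj p q ∧ p ∈ C ∧ q ∈ C) u v

def Cn (K : SimpleGraph W) (C : Set W) : Prop := ∀ u ∈ C, ∀ v ∈ C, Rc K C u v

theorem Rc.mono {K K' : SimpleGraph W} {C C' : Set W} (hK : K ≤ K') (hC : C ⊆ C') {u v : W}
    (h : Rc K C u v) : Rc K' C' u v :=
  Relation.ReflTransGen.mono (fun _ _ h => ⟨hK h.1, hC h.2.1, hC h.2.2⟩) _ _ h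

theorem Rc.symm {K : SimpleGraph W} {C : Set W} {u v : W} (h : Rc K C u v) : Rc K C v u := by
  induction h with
  | refl => exact Relation.ReflTransGen.refl
  | tail _ h2 ih => exact Relation.ReflTransGen.head ⟨h2.1.symm, h2.2.2, h2.2.1⟩ ih

theorem Rc.trans {K : SimpleGraph W} {C : Set W} {u v w : W} (h : Rc K C u v) (h' : Rc K C v w) :
    Rc K C u w := Relation.ReflTransGen.trans h h'

theorem Rc.step {K : SimpleGraph W} {C : Set W} {u v w : W} (h : Rc K C u v) (h' : K.Adj v w)
    (hv : v ∈ C) (hw : w ∈ C) : Rc K C u w := Relation.ReflTransGen.tail h ⟨h', hv, hw⟩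

theorem Rc.rfl {K : SimpleGraph W} {C : Set W} {u : W} : Rc K C u u :=
  Relation.ReflTransGen.refl

theorem Rc.mem {K : SimpleGraph W} {C : Set W} {u v : W} (h : Rc K C u v) (hu : u ∈ C) : v ∈ C := by
  cases h with
  | refl => exact hu
  | tail _ h2 => exact h2.2.2

theorem Rc.exit {K : SimpleGraph W} {P : Set W} {u v : W} (h : Rc K P u v) (D : Set W)
    (hu : u ∈ D) (hv : v ∉ D) : ∃ p q, K.Adj p q ∧ p ∈ D ∧ q ∉ D ∧ p ∈ P ∧ q ∈ P := by
  induction h with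
  | refl => exact absurd hu hv
  | tail _ h2 ih =>
    rename_i b c _
    by_cases hb : b ∈ D
    · exact ⟨b, c, h2.1, hb, hv, h2.2⟩
    · exact ih hb

theorem Cn.mono {K K' : SimpleGraph W} (hK : K ≤ K') {C : Set W} (h : Cn K C) : Cn K' C :=
  fun u hu v hv => (h u hu v hv).mono hK (subset_refl _)

theorem Cn.single {K : SimpleGraph W} (x : W) : Cn K {x} := by
  rintro u rfl v rfl; exact Rc.rfl

theorem Cn.of_root {K : SimpleGraph W} {C : Set W} (r : W) (h : ∀ u ∈ C, Rc K C r u) : Cn K C :=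
  fun u hu v hv => (h u hu).symm.trans (h v hv)

theorem Cn.union_adj {K : SimpleGraph W} {C D : Set W} (hC : Cn K C) (hD : Cn K D) {x y : W}
    (hx : x ∈ C) (hy : y ∈ D) (hxy : K.Adj x y) : Cn K (C ∪ D) := by
  apply Cn.of_root x
  rintro u (hu | hu)
  · exact (hC x hx u hu).mono le_rfl Set.subset_union_left
  · exact (Rc.rfl.step hxy (Or.inl hx) (Or.inr hy)).trans
      ((hD y hy u hu).mono le_rfl Set.subset_union_right)

theorem Cn.union_inter {K : SimpleGraph W} {C D : Set W} (hC : Cn K C) (hD : Cn K D) {x : W}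
    (hx : x ∈ C) (hy : x ∈ D) : Cn K (C ∪ D) := by
  apply Cn.of_root x
  rintro u (hu | hu)
  · exact (hC x hx u hu).mono le_rfl Set.subset_union_left
  · exact ((hD x hy u hu).mono le_rfl Set.subset_union_right)

theorem Cn.ins {K : SimpleGraph W} {C : Set W} (hC : Cn K C) {x y : W}
    (hx : x ∈ C) (hxy : K.Adj x y) : Cn K (insert y C) := by
  have := hC.union_adj (Cn.single y) hx rfl hxy
  rwa [Set.union_singleton] at this

theorem Cn.reach {K : SimpleGraph W} {P : Set W} (a : W) : Cn K {z | Rc K P a z} := by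
  apply Cn.of_root a
  intro u hu
  have hu' : Rc K P a u := hu
  induction hu' with
  | refl => exact Rc.rfl
  | tail h1 h2 ih => exact (ih h1).step h2.1 h1 (Relation.ReflTransGen.tail h1 h2)

theorem Cn.comp {K : SimpleGraph W} {P : Set W} (hP : Cn K P) {p a : W} (hp : p ∈ P) (ha : a ∈ P)
    (hne : a ≠ p) : ∃ A : Set W, a ∈ A ∧ A ⊆ P ∧ p ∉ A ∧ Cn K A ∧ (∃ z ∈ A, K.Adj z p) ∧
      (∀ z ∈ A, ∀ q ∈ P, K.Adj z q → q = p ∨ q ∈ A) ∧ Cn K (P \ A) := by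
  set A : Set W := {z | Rc K (P \ {p}) a z} with hA
  have haP : a ∈ P \ {p} := ⟨ha, hne⟩
  have hAP : ∀ z ∈ A, z ∈ P \ {p} := fun z hz => Rc.mem hz haP
  have hcl : ∀ z ∈ A, ∀ q ∈ P, K.Adj z q → q = p ∨ q ∈ A := by
    intro z hz q hq hzq
    by_cases h : q = p
    · exact Or.inl h
    · exact Or.inr (Rc.step hz hzq (hAP z hz) ⟨hq, h⟩)
  have hpA : p ∉ A := fun h => (hAP p h).2 rfl
  refine ⟨A, Rc.rfl, fun z hz => (hAP z hz).1, hpA, Cn.reach a, ?_, hcl, ?_⟩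
  · obtain ⟨x, q, hxq, hx, hq, -, hqP⟩ := (hP a ha p hp).exit A Rc.rfl hpA
    rcases hcl x hx q hqP hxq with h | h
    · exact ⟨x, hx, h ▸ hxq⟩
    · exact absurd h hq
  · apply Cn.of_root p
    intro u hu
    by_contra hcon
    obtain ⟨x, y, hxy, hx, hy, hxP, hyP⟩ := (hP p hp u hu.1).exit
      ({z | Rc K (P \ A) p z} ∪ A) (Or.inl Rc.rfl) (by
        rintro (h | h)
        · exact hcon h
        · exact hu.2 h)
    rcases hx with hx | hx
    · apply hy
      by_cases h : y ∈ A
      · exact Or.inr h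
      · exact Or.inl (Rc.step hx hxy (Rc.mem hx ⟨hp, hpA⟩) ⟨hyP, h⟩)
    · rcases hcl x hx y hyP hxy with h | h
      · exact hy (Or.inl (h ▸ Rc.rfl))
      · exact hy (Or.inr h)

theorem Cn.trim {K : SimpleGraph W} {C B : Set W} (hC : Cn K C) {a b : W} (ha : a ∈ C)
    (haB : a ∉ B) (hb : b ∈ C) (hbB : b ∈ B) : ∃ A : Set W, A ⊆ C ∧ a ∈ A ∧ Cn K A ∧
      (∀ x ∈ A, x ∉ B) ∧ ∃ b' ∈ C, b' ∈ B ∧ ∃ z ∈ A, K.Adj z b' := by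
  set A : Set W := {z | Rc K (C \ B) a z} with hA
  have hAP : ∀ z ∈ A, z ∈ C \ B := fun z hz => Rc.mem hz ⟨ha, haB⟩
  refine ⟨A, fun z hz => (hAP z hz).1, Rc.rfl, Cn.reach a, fun z hz => (hAP z hz).2, ?_⟩
  obtain ⟨x, q, hxq, hx, hq, -, hqP⟩ := (hC a ha b hb).exit A Rc.rfl (fun h => (hAP b h).2 hbB)
  refine ⟨q, hqP, ?_, x, hx, hxq⟩
  by_contra h
  exact hq (Rc.step hx hxq (hAP x hx) ⟨hqP, h⟩)

def Sep (K : SimpleGraph W) (A B S : Set W) : Prop :=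
  ∀ a ∈ A, a ∉ S → ∀ b ∈ B, b ∉ S → ¬ Rc K Sᶜ a b

theorem Sep.symm {K : SimpleGraph W} {A B S : Set W} (h : Sep K A B S) : Sep K B A S :=
  fun b hb hbS a ha haS hr => h a ha haS b hb hbS hr.symm

theorem menger_aux {K K' : SimpleGraph W} {p q : W} (hKK : ∀ u w, K.Adj u w → K'.Adj u w ∨
    (u = p ∧ w = q) ∨ (u = q ∧ w = p)) {A B S T : Set W} (hS : Sep K' A B S)
    (hq : ∀ a ∈ A, a ∉ S → ¬ Rc K' Sᶜ a q) (hT : Sep K' (insert p S) A T) : Sep K A B T := by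
  intro a ha haT b hb hbT hr
  have hD : ∀ z, Rc K' Tᶜ a z → z ∉ insert p S := by
    intro z hz hzS
    exact hT z hzS (Rc.mem hz haT) a ha haT hz.symm
  have haS : a ∉ S := fun h => hD a Rc.rfl (Or.inr h)
  have hDR : ∀ z, Rc K' Tᶜ a z → Rc K' Sᶜ a z := by
    intro z hz
    induction hz with
    | refl => exact Rc.rfl
    | tail h1 h2 ih =>
      exact ih.step h2.1 (fun h => hD _ h1 (Or.inr h))
        (fun h => hD _ (Relation.ReflTransGen.tail h1 h2) (Or.inr h))
  obtain ⟨u, w, huw, hu, hw, huT, hwT⟩ := hr.exit {z | Rc K' Tᶜ a z} Rc.rfl (by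
    intro h
    exact hS a ha haS b hb (fun h' => hD b h (Or.inr h')) (hDR b h))
  rcases hKK u w huw with h | ⟨h, -⟩ | ⟨h, -⟩
  · exact hw (Rc.step hu h huT hwT)
  · exact hD u hu (Or.inl h)
  · exact hq a ha haS (h ▸ hDR u hu)

theorem fam_trim {K : SimpleGraph W} {A S R : Set W} {p : W}
    (hR : ∀ a ∈ A, a ∉ S → ∀ z, Rc K Sᶜ a z → z ∈ R)
    (C : W → Set W) (hC : ∀ s ∈ insert p S, s ∈ C s ∧ Cn K (C s) ∧ ∃ b ∈ A, b ∈ C s)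
    (hd : ∀ s ∈ insert p S, ∀ t ∈ insert p S, s ≠ t → ∀ x ∈ C s, x ∉ C t) :
    ∃ C' : W → Set W, (∀ s ∈ insert p S, s ∈ C' s ∧ Cn K (C' s) ∧ ∃ b ∈ A, b ∈ C' s) ∧
      (∀ s ∈ insert p S, ∀ t ∈ insert p S, s ≠ t → ∀ x ∈ C' s, x ∉ C' t) ∧
      (∀ s ∈ insert p S, ∀ x ∈ C' s, x = s ∨ x ∈ R) := by
  have key : ∀ s ∈ insert p S, ∃ D : Set W, D ⊆ C s ∧ s ∈ D ∧ Cn K D ∧ (∃ b ∈ A, b ∈ D) ∧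
      ∀ x ∈ D, x = s ∨ x ∈ R := by
    intro s hs
    obtain ⟨h1, h2, b, hb, hbC⟩ := hC s hs
    by_cases hbs : b = s
    · subst hbs
      refine ⟨{b}, by simpa using h1, rfl, Cn.single b, ⟨b, hb, rfl⟩, fun x hx => Or.inl hx⟩
    · have hav : ∀ x ∈ C s \ {s}, x ∉ S := by
        intro x hx hxS
        exact hd x (Or.inr hxS) s hs hx.2 x (hC x (Or.inr hxS)).1 hx.1
      obtain ⟨D, hbD, hDC, hsD, hDcn, ⟨z, hz, hzs⟩, -, -⟩ := h2.comp h1 hbC hbs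
      refine ⟨insert s D, ?_, Or.inl rfl, hDcn.ins hz hzs, ⟨b, hb, Or.inr hbD⟩, ?_⟩
      · rintro x (rfl | hx)
        · exact h1
        · exact hDC hx
      · rintro x (rfl | hx)
        · exact Or.inl rfl
        · right
          refine hR b hb (hav b ⟨hbC, hbs⟩) x ((hDcn b hbD x hx).mono le_rfl ?_)
          intro y hy
          exact hav y ⟨hDC hy, fun h => hsD (h ▸ hy)⟩
  choose! D hD using key
  refine ⟨D, fun s hs => ⟨(hD s hs).2.1, (hD s hs).2.2.1, (hD s hs).2.2.2.1⟩, ?_,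
    fun s hs => (hD s hs).2.2.2.2⟩
  intro s hs t ht hst x hx hx'
  exact hd s hs t ht hst x ((hD s hs).1 hx) ((hD t ht).1 hx')

theorem menger [Finite W] (K : SimpleGraph W) : ∀ (A : Finset W) (B : Set W),
    (∀ S : Finset W, Sep K ↑A B ↑S → A.card ≤ S.card) →
    ∃ C : W → Set W, (∀ a ∈ A, a ∈ C a ∧ Cn K (C a) ∧ ∃ b ∈ B, b ∈ C a) ∧
      ∀ a ∈ A, ∀ a' ∈ A, a ≠ a' → ∀ x ∈ C a, x ∉ C a' := by
  classical
  have := Fintype.ofFinite W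
  induction K using WellFoundedLT.induction with
  | ind K ih =>
  intro A B hAB
  by_cases hedge : ∀ x y, ¬ K.Adj x y
  · have h1 : A.card ≤ (A.filter (· ∈ B)).card := by
      apply hAB
      intro a ha haS b hb hbS hr
      have : a = b := by
        induction hr with
        | refl => rfl
        | tail _ h2 _ => exact absurd h2.1 (hedge _ _)
      subst this
      exact haS (by simpa using ⟨ha, hb⟩)
    have h2 := Finset.eq_of_subset_of_card_le (Finset.filter_subset _ A) h1
    have h3 : ∀ a ∈ A, a ∈ B := by
      intro a ha
      rw [← h2] at ha
      exact (Finset.mem_filter.1 ha).2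
    refine ⟨fun a => {a}, fun a ha => ⟨rfl, Cn.single a, a, h3 a ha, rfl⟩, ?_⟩
    rintro a _ a' _ hne x rfl h
    exact hne h
  push Not at hedge
  obtain ⟨x, y, hxy⟩ := hedge
  set K' := K.deleteEdges {s(x, y)} with hK'
  have hle : K' ≤ K := SimpleGraph.deleteEdges_le _
  have hlt : K' < K := by
    refine lt_of_le_of_ne hle ?_
    intro h
    have : K'.Adj x y := h ▸ hxy
    simp [hK'] at this
  by_cases hsm : ∀ S : Finset W, Sep K' ↑A B ↑S → A.card ≤ S.card
  · obtain ⟨C, h1, h2⟩ := ih K' hlt A B hsm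
    exact ⟨C, fun a ha => ⟨(h1 a ha).1, (h1 a ha).2.1.mono hle, (h1 a ha).2.2⟩, h2⟩
  push Not at hsm
  obtain ⟨S, hS, hSc⟩ := hsm
  have hnS : ¬ Sep K ↑A B ↑S := fun h => absurd (hAB S h) (by omega)
  unfold Sep at hnS
  push Not at hnS
  obtain ⟨a, ha, haS, b, hb, hbS, hr⟩ := hnS
  set Ra : Set W := {z | ∃ a ∈ A, a ∉ S ∧ Rc K' (↑S)ᶜ a z} with hRa
  set Rb : Set W := {z | ∃ b ∈ B, b ∉ S ∧ Rc K' (↑S)ᶜ b z} with hRb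
  have hdis : ∀ z, z ∈ Ra → z ∈ Rb → False := by
    rintro z ⟨a, h1, h2, h3⟩ ⟨b, h4, h5, h6⟩
    exact hS a h1 h2 b h4 h5 (h3.trans h6.symm)
  have hRaS : ∀ z ∈ Ra, z ∉ S := by
    rintro z ⟨a, h1, h2, h3⟩ 
    exact Rc.mem h3 h2
  have hRbS : ∀ z ∈ Rb, z ∉ S := by
    rintro z ⟨a, h1, h2, h3⟩ 
    exact Rc.mem h3 h2
  have haR : a ∈ Ra := ⟨a, ha, haS, Rc.rfl⟩
  have hbR : b ∈ Rb := ⟨b, hb, hbS, Rc.rfl⟩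
  have hKK : ∀ u w, K.Adj u w → K'.Adj u w ∨ (u = x ∧ w = y) ∨ (u = y ∧ w = x) := by
    intro u w h
    by_cases h' : s(u, w) = s(x, y)
    · right
      simpa using h'
    · left
      simp only [hK', SimpleGraph.deleteEdges_adj, Set.mem_singleton_iff]
      exact ⟨h, h'⟩
  obtain ⟨p, q, hpq, hp, hq, hpS, hqS⟩ := hr.exit Ra haR (fun h => hdis b h hbR)
  obtain ⟨q', p', hpq', hq', hp', hqS', hpS'⟩ := hr.symm.exit Rb hbR (fun h => hdis a haR h)
  have hn1 : ¬ K'.Adj p q := by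
    intro h
    obtain ⟨a', h1, h2, h3⟩ := hp
    exact hq ⟨a', h1, h2, h3.step h hpS hqS⟩
  have hn2 : ¬ K'.Adj q' p' := by
    intro h
    obtain ⟨a', h1, h2, h3⟩ := hq'
    exact hp' ⟨a', h1, h2, h3.step h hqS' hpS'⟩
  have hKK2 : ∀ u w, K.Adj u w → K'.Adj u w ∨ (u = p ∧ w = q) ∨ (u = q ∧ w = p) := by
    intro u w h
    rcases hKK p q hpq with h1 | ⟨rfl, rfl⟩ | ⟨rfl, rfl⟩
    · exact absurd h1 hn1
    · exact hKK u w h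
    · have := hKK u w h
      tauto
  obtain ⟨hq1, hp1⟩ : q' = q ∧ p' = p := by
    rcases hKK2 _ _ hpq' with h1 | ⟨h1, h2⟩ | h1
    · exact absurd h1 hn2
    · exact absurd (h1 ▸ hq') (fun h => hdis _ hp h)
    · exact h1
  subst hq1 hp1
  have auxA : ∀ T : Set W, Sep K' (insert p' ↑S) ↑A T → Sep K ↑A B T := fun T hT =>
    menger_aux hKK2 hS (fun a h1 h2 h3 => hq ⟨a, h1, h2, h3⟩) hT
  have auxB : ∀ T : Set W, Sep K' (insert q' ↑S) B T → Sep K ↑A B T := fun T hT =>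
    (menger_aux (fun u w h => by have := hKK2 u w h; tauto) hS.symm
      (fun a h1 h2 h3 => hp' ⟨a, h1, h2, h3⟩) hT).symm
  have hc1 : A.card ≤ (insert p' S).card := by
    apply hAB
    apply auxA
    intro s hs hs'
    exact absurd (by simpa using hs) hs'
  have hp'S : p' ∉ S := hRaS _ hp
  have hq'S : q' ∉ S := hRbS _ hq'
  have hcp : (insert p' S).card = S.card + 1 := Finset.card_insert_of_notMem hp'S
  have hcq : (insert q' S).card = S.card + 1 := Finset.card_insert_of_notMem hq'S
  obtain ⟨C1, hC1, hd1⟩ := ih K' hlt (insert p' S) ↑A (by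
    intro T hT
    have := hAB T (auxA _ (by simpa using hT))
    omega)
  obtain ⟨C2, hC2, hd2⟩ := ih K' hlt (insert q' S) B (by
    intro T hT
    have := hAB T (auxB _ (by simpa using hT))
    omega)
  obtain ⟨D1, hD1, hdd1, hr1⟩ := fam_trim (K := K') (A := ↑A) (S := ↑S) (R := Ra) (p := p')
    (fun a h1 h2 z h3 => ⟨a, h1, h2, h3⟩) C1 (by simpa using hC1) (by simpa using hd1)
  obtain ⟨D2, hD2, hdd2, hr2⟩ := fam_trim (K := K') (A := B) (S := ↑S) (R := Rb) (p := q')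
    (fun a h1 h2 z h3 => ⟨a, h1, h2, h3⟩) C2 (by simpa using hC2) (by simpa using hd2)
  set σ : W → W := fun s => if s = p' then q' else s with hσ
  have hσp : σ p' = q' := by simp [hσ]
  have hσs : ∀ s ∈ S, σ s = s := by
    intro s hs
    have : s ≠ p' := by rintro rfl; exact hp'S hs
    simp [hσ, this]
  have hσm : ∀ s ∈ insert p' (S : Set W), σ s ∈ insert q' (S : Set W) := by
    rintro s (rfl | hs)
    · left; exact hσp
    · right; rw [hσs s hs]; exact hs
  set D : W → Set W := fun s => D1 s ∪ D2 (σ s) with hD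
  have hDm : ∀ s ∈ insert p' (S : Set W), s ∈ D s ∧ Cn K (D s) ∧ (∃ a ∈ A, a ∈ D s) ∧
      ∃ b ∈ B, b ∈ D s := by
    intro s hs
    obtain ⟨e1, e2, a, e3, e4⟩ := hD1 s hs
    obtain ⟨f1, f2, b, f3, f4⟩ := hD2 (σ s) (hσm s hs)
    refine ⟨Or.inl e1, ?_, ⟨a, e3, Or.inl e4⟩, ⟨b, f3, Or.inr f4⟩⟩
    rcases hs with rfl | hs
    · rw [hσp] at f1
      refine (e2.mono hle).union_adj (f2.mono hle) e1 ?_ hpq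
      rw [hσp]; exact f1
    · rw [hσs s hs] at f1
      refine (e2.mono hle).union_inter (f2.mono hle) e1 ?_
      rw [hσs s hs]; exact f1
  have hcross : ∀ s ∈ insert p' (S : Set W), ∀ t ∈ insert p' (S : Set W), s ≠ t →
      ∀ z ∈ D1 s, z ∉ D2 (σ t) := by
    intro s hs t ht hst z hz hz'
    have e1 := hr1 s hs z hz
    have e2 := hr2 _ (hσm t ht) z hz'
    rcases e1 with rfl | e1
    · rcases e2 with e2 | e2
      · rcases ht with rfl | ht
        · rw [hσp] at e2
          rcases hs with rfl | hs
          · exact hst rfl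
          · exact hq'S (e2 ▸ hs)
        · rw [hσs t ht] at e2
          exact hst e2
      · rcases hs with rfl | hs
        · exact hp' e2
        · exact hRbS _ e2 hs
    · rcases e2 with e2 | e2
      · rcases ht with rfl | ht
        · rw [hσp] at e2
          exact hq (e2 ▸ e1)
        · rw [hσs t ht] at e2
          exact hRaS _ e1 (e2 ▸ ht)
      · exact hdis _ e1 e2
  have hDd : ∀ s ∈ insert p' (S : Set W), ∀ t ∈ insert p' (S : Set W), s ≠ t →
      ∀ z ∈ D s, z ∉ D t := by
    intro s hs t ht hst z hz hz'
    rcases hz with hz | hz <;> rcases hz' with hz' | hz'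
    · exact hdd1 s hs t ht hst z hz hz'
    · exact hcross s hs t ht hst z hz hz'
    · exact hcross t ht s hs hst.symm z hz' hz
    · refine hdd2 _ (hσm s hs) _ (hσm t ht) ?_ z hz hz'
      intro h
      apply hst
      rcases hs with rfl | hs <;> rcases ht with rfl | ht
      · rfl
      · rw [hσp, hσs t ht] at h
        exact absurd (h ▸ ht) hq'S
      · rw [hσp, hσs s hs] at h
        exact absurd (h ▸ hs) hq'S
      · rwa [hσs s hs, hσs t ht] at h
  have hf : ∀ s ∈ insert p' (S : Set W), ∃ a ∈ A, a ∈ D s := fun s hs => (hDm s hs).2.2.1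
  choose! f hfA hfD using hf
  have hsurj : Set.SurjOn f ↑(insert p' S) (↑A : Set W) := by
    apply Finset.surjOn_of_injOn_of_card_le f
    · intro s hs
      exact hfA s (by simpa using hs)
    · intro s hs t ht hst
      by_contra hne
      have hs' : s ∈ insert p' (S : Set W) := by simpa using hs
      have ht' : t ∈ insert p' (S : Set W) := by simpa using ht
      exact hDd s hs' t ht' hne (f s) (hfD s hs') (hst ▸ hfD t ht')
    · omega
  have hg : ∀ a ∈ A, ∃ s, s ∈ insert p' (S : Set W) ∧ f s = a := by
    intro a ha
    obtain ⟨s, hs, h⟩ := hsurj ha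
    exact ⟨s, by simpa using hs, h⟩
  choose! g hgS hgf using hg
  refine ⟨fun a => D (g a), fun a ha => ⟨?_, (hDm _ (hgS a ha)).2.1, (hDm _ (hgS a ha)).2.2.2⟩, ?_⟩
  · have := hfD _ (hgS a ha)
    rwa [hgf a ha] at this
  · intro a ha a' ha' hne
    refine hDd _ (hgS a ha) _ (hgS a' ha') ?_
    intro h
    apply hne
    rw [← hgf a ha, ← hgf a' ha', h]

end CoreGraph

section CoreThm
variable {W : Type*}

structure Tri (K : SimpleGraph W) (Lf : W → Prop) (L M P : Set W) : Prop where
  cL : Cn K L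
  cM : Cn K M
  cP : Cn K P
  dLM : ∀ x ∈ L, x ∉ M
  dLP : ∀ x ∈ L, x ∉ P
  dMP : ∀ x ∈ M, x ∉ P
  lL : ∃ a ∈ L, Lf a
  lM : ∃ a ∈ M, Lf a
  lP : ∃ a ∈ P, Lf a

theorem Tri.swap {K : SimpleGraph W} {Lf : W → Prop} {L M P : Set W} (h : Tri K Lf L M P) :
    Tri K Lf M L P :=
  ⟨h.cM, h.cL, h.cP, fun x h1 h2 => h.dLM x h2 h1, h.dMP, h.dLP, h.lM, h.lL, h.lP⟩

theorem Tri.rot {K : SimpleGraph W} {Lf : W → Prop} {L M P : Set W} (h : Tri K Lf L M P) :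
    Tri K Lf M P L :=
  ⟨h.cM, h.cP, h.cL, h.dMP, fun x h1 h2 => h.dLM x h2 h1, fun x h1 h2 => h.dLP x h2 h1,
    h.lM, h.lP, h.lL⟩

theorem Tri.ins {K : SimpleGraph W} {Lf : W → Prop} {L M P : Set W} (h : Tri K Lf L M P)
    {v z : W} (hL : v ∉ L) (hM : v ∉ M) (hz : z ∈ P) (hzv : K.Adj z v) :
    Tri K Lf L M (insert v P) := by
  refine ⟨h.cL, h.cM, h.cP.ins hz hzv, h.dLM, ?_, ?_, h.lL, h.lM, ?_⟩
  · rintro x hx (rfl | h')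
    · exact hL hx
    · exact h.dLP x hx h'
  · rintro x hx (rfl | h')
    · exact hM hx
    · exact h.dMP x hx h'
  · obtain ⟨a, h1, h2⟩ := h.lP
    exact ⟨a, Or.inr h1, h2⟩

def ClosedD (K : SimpleGraph W) (Lf : W → Prop) (s1 s2 : W) (D : Set W) : Prop :=
  s1 ∉ D ∧ s2 ∉ D ∧ (∀ a, Lf a → a ∉ D) ∧ ∀ d ∈ D, ∀ z, K.Adj d z → z ∈ D ∨ z = s1 ∨ z = s2

/-- F-edge between. -/
def Fb (F : SimpleGraph W) (L M : Set W) : Prop := ∃ x ∈ L, ∃ y ∈ M, F.Adj x y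

theorem Fb.symm {F : SimpleGraph W} {L M : Set W} (h : Fb F L M) : Fb F M L := by
  obtain ⟨x, hx, y, hy, h⟩ := h
  exact ⟨y, hy, x, hx, h.symm⟩

theorem Fb.mono {F : SimpleGraph W} {L M L' M' : Set W} (h : Fb F L M) (hL : L ⊆ L') (hM : M ⊆ M') :
    Fb F L' M' := by
  obtain ⟨x, hx, y, hy, h⟩ := h
  exact ⟨x, hL hx, y, hM hy, h⟩

structure CoreHyp (K F : SimpleGraph W) (Lf : W → Prop) : Prop where
  hle : F ≤ K
  h3 : ∃ a b c, a ≠ b ∧ a ≠ c ∧ b ≠ c ∧ ∀ d, Lf d ↔ d = a ∨ d = b ∨ d = c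
  leafF : ∀ a z, Lf a → ¬ F.Adj a z
  sapA : ∀ L M P, Tri K Lf L M P → Fb F L L → Fb F M M → Fb F P P → False
  sapB : ∀ L M P, Tri K Lf L M P → Cn (K \ F) L → Cn (K \ F) M → Fb F L M → Fb F P P → False
  hH1 : ∀ s1 s2 D, ClosedD K Lf s1 s2 D →
    ¬ ∀ x y, F.Adj x y → x = s1 ∨ y = s1 ∨ (x ∈ insert s2 D ∧ y ∈ insert s2 D)
  hH2 : ∃ x1 y1 x2 y2, F.Adj x1 y1 ∧ F.Adj x2 y2 ∧ x1 ≠ x2 ∧ x1 ≠ y2 ∧ y1 ≠ x2 ∧ y1 ≠ y2 ∧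
    ∀ s1 s2 D, ClosedD K Lf s1 s2 D → ∃ z, (z = x1 ∨ z = y1 ∨ z = x2 ∨ z = y2) ∧
      z ∉ D ∧ z ≠ s1 ∧ z ≠ s2

def Ext (K : SimpleGraph W) (S L M P : Set W) : Prop :=
  ∀ x y, x ∉ S → K.Adj x y → (y ∈ L ∨ y ∈ M ∨ y ∈ P) → (x ∈ L ∨ x ∈ M ∨ x ∈ P)

theorem Cn.ofFree {K F : SimpleGraph W} {C : Set W} (h : Cn K C) (hF : ¬ Fb F C C) :
    Cn (K \ F) C := by
  intro u hu v hv
  refine Relation.ReflTransGen.mono ?_ _ _ (h u hu v hv)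
  rintro p q ⟨h1, h2, h3⟩
  exact ⟨⟨h1, fun h => hF ⟨p, h2, q, h3, h⟩⟩, h2, h3⟩

theorem Tri.extend [Finite W] {K : SimpleGraph W} {Lf : W → Prop} {L M P : Set W} (S : Set W)
    (h : Tri K Lf L M P) (hL : ∀ x ∈ L, x ∉ S) (hM : ∀ x ∈ M, x ∉ S) (hP : ∀ x ∈ P, x ∉ S) :
    ∃ L' M' P', L ⊆ L' ∧ M ⊆ M' ∧ P ⊆ P' ∧ Tri K Lf L' M' P' ∧ (∀ x ∈ L', x ∉ S) ∧
      (∀ x ∈ M', x ∉ S) ∧ (∀ x ∈ P', x ∉ S) ∧ Ext K S L' M' P' := by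
  generalize hn : (L ∪ M ∪ P)ᶜ.ncard = n
  induction n using Nat.strong_induction_on generalizing L M P with
  | _ n ih =>
  by_cases hE : Ext K S L M P
  · exact ⟨L, M, P, le_rfl, le_rfl, le_rfl, h, hL, hM, hP, hE⟩
  unfold Ext at hE
  push Not at hE
  obtain ⟨x, y, hxS, hxy, hy, hx1, hx2, hx3⟩ := hE
  have hlt : ∀ A : Set W, (L ∪ M ∪ P) ⊆ A → x ∈ A → Aᶜ.ncard < n := by
    intro A hA hxA
    rw [← hn]
    apply Set.ncard_lt_ncard _ (Set.toFinite _)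
    refine ⟨Set.compl_subset_compl.2 hA, fun hh => ?_⟩
    exact hh (by simp [hx1, hx2, hx3] : x ∈ (L ∪ M ∪ P)ᶜ) hxA
  have hins : ∀ C : Set W, (∀ x ∈ C, x ∉ S) → ∀ z ∈ insert x C, z ∉ S := by
    rintro C hC z (rfl | hz)
    · exact hxS
    · exact hC z hz
  rcases hy with hy | hy | hy
  · have ht : Tri K Lf (insert x L) M P := (h.rot.ins hx2 hx3 hy hxy.symm).rot.rot
    obtain ⟨L', M', P', h1, h2, h3, h4⟩ := ih _ (hlt (insert x L ∪ M ∪ P)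
      (by intro z; simp; tauto) (by simp)) ht (hins L hL) hM hP rfl
    exact ⟨L', M', P', (Set.subset_insert _ _).trans h1, h2, h3, h4⟩
  · have ht : Tri K Lf L (insert x M) P := (h.rot.rot.ins hx3 hx1 hy hxy.symm).rot
    obtain ⟨L', M', P', h1, h2, h3, h4⟩ := ih _ (hlt (L ∪ insert x M ∪ P)
      (by intro z; simp; tauto) (by simp)) ht hL (hins M hM) hP rfl
    exact ⟨L', M', P', h1, (Set.subset_insert _ _).trans h2, h3, h4⟩
  · have ht : Tri K Lf L M (insert x P) := (h.ins hx1 hx2 hy hxy.symm)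
    obtain ⟨L', M', P', h1, h2, h3, h4⟩ := ih _ (hlt (L ∪ M ∪ insert x P)
      (by intro z; simp; tauto) (by simp)) ht hL hM (hins P hP) rfl
    exact ⟨L', M', P', h1, h2, (Set.subset_insert _ _).trans h3, h4⟩

variable {K F : SimpleGraph W} {Lf : W → Prop}

theorem CoreHyp.leaf_mem (h : CoreHyp K F Lf) {L M P : Set W} (ht : Tri K Lf L M P) {d : W}
    (hd : Lf d) : d ∈ L ∨ d ∈ M ∨ d ∈ P := by
  obtain ⟨a, b, c, hab, hac, hbc, hl⟩ := h.h3
  obtain ⟨a', h1, h1'⟩ := ht.lL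
  obtain ⟨b', h2, h2'⟩ := ht.lM
  obtain ⟨c', h3, h3'⟩ := ht.lP
  have e1 : a' ≠ b' := fun e => ht.dLM _ h1 (e ▸ h2)
  have e2 : a' ≠ c' := fun e => ht.dLP _ h1 (e ▸ h3)
  have e3 : b' ≠ c' := fun e => ht.dMP _ h2 (e ▸ h3)
  have : d = a' ∨ d = b' ∨ d = c' := by
    rw [hl] at hd h1' h2' h3'
    rcases h1' with rfl | rfl | rfl <;> rcases h2' with rfl | rfl | rfl <;>
      rcases h3' with rfl | rfl | rfl <;> simp_all <;> tauto
  rcases this with rfl | rfl | rfl <;> tauto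

structure Config (K F : SimpleGraph W) (Lf : W → Prop) (v : W) (L M P : Set W) : Prop where
  tri : Tri K Lf L M P
  vL : v ∉ L
  vM : v ∉ M
  vP : v ∉ P
  fL : ∃ x ∈ L, F.Adj v x
  fM : ∃ x ∈ M, F.Adj v x
  fP : Fb F P P

theorem Config.swap {v : W} {L M P : Set W} (h : Config K F Lf v L M P) : Config K F Lf v M L P :=
  ⟨h.tri.swap, h.vM, h.vL, h.vP, h.fM, h.fL, h.fP⟩

structure Star (K F : SimpleGraph W) (Lf : W → Prop) (v w : W) (L M P : Set W) : Prop where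
  tri : Tri K Lf L M P
  ne : v ≠ w
  vL : v ∉ L
  vM : v ∉ M
  vP : v ∉ P
  wL : w ∉ L
  wM : w ∉ M
  wP : w ∉ P
  fvL : ∃ x ∈ L, F.Adj v x
  fvM : ∃ x ∈ M, F.Adj v x
  fwL : ∃ x ∈ L, F.Adj w x
  fwP : ∃ x ∈ P, F.Adj w x

theorem Fb.insL {v : W} {C : Set W} (h : ∃ x ∈ C, F.Adj v x) : Fb F (insert v C) (insert v C) := by
  obtain ⟨x, h1, h2⟩ := h
  exact ⟨v, Or.inl rfl, x, Or.inr h1, h2⟩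

theorem Star.swap {v w : W} {L M P : Set W} (h : Star K F Lf v w L M P) :
    Star K F Lf w v L P M :=
  ⟨h.tri.swap.rot, h.ne.symm, h.wL, h.wP, h.wM, h.vL, h.vP, h.vM, h.fwL, h.fwP, h.fvL, h.fvM⟩

/-- consequences of a star: one side -/
theorem CoreHyp.star_out (h : CoreHyp K F Lf) {v w : W} {L M P : Set W}
    (s : Star K F Lf v w L M P) :
    (¬ Fb F L L ∧ ¬ Fb F M M ∧ ¬ Fb F P P ∧ ¬ Fb F L M ∧ ¬ Fb F L P ∧ ¬ Fb F M P) ∧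
    (∀ x, K.Adj v x → ¬ F.Adj v x → x ∉ L ∧ x ∉ M ∧ x ∉ P) ∧
    (∀ x, K.Adj w x → ¬ F.Adj w x → x ∉ L ∧ x ∉ M ∧ x ∉ P) := by
  -- three key instances
  have key : ∀ {v w : W} {L M P : Set W}, Star K F Lf v w L M P →
      Tri K Lf L (insert v M) (insert w P) ∧ Tri K Lf M (insert v L) (insert w P) ∧
      Tri K Lf L M (insert w P) ∧ Tri K Lf M P (insert v L) := by
    intro v w L M P s
    obtain ⟨x1, hx1, e1⟩ := s.fvL
    obtain ⟨x2, hx2, e2⟩ := s.fvM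
    obtain ⟨x3, hx3, e3⟩ := s.fwL
    obtain ⟨x4, hx4, e4⟩ := s.fwP
    have a1 : Tri K Lf L M (insert w P) := s.tri.ins s.wL s.wM hx4 (h.hle e4.symm)
    have hv : v ∉ insert w P := by rintro (h | h); exacts [s.ne h, s.vP h]
    have hw : w ∉ insert v P := by rintro (h | h); exacts [s.ne h.symm, s.wP h]
    refine ⟨?_, ?_, a1, ?_⟩
    · exact (a1.rot.rot.ins hv s.vL hx2 (h.hle e2.symm)).rot
    · exact (a1.swap.rot.rot.ins hv s.vM hx1 (h.hle e1.symm)).rot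
    · exact s.tri.rot.ins s.vM s.vP hx1 (h.hle e1.symm)
  obtain ⟨t1, t2, t3, t4⟩ := key s
  obtain ⟨u1, u2, u3, u4⟩ := key s.swap
  have hL : ¬ Fb F L L := fun hf => h.sapA _ _ _ t1 hf (Fb.insL s.fvM) (Fb.insL s.fwP)
  have hM : ¬ Fb F M M := fun hf => h.sapA _ _ _ t2 hf (Fb.insL s.fvL) (Fb.insL s.fwP)
  have hP : ¬ Fb F P P := fun hf => h.sapA _ _ _ u2 hf (Fb.insL s.fwL) (Fb.insL s.fvM)
  have cL := s.tri.cL.ofFree hL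
  have cM := s.tri.cM.ofFree hM
  have cP := s.tri.cP.ofFree hP
  have key2 : ∀ {v w : W} {L M P : Set W}, Star K F Lf v w L M P → Cn (K \ F) L →
      Cn (K \ F) M → Cn (K \ F) P →
      ∀ x, K.Adj v x → ¬ F.Adj v x → x ∉ L ∧ x ∉ M ∧ x ∉ P := by
    intro v w L M P s cL cM cP x hvx hnf
    obtain ⟨t1, t2, t3, t4⟩ := key s
    obtain ⟨u1, u2, u3, u4⟩ := key s.swap
    have hvx' : (K \ F).Adj x v := ⟨hvx.symm, fun h => hnf h.symm⟩
    obtain ⟨x1, hx1, e1⟩ := s.fvL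
    obtain ⟨x2, hx2, e2⟩ := s.fvM
    refine ⟨fun hx => ?_, fun hx => ?_, fun hx => ?_⟩
    · exact h.sapB _ _ _ t2 cM (cL.ins hx hvx') ⟨x2, hx2, v, Or.inl rfl, e2.symm⟩ (Fb.insL s.fwP)
    · exact h.sapB _ _ _ t1 cL (cM.ins hx hvx') ⟨x1, hx1, v, Or.inl rfl, e1.symm⟩ (Fb.insL s.fwP)
    · have t5 : Tri K Lf M (insert v P) (insert w L) := by
        refine (u4.rot.ins (v := v) (z := x) s.vM ?_ hx hvx.symm).swap.rot
        rintro (h | h)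
        exacts [s.ne h, s.vL h]
      exact h.sapB _ _ _ t5 cM (cP.ins hx hvx') ⟨x2, hx2, v, Or.inl rfl, e2.symm⟩ (Fb.insL s.fwL)
  refine ⟨⟨hL, hM, hP, fun hf => h.sapB _ _ _ t3 cL cM hf (Fb.insL s.fwP),
    fun hf => h.sapB _ _ _ u3 cL cP hf (Fb.insL s.fvM),
    fun hf => h.sapB _ _ _ t4 cM cP hf (Fb.insL s.fvL)⟩, key2 s cL cM cP, ?_⟩
  intro x h1 h2
  obtain ⟨e1, e2, e3⟩ := key2 s.swap cL cP cM x h1 h2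
  exact ⟨e1, e3, e2⟩

def CoreConcl (K F : SimpleGraph W) (Lf : W → Prop) : Prop :=
  ∃ v w D, v ≠ w ∧ ClosedD K Lf v w D ∧
    (∀ x y, F.Adj x y → x = v ∨ x = w ∨ y = v ∨ y = w ∨ (x ∈ D ∧ y ∈ D)) ∧
    (∀ x, K.Adj v x → ¬ F.Adj v x → x ∈ D ∨ x = w) ∧
    (∀ x, K.Adj w x → ¬ F.Adj w x → x ∈ D ∨ x = v)

theorem CoreHyp.step3 [Finite W] (h : CoreHyp K F Lf) {v w : W} {L M P : Set W}
    (s : Star K F Lf v w L M P) : CoreConcl K F Lf := by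
  obtain ⟨L', M', P', hL, hM, hP, ht, aL, aM, aP, hE⟩ := s.tri.extend {v, w}
    (by rintro x hx (rfl | rfl); exacts [s.vL hx, s.wL hx])
    (by rintro x hx (rfl | rfl); exacts [s.vM hx, s.wM hx])
    (by rintro x hx (rfl | rfl); exacts [s.vP hx, s.wP hx])
  have s' : Star K F Lf v w L' M' P' := by
    refine ⟨ht, s.ne, fun h => aL v h (by simp), fun h => aM v h (by simp), fun h => aP v h (by simp),
      fun h => aL w h (by simp), fun h => aM w h (by simp), fun h => aP w h (by simp), ?_, ?_, ?_, ?_⟩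
    · obtain ⟨x, h1, h2⟩ := s.fvL; exact ⟨x, hL h1, h2⟩
    · obtain ⟨x, h1, h2⟩ := s.fvM; exact ⟨x, hM h1, h2⟩
    · obtain ⟨x, h1, h2⟩ := s.fwL; exact ⟨x, hL h1, h2⟩
    · obtain ⟨x, h1, h2⟩ := s.fwP; exact ⟨x, hP h1, h2⟩
  obtain ⟨⟨f1, f2, f3, f4, f5, f6⟩, gv, gw⟩ := h.star_out s'
  have hFT : ∀ x y, F.Adj x y → (x ∈ L' ∨ x ∈ M' ∨ x ∈ P') → ¬ (y ∈ L' ∨ y ∈ M' ∨ y ∈ P') := by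
    intro x y hxy hx hy
    rcases hx with hx | hx | hx <;> rcases hy with hy | hy | hy
    · exact f1 ⟨x, hx, y, hy, hxy⟩
    · exact f4 ⟨x, hx, y, hy, hxy⟩
    · exact f5 ⟨x, hx, y, hy, hxy⟩
    · exact f4 ⟨y, hy, x, hx, hxy.symm⟩
    · exact f2 ⟨x, hx, y, hy, hxy⟩
    · exact f6 ⟨x, hx, y, hy, hxy⟩
    · exact f5 ⟨y, hy, x, hx, hxy.symm⟩
    · exact f6 ⟨y, hy, x, hx, hxy.symm⟩
    · exact f3 ⟨x, hx, y, hy, hxy⟩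
  refine ⟨v, w, {z | z ≠ v ∧ z ≠ w ∧ ¬ (z ∈ L' ∨ z ∈ M' ∨ z ∈ P')}, s.ne,
    ⟨fun h => h.1 rfl, fun h => h.2.1 rfl, fun a ha hD => hD.2.2 (h.leaf_mem ht ha), ?_⟩, ?_, ?_, ?_⟩
  · intro d hd z hdz
    by_cases h1 : z = v
    · exact Or.inr (Or.inl h1)
    by_cases h2 : z = w
    · exact Or.inr (Or.inr h2)
    refine Or.inl ⟨h1, h2, fun hz => hd.2.2 (hE d z ?_ hdz hz)⟩
    rintro (h | h)
    exacts [hd.1 h, hd.2.1 h]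
  · intro x y hxy
    by_cases h1 : x = v
    · exact Or.inl h1
    by_cases h2 : x = w
    · exact Or.inr (Or.inl h2)
    by_cases h3 : y = v
    · exact Or.inr (Or.inr (Or.inl h3))
    by_cases h4 : y = w
    · exact Or.inr (Or.inr (Or.inr (Or.inl h4)))
    right; right; right; right
    have e1 : ∀ x y, F.Adj x y → x ≠ v → x ≠ w → ¬ (y ∈ L' ∨ y ∈ M' ∨ y ∈ P') := by
      intro x y hxy h1 h2 hy
      refine hFT x y hxy (hE x y ?_ (h.hle hxy) hy) hy
      rintro (h | h)
      exacts [h1 h, h2 h]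
    exact ⟨⟨h1, h2, e1 y x hxy.symm h3 h4⟩, ⟨h3, h4, e1 x y hxy h1 h2⟩⟩
  · intro x h1 h2
    obtain ⟨a1, a2, a3⟩ := gv x h1 h2
    by_cases hw : x = w
    · exact Or.inr hw
    · exact Or.inl ⟨fun e => h1.ne e.symm, hw, by tauto⟩
  · intro x h1 h2
    obtain ⟨a1, a2, a3⟩ := gw x h1 h2
    by_cases hw : x = v
    · exact Or.inr hw
    · exact Or.inl ⟨hw, fun e => h1.ne e.symm, by tauto⟩

theorem CoreHyp.step2 [Finite W] (h : CoreHyp K F Lf) {v : W} {L₀ M₀ P₀ : Set W}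
    (s : Config K F Lf v L₀ M₀ P₀) : CoreConcl K F Lf := by
  classical
  -- minimal extended config
  have hex : ∃ n, ∃ L M P, Config K F Lf v L M P ∧ Ext K {v} L M P ∧ P.ncard = n := by
    obtain ⟨L', M', P', hL, hM, hP, ht, aL, aM, aP, hE⟩ := s.tri.extend {v}
      (by rintro x hx rfl; exact s.vL hx)
      (by rintro x hx rfl; exact s.vM hx)
      (by rintro x hx rfl; exact s.vP hx)
    refine ⟨_, L', M', P', ⟨ht, fun h => aL v h (by simp), fun h => aM v h (by simp),
      fun h => aP v h (by simp), ?_, ?_, s.fP.mono hP hP⟩, hE, rfl⟩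
    · obtain ⟨x, h1, h2⟩ := s.fL; exact ⟨x, hL h1, h2⟩
    · obtain ⟨x, h1, h2⟩ := s.fM; exact ⟨x, hM h1, h2⟩
  clear s L₀ M₀ P₀
  obtain ⟨L, M, P, s, hE, hPn⟩ := Nat.find_spec hex
  have hmin : ∀ L' M' P', Config K F Lf v L' M' P' → Ext K {v} L' M' P' → P.ncard ≤ P'.ncard := by
    intro L' M' P' h1 h2
    rw [hPn]
    exact Nat.find_min' hex ⟨L', M', P', h1, h2, rfl⟩
  clear hPn hex
  obtain ⟨xl, hxl, el⟩ := s.fL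
  obtain ⟨xm, hxm, em⟩ := s.fM
  have t1 : Tri K Lf L (insert v M) P :=
    (s.tri.rot.rot.ins s.vP s.vL hxm (h.hle em.symm)).rot
  have t2 : Tri K Lf M (insert v L) P :=
    (s.tri.swap.rot.rot.ins s.vP s.vM hxl (h.hle el.symm)).rot
  have hLf : ¬ Fb F L L := fun hf => h.sapA _ _ _ t1 hf (Fb.insL s.fM) s.fP
  have hMf : ¬ Fb F M M := fun hf => h.sapA _ _ _ t2 hf (Fb.insL s.fL) s.fP
  have cL := s.tri.cL.ofFree hLf
  have cM := s.tri.cM.ofFree hMf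
  have hLM : ¬ Fb F L M := fun hf => h.sapB _ _ _ s.tri cL cM hf s.fP
  obtain ⟨c, hcP, hc⟩ := s.tri.lP
  have hcomp : ∀ p, p ∈ P → p ≠ c → ∃ A : Set W, c ∈ A ∧ A ⊆ P ∧ p ∉ A ∧ Cn K A ∧
      (∃ z ∈ A, K.Adj z p) ∧ (∀ z ∈ A, ∀ q ∈ P, K.Adj z q → q = p ∨ q ∈ A) ∧ Cn K (P \ A) :=
    fun p hp hpc => s.tri.cP.comp hp hcP hpc.symm
  choose! A a1 a2 a3 a4 a5 a6 a7 using hcomp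
  set P0 : Set W := {p | p ∈ P ∧ p ≠ c ∧ ∃ z, (z ∈ L ∨ z ∈ M) ∧ K.Adj p z} with hP0
  -- A p is F-free
  have aux : ∀ L M, Config K F Lf v L M P → Ext K {v} L M P → ∀ p, p ∈ P → p ≠ c →
      (∃ z ∈ L, K.Adj p z) → ¬ Fb F (A p) (A p) := by
    rintro L M s hE p hp hpc ⟨z, hz, hpz⟩ hf
    have hcfg : Config K F Lf v (L ∪ (P \ A p)) M (A p) := by
      refine ⟨⟨s.tri.cL.union_adj (a7 p hp hpc) hz ⟨hp, a3 p hp hpc⟩ hpz.symm, s.tri.cM, a4 p hp hpc,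
        ?_, ?_, fun x h1 h2 => s.tri.dMP x h1 (a2 p hp hpc h2), ?_, s.tri.lM, ⟨c, a1 p hp hpc, hc⟩⟩,
        ?_, s.vM, fun h => s.vP (a2 p hp hpc h), ?_, s.fM, hf⟩
      · rintro x (hx | hx) hx'
        · exact s.tri.dLM x hx hx'
        · exact s.tri.dMP x hx' hx.1
      · rintro x (hx | hx) hx'
        · exact s.tri.dLP x hx (a2 p hp hpc hx')
        · exact hx.2 hx'
      · obtain ⟨a, e1, e2⟩ := s.tri.lL
        exact ⟨a, Or.inl e1, e2⟩
      · rintro (hx | hx)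
        · exact s.vL hx
        · exact s.vP hx.1
      · obtain ⟨a, e1, e2⟩ := s.fL
        exact ⟨a, Or.inl e1, e2⟩
    have hext : Ext K {v} (L ∪ (P \ A p)) M (A p) := by
      intro x y hx hxy hy
      have hAP := a2 p hp hpc
      have := hE x y hx hxy (by
        rcases hy with (h1 | h1) | h1 | h1
        · exact Or.inl h1
        · exact Or.inr (Or.inr h1.1)
        · exact Or.inr (Or.inl h1)
        · exact Or.inr (Or.inr (hAP h1)))
      by_cases hxA : x ∈ A p
      · exact Or.inr (Or.inr hxA)
      · rcases this with h1 | h1 | h1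
        · exact Or.inl (Or.inl h1)
        · exact Or.inr (Or.inl h1)
        · exact Or.inl (Or.inr ⟨h1, hxA⟩)
    have h1 := hmin _ _ _ hcfg hext
    have h2 : (A p).ncard < P.ncard :=
      Set.ncard_lt_ncard ⟨a2 p hp hpc, fun hh => a3 p hp hpc (hh hp)⟩ (Set.toFinite _)
    omega
  have hE' : Ext K {v} M L P := by
    intro x y h1 h2 h3
    have := hE x y h1 h2 (by tauto)
    tauto
  have hAf : ∀ p ∈ P0, ¬ Fb F (A p) (A p) := by
    rintro p ⟨hp, hpc, z, hz | hz, hpz⟩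
    · exact aux L M s hE p hp hpc ⟨z, hz, hpz⟩
    · exact aux M L s.swap hE' p hp hpc ⟨z, hz, hpz⟩
  by_cases hcase : ∃ p ∈ P0, ∃ x ∈ A p, F.Adj p x
  · obtain ⟨p, hp0, x, hxA, hpx⟩ := hcase
    have hA := hAf p hp0
    obtain ⟨hp, hpc, z, hz, hpz⟩ := hp0
    have fin : ∀ L M, Config K F Lf v L M P → ¬ Fb F L L → z ∈ L → CoreConcl K F Lf := by
      intro L M s hLf hz
      have tA : Tri K Lf L M (A p) := ⟨s.tri.cL, s.tri.cM, a4 p hp hpc, s.tri.dLM,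
        fun x h1 h2 => s.tri.dLP x h1 (a2 p hp hpc h2),
        fun x h1 h2 => s.tri.dMP x h1 (a2 p hp hpc h2), s.tri.lL, s.tri.lM, ⟨c, a1 p hp hpc, hc⟩⟩
      have vA : v ∉ A p := fun h => s.vP (a2 p hp hpc h)
      have pL : p ∉ L := fun h => s.tri.dLP p h hp
      have pM : p ∉ M := fun h => s.tri.dMP p h hp
      have pv : v ≠ p := fun h => s.vP (h ▸ hp)
      have hF : F.Adj p z := by
        by_contra hnF
        obtain ⟨xm, hxm, em⟩ := s.fM
        have t3 : Tri K Lf (A p) L (insert v M) :=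
          (tA.rot.rot.ins vA s.vL hxm (h.hle em.symm))
        have t4 : Tri K Lf (A p) (insert p L) (insert v M) := by
          refine (t3.rot.rot.ins ?_ (a3 p hp hpc) hz hpz.symm).rot
          rintro (e | e)
          exacts [pv e.symm, pM e]
        exact h.sapB _ _ _ t4 ((a4 p hp hpc).ofFree hA)
          ((s.tri.cL.ofFree hLf).ins hz ⟨hpz.symm, fun e => hnF e.symm⟩)
          ⟨x, hxA, p, Or.inl rfl, hpx.symm⟩ (Fb.insL s.fM)
      exact h.step3 (v := v) (w := p) (L := L) (M := M) (P := A p)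
        ⟨tA, pv, s.vL, s.vM, vA, pL, pM, a3 p hp hpc, s.fL, s.fM, ⟨z, hz, hF⟩, ⟨x, hxA, hpx⟩⟩
    rcases hz with hz | hz
    · exact fin L M s hLf hz
    · exact fin M L s.swap hMf hz
  exfalso
  have hcase : ∀ p ∈ P0, ∀ x ∈ A p, ¬ F.Adj p x := by
    intro p hp x hx hpx
    exact hcase ⟨p, hp, x, hx, hpx⟩
  have hApf : ∀ p ∈ P0, ¬ Fb F (insert p (A p)) (insert p (A p)) := by
    rintro p hp ⟨x, (rfl | hx), y, (rfl | hy), hxy⟩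
    · exact F.irrefl hxy
    · exact hcase _ hp y hy hxy
    · exact hcase _ hp x hx hxy.symm
    · exact hAf p hp ⟨x, hx, y, hy, hxy⟩
  have noPaux : ∀ L M, Config K F Lf v L M P → ¬ Fb F L L → (∀ z ∈ L, z ∈ L ∨ z ∈ M) →
      (∀ p ∈ P, p ≠ c → ∀ z ∈ L, K.Adj p z → p ∈ P0) → ¬ Fb F P L := by
    rintro L M s hLf - hin ⟨p, hp, z, hz, hpz⟩
    have hpc : p ≠ c := by rintro rfl; exact h.leafF _ _ hc hpz
    have hp0 := hin p hp hpc z hz (h.hle hpz)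
    obtain ⟨xm, hxm, em⟩ := s.fM
    obtain ⟨zz, hzz, ezz⟩ := a5 p hp hpc
    have tA : Tri K Lf L M (insert p (A p)) := ⟨s.tri.cL, s.tri.cM, (a4 p hp hpc).ins hzz ezz,
      s.tri.dLM, (by
        rintro x hx (rfl | h')
        · exact s.tri.dLP _ hx hp
        · exact s.tri.dLP _ hx (a2 p hp hpc h')), (by
        rintro x hx (rfl | h')
        · exact s.tri.dMP _ hx hp
        · exact s.tri.dMP _ hx (a2 p hp hpc h')), s.tri.lL, s.tri.lM, ⟨c, Or.inr (a1 p hp hpc), hc⟩⟩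
    have vA : v ∉ insert p (A p) := by
      rintro (e | e)
      · exact s.vP (e ▸ hp)
      · exact s.vP (a2 p hp hpc e)
    have t3 : Tri K Lf (insert p (A p)) L (insert v M) :=
      (tA.rot.rot.ins vA s.vL hxm (h.hle em.symm))
    exact h.sapB _ _ _ t3 (t3.cL.ofFree (hApf p hp0)) (s.tri.cL.ofFree hLf)
      ⟨p, Or.inl rfl, z, hz, hpz⟩ (Fb.insL s.fM)
  have hPL : ¬ Fb F P L := noPaux L M s hLf (by tauto)
    (fun p hp hpc z hz hpz => ⟨hp, hpc, z, Or.inl hz, hpz⟩)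
  have hPM : ¬ Fb F P M := noPaux M L s.swap hMf (by tauto)
    (fun p hp hpc z hz hpz => ⟨hp, hpc, z, Or.inr hz, hpz⟩)
  -- the separating vertex
  obtain ⟨t, B, htP, hBP, htB, hBcl, hBf, hBP0, hcB⟩ : ∃ (t : W) (B : Set W), t ∈ P ∧ B ⊆ P ∧ t ∉ B ∧
      (∀ z ∈ B, ∀ q ∈ P, K.Adj z q → q = t ∨ q ∈ B) ∧ ¬ Fb F (insert t B) B ∧
      (∀ q ∈ P0, q = t ∨ q ∈ B) ∧ (c = t ∨ c ∈ B) := by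
    by_cases hne : P0.Nonempty
    · obtain ⟨p, hp0, hpm⟩ := (Set.toFinite P0).exists_maximalFor (fun p => (A p).ncard) P0 hne
      obtain ⟨hp, hpc, hp2⟩ := hp0
      have hp0 : p ∈ P0 := ⟨hp, hpc, hp2⟩
      refine ⟨p, A p, hp, a2 p hp hpc, a3 p hp hpc, a6 p hp hpc,
        fun hf => hApf p hp0 (hf.mono le_rfl (Set.subset_insert _ _)), ?_, Or.inr (a1 p hp hpc)⟩
      intro q hq0
      by_contra hcon
      push Not at hcon
      obtain ⟨hq, hqc, hq2⟩ := hq0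
      have hsub : insert p (A p) ⊆ A q := by
        have e1 : A p ⊆ A q := by
          intro z hz
          by_contra hzq
          obtain ⟨x, y, hxy, hx, hy, hxA, hyA⟩ := (a4 p hp hpc c (a1 p hp hpc) z hz).exit (A q)
            (a1 q hq hqc) hzq
          rcases a6 q hq hqc x hx y (a2 p hp hpc hyA) hxy with e | e
          · exact hcon.2 (e ▸ hyA)
          · exact hy e
        rintro z (rfl | hz)
        · obtain ⟨u, hu, hup⟩ := a5 z hp hpc
          rcases a6 q hq hqc u (e1 hu) z hp hup with e | e
          · exact absurd e.symm hcon.1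
          · exact e
        · exact e1 hz
      have hlt : (A p).ncard < (A q).ncard := by
        apply Set.ncard_lt_ncard _ (Set.toFinite _)
        exact ⟨(Set.subset_insert _ _).trans hsub, fun hh => a3 p hp hpc (hh (hsub (Or.inl rfl)))⟩
      have := hpm (j := q) ⟨hq, hqc, hq2⟩ hlt.le
      simp only at this
      omega
    · refine ⟨c, ∅, hcP, by simp, by simp, by simp, ?_, ?_, Or.inl rfl⟩
      · rintro ⟨x, hx, y, hy, hxy⟩; exact hy
      · intro q hq; exact absurd ⟨q, hq⟩ hne
  have hvt : v ≠ t := fun e => s.vP (e ▸ htP)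
  set T : Set W := {z | z ∈ L ∨ z ∈ M ∨ z ∈ B} with hT
  -- neighbours of T
  have hTn : ∀ x y, y ∈ T → K.Adj x y → x = v ∨ x = t ∨ x ∈ T := by
    intro x y hy hxy
    by_cases hxv : x = v
    · exact Or.inl hxv
    right
    have hx := hE x y hxv hxy (by
      rcases hy with h1 | h1 | h1
      exacts [Or.inl h1, Or.inr (Or.inl h1), Or.inr (Or.inr (hBP h1))])
    rcases hx with hx | hx | hx
    · exact Or.inr (Or.inl hx)
    · exact Or.inr (Or.inr (Or.inl hx))
    · have e : x = t ∨ x ∈ B := by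
        by_cases hxc : x = c
        · rw [hxc]; exact hcB
        rcases hy with h1 | h1 | h1
        · exact hBP0 x ⟨hx, hxc, y, Or.inl h1, hxy⟩
        · exact hBP0 x ⟨hx, hxc, y, Or.inr h1, hxy⟩
        · exact hBcl y h1 x hx hxy.symm
      rcases e with e | e
      · exact Or.inl e
      · exact Or.inr (Or.inr (Or.inr e))
  have htT : t ∉ T := by
    rintro (e | e | e)
    exacts [s.tri.dLP t e htP, s.tri.dMP t e htP, htB e]
  have hTf : ∀ x y, F.Adj x y → x ∈ T → y ∈ insert t T → False := by
    intro x y hxy hx hy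
    have hP : ∀ z, z ∈ insert t T → z ∈ L ∨ z ∈ M ∨ (z ∈ P ∧ z ∈ insert t B) := by
      rintro z (rfl | h1 | h1 | h1)
      · exact Or.inr (Or.inr ⟨htP, Or.inl rfl⟩)
      · exact Or.inl h1
      · exact Or.inr (Or.inl h1)
      · exact Or.inr (Or.inr ⟨hBP h1, Or.inr h1⟩)
    rcases hP y hy with hy | hy | ⟨hy, hy'⟩ <;> rcases hx with hx | hx | hx
    · exact hLf ⟨x, hx, y, hy, hxy⟩
    · exact hLM ⟨y, hy, x, hx, hxy.symm⟩
    · exact hPL ⟨x, hBP hx, y, hy, hxy⟩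
    · exact hLM ⟨x, hx, y, hy, hxy⟩
    · exact hMf ⟨x, hx, y, hy, hxy⟩
    · exact hPM ⟨x, hBP hx, y, hy, hxy⟩
    · exact hPL ⟨y, hy, x, hx, hxy.symm⟩
    · exact hPM ⟨y, hy, x, hx, hxy.symm⟩
    · exact hBf ⟨y, hy', x, hx, hxy.symm⟩
  refine h.hH1 v t {z | z ≠ v ∧ z ≠ t ∧ z ∉ T} ⟨fun e => e.1 rfl, fun e => e.2.1 rfl, ?_, ?_⟩ ?_
  · rintro a ha ⟨e1, e2, e3⟩
    have h3 := h.h3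
    rcases h.leaf_mem s.tri ha with e | e | e
    · exact e3 (Or.inl e)
    · exact e3 (Or.inr (Or.inl e))
    · have : a = c := by
        obtain ⟨a', b1, b2⟩ := s.tri.lL
        obtain ⟨b', b3, b4⟩ := s.tri.lM
        have n1 : a' ≠ b' := fun e => s.tri.dLM _ b1 (e ▸ b3)
        have n2 : a' ≠ c := fun e => s.tri.dLP _ b1 (e ▸ hcP)
        have n3 : b' ≠ c := fun e => s.tri.dMP _ b3 (e ▸ hcP)
        have n4 : a' ≠ a := fun e' => s.tri.dLP _ b1 (e' ▸ e)
        have n5 : b' ≠ a := fun e' => s.tri.dMP _ b3 (e' ▸ e)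
        obtain ⟨p, q, r, hpq, hpr, hqr, hl⟩ := h3
        rw [hl] at ha hc b2 b4
        clear * - ha hc b2 b4 n1 n2 n3 n4 n5
        grind
      rw [this] at e2 e3
      rcases hcB with e' | e'
      · exact e2 e'
      · exact e3 (Or.inr (Or.inr e'))
  · rintro d ⟨d1, d2, d3⟩ z hdz
    by_cases hzv : z = v
    · exact Or.inr (Or.inl hzv)
    by_cases hzt : z = t
    · exact Or.inr (Or.inr hzt)
    refine Or.inl ⟨hzv, hzt, fun hz => ?_⟩
    rcases hTn d z hz hdz with e | e | e
    exacts [d1 e, d2 e, d3 e]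
  · intro x y hxy
    by_cases hxv : x = v
    · exact Or.inl hxv
    by_cases hyv : y = v
    · exact Or.inr (Or.inl hyv)
    right; right
    have e : ∀ x y, F.Adj x y → x ≠ v → y ∉ T := by
      intro x y hxy hxv hy
      rcases hTn x y hy (h.hle hxy) with e | e | e
      · exact hxv e
      · exact hTf y x hxy.symm hy (Or.inl e)
      · exact hTf y x hxy.symm hy (Or.inr e)
    constructor
    · by_cases hxt : x = t
      · exact Or.inl hxt
      · exact Or.inr ⟨hxv, hxt, e y x hxy.symm hyv⟩
    · by_cases hyt : y = t
      · exact Or.inl hyt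
      · exact Or.inr ⟨hyv, hyt, e x y hxy hxv⟩

end CoreThm

section CoreStepOne
variable {W : Type*} {K F : SimpleGraph W} {Lf : W → Prop}

theorem CoreHyp.step1core [Finite W] (h : CoreHyp K F Lf) {A1 A2 A3 : Set W} {b1 b2 b3 b4 : W}
    (t : Tri K Lf A1 A2 A3) (hB : ∀ b, b = b1 ∨ b = b2 ∨ b = b3 ∨ b = b4 → b ∉ A1 ∧ b ∉ A2 ∧ b ∉ A3)
    (n12 : b1 ≠ b2) (n13 : b1 ≠ b3) (n14 : b1 ≠ b4) (n23 : b2 ≠ b3) (n24 : b2 ≠ b4)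
    (h1 : ∃ z ∈ A1, K.Adj z b1) (h2 : ∃ z ∈ A2, K.Adj z b2) (h3 : ∃ z ∈ A3, K.Adj z b3)
    (f12 : F.Adj b1 b2) (f34 : F.Adj b3 b4) : CoreConcl K F Lf := by
  obtain ⟨z1, hz1, e1⟩ := h1
  obtain ⟨z2, hz2, e2⟩ := h2
  obtain ⟨z3, hz3, e3⟩ := h3
  obtain ⟨b11, b12, b13⟩ := hB b1 (by simp)
  obtain ⟨b21, b22, b23⟩ := hB b2 (by simp)
  obtain ⟨b31, b32, b33⟩ := hB b3 (by simp)
  obtain ⟨b41, b42, b43⟩ := hB b4 (by simp)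
  set P : Set W := insert b4 (insert b3 A3) with hP
  have t1 : Tri K Lf A1 A2 P :=
    (t.ins b31 b32 hz3 e3).ins b41 b42 (Or.inl rfl) (h.hle f34)
  have hPf : Fb F P P := ⟨b3, Or.inr (Or.inl rfl), b4, Or.inl rfl, f34⟩
  have b1P : b1 ∉ P := by
    rintro (e | e | e)
    exacts [n14 e, n13 e, b13 e]
  have b2P : b2 ∉ P := by
    rintro (e | e | e)
    exacts [n24 e, n23 e, b23 e]
  have tM : Tri K Lf A1 (insert b2 A2) P := (t1.rot.rot.ins b2P b21 hz2 e2).rot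
  have tL : Tri K Lf A2 (insert b1 A1) P := (t1.swap.rot.rot.ins b1P b12 hz1 e1).rot
  by_cases c1 : ∃ x ∈ A1, F.Adj b1 x
  · refine h.step2 (v := b1) (L₀ := A1) (M₀ := insert b2 A2) (P₀ := P)
      ⟨tM, b11, ?_, b1P, c1, ⟨b2, Or.inl rfl, f12⟩, hPf⟩
    rintro (e | e)
    exacts [n12 e, b12 e]
  by_cases c2 : ∃ x ∈ A2, F.Adj b2 x
  · refine h.step2 (v := b2) (L₀ := A2) (M₀ := insert b1 A1) (P₀ := P)
      ⟨tL, b22, ?_, b2P, c2, ⟨b1, Or.inl rfl, f12.symm⟩, hPf⟩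
    rintro (e | e)
    exacts [n12 e.symm, b21 e]
  exfalso
  have f1 : ¬ Fb F A1 A1 := fun hf => by
    have t5 : Tri K Lf A1 (insert b1 (insert b2 A2)) P :=
      (tM.rot.rot.ins b1P b11 (Or.inl rfl) (h.hle f12.symm)).rot
    exact h.sapA _ _ _ t5 hf ⟨b1, Or.inl rfl, b2, Or.inr (Or.inl rfl), f12⟩ hPf
  have f2 : ¬ Fb F A2 A2 := fun hf => by
    have t5 : Tri K Lf A2 (insert b2 (insert b1 A1)) P :=
      (tL.rot.rot.ins b2P b22 (Or.inl rfl) (h.hle f12)).rot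
    exact h.sapA _ _ _ t5 hf ⟨b2, Or.inl rfl, b1, Or.inr (Or.inl rfl), f12.symm⟩ hPf
  have t6 : Tri K Lf (insert b2 A2) (insert b1 A1) P := by
    refine (tM.swap.rot.rot.ins b1P ?_ hz1 e1).rot
    rintro (e | e)
    exacts [n12 e, b12 e]
  refine h.sapB _ _ _ t6 ?_ ?_ ⟨b2, Or.inl rfl, b1, Or.inl rfl, f12.symm⟩ hPf
  · exact (t.cM.ofFree f2).ins hz2 ⟨e2, fun e => c2 ⟨z2, hz2, e.symm⟩⟩
  · exact (t.cL.ofFree f1).ins hz1 ⟨e1, fun e => c1 ⟨z1, hz1, e.symm⟩⟩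

theorem core [Finite W] (h : CoreHyp K F Lf) : CoreConcl K F Lf := by
  classical
  obtain ⟨a, b, c, hab, hac, hbc, hl⟩ := h.h3
  obtain ⟨x1, y1, x2, y2, f1, f2, n1, n2, n3, n4, hH2⟩ := h.hH2
  set B : Set W := {z | z = x1 ∨ z = y1 ∨ z = x2 ∨ z = y2} with hB
  have hA3 : ({a, b, c} : Finset W).card = 3 := by
    rw [Finset.card_eq_three]; exact ⟨a, b, c, hab, hac, hbc, rfl⟩
  have hlA : ∀ d, d ∈ (({a, b, c} : Finset W) : Set W) ↔ Lf d := by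
    intro d; rw [hl]; simp
  obtain ⟨C, hC, hCd⟩ := menger K {a, b, c} B (by
    intro S hS
    rw [hA3]
    by_contra hlt
    obtain ⟨s1, s2, hs⟩ : ∃ s1 s2, ∀ z ∈ S, z = s1 ∨ z = s2 := by
      have : S.card = 0 ∨ S.card = 1 ∨ S.card = 2 := by omega
      rcases this with e | e | e
      · rw [Finset.card_eq_zero] at e
        exact ⟨a, a, by simp [e]⟩
      · obtain ⟨s, e⟩ := Finset.card_eq_one.1 e
        exact ⟨s, s, by simp [e]⟩
      · obtain ⟨s, s', -, e⟩ := Finset.card_eq_two.1 e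
        exact ⟨s, s', by simp [e]⟩
    obtain ⟨z, hz, hz1, hz2, hz3⟩ := hH2 s1 s2
      {z | z ≠ s1 ∧ z ≠ s2 ∧ ∀ d, Lf d → d ∉ ({s1, s2} : Set W) → ¬ Rc K ({s1, s2} : Set W)ᶜ d z} (by
      refine ⟨fun e => e.1 rfl, fun e => e.2.1 rfl, ?_, ?_⟩
      · rintro d hd ⟨d1, d2, d3⟩
        exact d3 d hd (by simp [d1, d2]) Rc.rfl
      · rintro d ⟨d1, d2, d3⟩ z hdz
        by_cases hz1 : z = s1
        · exact Or.inr (Or.inl hz1)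
        by_cases hz2 : z = s2
        · exact Or.inr (Or.inr hz2)
        refine Or.inl ⟨hz1, hz2, fun d' hd' hdS hr => ?_⟩
        exact d3 d' hd' hdS (hr.step hdz.symm (by simp [hz1, hz2]) (by simp [d1, d2])))
    have : ∃ d, Lf d ∧ d ∉ ({s1, s2} : Set W) ∧ Rc K ({s1, s2} : Set W)ᶜ d z := by
      by_contra hcon
      push Not at hcon
      exact hz1 ⟨hz2, hz3, hcon⟩
    obtain ⟨d, hd, hdS, hr⟩ := this
    have hsub : (S : Set W) ⊆ {s1, s2} := fun z hz => hs z hz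
    refine hS d ((hlA d).2 hd) (fun e => hdS (hsub e)) z hz (fun e => ?_)
      (hr.mono le_rfl (Set.compl_subset_compl.2 hsub))
    rcases hs z e with e | e
    exacts [hz2 e, hz3 e])
  have hBF : ∀ z ∈ B, ∃ w ∈ B, F.Adj z w := by
    rintro z (rfl | rfl | rfl | rfl)
    · exact ⟨y1, by simp [hB], f1⟩
    · exact ⟨x1, by simp [hB], f1.symm⟩
    · exact ⟨y2, by simp [hB], f2⟩
    · exact ⟨x2, by simp [hB], f2.symm⟩
  have htrim : ∀ d, d ∈ ({a, b, c} : Finset W) → ∃ A : Set W, A ⊆ C d ∧ d ∈ A ∧ Cn K A ∧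
      (∀ x ∈ A, x ∉ B) ∧ ∃ b' ∈ C d, b' ∈ B ∧ ∃ z ∈ A, K.Adj z b' := by
    intro d hd
    obtain ⟨g1, g2, b', g3, g4⟩ := hC d hd
    refine g2.trim g1 (fun e => ?_) g4 g3
    obtain ⟨w, -, hw⟩ := hBF d e
    exact h.leafF d w ((hlA d).1 (by exact_mod_cast hd)) hw
  have ma : a ∈ ({a, b, c} : Finset W) := by simp
  have mb : b ∈ ({a, b, c} : Finset W) := by simp
  have mc : c ∈ ({a, b, c} : Finset W) := by simp
  obtain ⟨A1, p1, q1, r1, s1, b1, u1, v1, w1⟩ := htrim a ma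
  obtain ⟨A2, p2, q2, r2, s2, b2, u2, v2, w2⟩ := htrim b mb
  obtain ⟨A3, p3, q3, r3, s3, b3, u3, v3, w3⟩ := htrim c mc
  have t : Tri K Lf A1 A2 A3 := ⟨r1, r2, r3,
    fun x e1 e2 => hCd a ma b mb hab x (p1 e1) (p2 e2),
    fun x e1 e2 => hCd a ma c mc hac x (p1 e1) (p3 e2),
    fun x e1 e2 => hCd b mb c mc hbc x (p2 e1) (p3 e2),
    ⟨a, q1, (hl a).2 (by simp)⟩, ⟨b, q2, (hl b).2 (by simp)⟩, ⟨c, q3, (hl c).2 (by simp)⟩⟩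
  have n12 : b1 ≠ b2 := fun e => hCd a ma b mb hab b1 u1 (e ▸ u2)
  have n13 : b1 ≠ b3 := fun e => hCd a ma c mc hac b1 u1 (e ▸ u3)
  have n23 : b2 ≠ b3 := fun e => hCd b mb c mc hbc b2 u2 (e ▸ u3)
  have hBo : ∀ z ∈ B, z ∉ A1 ∧ z ∉ A2 ∧ z ∉ A3 := fun z hz =>
    ⟨fun e => s1 z e hz, fun e => s2 z e hz, fun e => s3 z e hz⟩
  have cases3 : (F.Adj b1 b2 ∧ ∃ b4 ∈ B, F.Adj b3 b4 ∧ b4 ≠ b1 ∧ b4 ≠ b2) ∨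
      (F.Adj b1 b3 ∧ ∃ b4 ∈ B, F.Adj b2 b4 ∧ b4 ≠ b1 ∧ b4 ≠ b3) ∨
      (F.Adj b2 b3 ∧ ∃ b4 ∈ B, F.Adj b1 b4 ∧ b4 ≠ b2 ∧ b4 ≠ b3) := by
    have m1 : x1 ∈ B := by simp [hB]
    have m2 : y1 ∈ B := by simp [hB]
    have m3 : x2 ∈ B := by simp [hB]
    have m4 : y2 ∈ B := by simp [hB]
    have f1' := f1.symm
    have f2' := f2.symm
    rcases v1 with rfl | rfl | rfl | rfl <;> rcases v2 with rfl | rfl | rfl | rfl <;>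
      rcases v3 with rfl | rfl | rfl | rfl <;> first | contradiction | skip
    all_goals clear hH2 hC hCd hl hlA hA3 htrim hBo hBF t w1 w2 w3 s1 s2 s3 p1 p2 p3 hB; grind
  rcases cases3 with ⟨g1, b4, g2, g3, g4, g5⟩ | ⟨g1, b4, g2, g3, g4, g5⟩ | ⟨g1, b4, g2, g3, g4, g5⟩
  · refine h.step1core t (b1 := b1) (b2 := b2) (b3 := b3) (b4 := b4) ?_ n12 n13 g4.symm n23 g5.symm
      w1 w2 w3 g1 g3
    rintro z (rfl | rfl | rfl | rfl) <;> (apply hBo; assumption)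
  · refine h.step1core t.swap.rot (b1 := b1) (b2 := b3) (b3 := b2) (b4 := b4) ?_ n13 n12 g4.symm
      n23.symm g5.symm w1 w3 w2 g1 g3
    intro z hz
    have : z ∈ B := by rcases hz with rfl | rfl | rfl | rfl <;> assumption
    have := hBo z this
    tauto
  · refine h.step1core t.rot (b1 := b2) (b2 := b3) (b3 := b1) (b4 := b4) ?_ n23 n12.symm g4.symm
      n13.symm g5.symm w2 w3 w1 g1 g3
    intro z hz
    have : z ∈ B := by rcases hz with rfl | rfl | rfl | rfl <;> assumption
    have := hBo z this
    tauto

end CoreStepOne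

section TreeLemmas
variable {W : Type*} {G : SimpleGraph W}

theorem rc_iff_reachable {K : SimpleGraph W} {A : Set W} (u v : A) :
    (K.induce A).Reachable u v ↔ Rc K A u v := by
  rw [SimpleGraph.reachable_iff_reflTransGen]
  constructor
  · intro h
    induction h with
    | refl => exact Rc.rfl
    | tail _ h2 ih => exact ih.step h2 (Subtype.property _) (Subtype.property _)
  · intro h
    obtain ⟨v, hv⟩ := v
    simp only at h
    induction h with
    | refl => exact Relation.ReflTransGen.refl
    | tail h1 h2 ih =>
      exact Relation.ReflTransGen.tail (ih h2.2.1) h2.1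

theorem connected_iff_cn {K : SimpleGraph W} {A : Set W} :
    (K.induce A).Connected ↔ A.Nonempty ∧ Cn K A := by
  rw [SimpleGraph.connected_iff]
  constructor
  · rintro ⟨h1, h2⟩
    exact ⟨Set.nonempty_coe_sort.1 h2, fun u hu v hv => (rc_iff_reachable ⟨u, hu⟩ ⟨v, hv⟩).1 (h1 _ _)⟩
  · rintro ⟨h1, h2⟩
    exact ⟨fun u v => (rc_iff_reachable u v).2 (h2 _ u.2 _ v.2), Set.nonempty_coe_sort.2 h1⟩

structure Tr (G : SimpleGraph W) (A : Set W) : Prop where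
  ne : A.Nonempty
  cn : Cn G A
  br : ∀ p ∈ A, ∀ q ∈ A, G.Adj p q → ¬ Rc (G.deleteEdges {s(p, q)}) A p q

theorem Tr.isTree {A : Set W} (h : Tr G A) : (G.induce A).IsTree := by
  refine ⟨connected_iff_cn.2 ⟨h.ne, h.cn⟩, ?_⟩
  rw [SimpleGraph.isAcyclic_iff_forall_adj_isBridge]
  rintro ⟨p, hp⟩ ⟨q, hq⟩ hpq
  rw [SimpleGraph.isBridge_iff]
  intro hr
  apply h.br p hp q hq hpq
  rw [← rc_iff_reachable ⟨p, hp⟩ ⟨q, hq⟩]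
  refine hr.mono ?_
  rintro ⟨a, ha⟩ ⟨b, hb⟩ hab
  simp [SimpleGraph.deleteEdges_adj] at hab ⊢
  exact hab

theorem Tr.single (x : W) : Tr G {x} := by
  refine ⟨⟨x, rfl⟩, Cn.single x, ?_⟩
  rintro p rfl q rfl h
  exact absurd h (G.irrefl)

theorem Tr.leaf {A : Set W} (h : Tr G A) {x u : W} (hx : x ∉ A) (hu : u ∈ A) (hxu : G.Adj u x)
    (huniq : ∀ z ∈ A, G.Adj z x → z = u) : Tr G (insert x A) := by
  refine ⟨⟨x, Or.inl rfl⟩, h.cn.ins hu hxu, ?_⟩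
  have hxA : ∀ z ∈ insert x A, G.Adj x z → z = u := by
    rintro z (rfl | hz) hxz
    · exact absurd hxz G.irrefl
    · exact huniq z hz hxz.symm
  have iso : ∀ z, Rc (G.deleteEdges {s(x, u)}) (insert x A) x z → z = x := by
    intro z hz
    induction hz with
    | refl => rfl
    | tail _ h2 ih =>
      subst ih
      have := hxA _ h2.2.2 h2.1.1
      subst this
      simp at h2
  rintro p (rfl | hp) q (rfl | hq) hpq hr
  · exact G.irrefl hpq
  · have := huniq q hq hpq.symm
    subst this
    exact hpq.ne (iso _ hr).symm
  · have := huniq p hp hpq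
    subst this
    rw [Sym2.eq_swap] at hr
    exact hpq.ne (iso _ hr.symm)
  · have key : ∀ z, Rc (G.deleteEdges {s(p, q)}) (insert x A) p z →
        Rc (G.deleteEdges {s(p, q)}) A p (if z = x then u else z) := by
      intro z hz
      induction hz with
      | refl =>
        rw [if_neg (by rintro rfl; exact hx hp)]
        exact Rc.rfl
      | tail _ h2 ih =>
        rename_i b c _
        rcases h2.2.1 with rfl | hb
        · rw [if_pos rfl] at ih
          have := hxA c h2.2.2 h2.1.1
          subst this
          rwa [if_neg h2.1.1.ne']
        · rw [if_neg (by rintro rfl; exact hx hb)] at ih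
          rcases h2.2.2 with rfl | hc
          · rw [if_pos rfl]
            rwa [← huniq b hb h2.1.1]
          · rw [if_neg (by rintro rfl; exact hx hc)]
            exact ih.step h2.1 hb hc
    have := key q hr
    rw [if_neg (by rintro rfl; exact hx hq)] at this
    exact h.br p hp q hq hpq this

theorem Tr.attach [Finite W] {A D : Set W} {a l : W} (h : Tr G A) (ha : a ∈ A)
    (hdis : ∀ x ∈ D, x ∉ A) (hD : Cn G D) (hl : l ∈ D) (hex : ∃ d ∈ D, G.Adj a d)
    (hon : ∀ x ∈ A, ∀ d ∈ D, G.Adj x d → x = a) :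
    ∃ D' ⊆ D, l ∈ D' ∧ Tr G (A ∪ D') := by
  generalize hn : D.ncard = n
  induction n using Nat.strong_induction_on generalizing A D a with
  | _ n ih =>
  by_cases hla : G.Adj a l
  · refine ⟨{l}, by simpa using hl, rfl, ?_⟩
    rw [Set.union_singleton]
    exact h.leaf (hdis l hl) ha hla (fun z hz hzl => hon z hz l hl hzl)
  obtain ⟨d₀, hd₀, had₀⟩ := hex
  obtain ⟨C, hCD, hlC, hCcn, hCN, d, hd, hdN, z, hz, hzd⟩ :=
    hD.trim (B := {x | G.Adj a x}) hl hla hd₀ had₀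
  have hdC : d ∉ C := fun e => hCN d e hdN
  have h1 : Tr G (insert d A) :=
    h.leaf (hdis d hd) ha hdN (fun z hz hzl => hon z hz d hd hzl)
  obtain ⟨D', e1, e2, e3⟩ := ih C.ncard (by
      rw [← hn]
      exact Set.ncard_lt_ncard ⟨hCD, fun e => hdC (e hd)⟩ (Set.toFinite _)) h1 (Or.inl rfl)
    (by
      rintro x hx (rfl | e)
      · exact hdC hx
      · exact hdis x (hCD hx) e) hCcn hlC ⟨z, hz, hzd.symm⟩ (by
      rintro x (rfl | hx) y hy hxy
      · rfl
      · have := hon x hx y (hCD hy) hxy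
        subst this
        exact absurd hxy (hCN y hy)) rfl
  refine ⟨insert d D', ?_, Or.inr e2, ?_⟩
  · rintro x (rfl | hx)
    · exact hd
    · exact hCD (e1 hx)
  · rwa [Set.union_insert, ← Set.insert_union]

/-- pairwise disjoint and anticomplete -/
def Anti (G : SimpleGraph W) (A B : Set W) : Prop := ∀ x ∈ A, ∀ z ∈ B, x ≠ z ∧ ¬ G.Adj x z

theorem Anti.symm {A B : Set W} (h : Anti G A B) : Anti G B A :=
  fun x hx z hz => ⟨(h z hz x hx).1.symm, fun e => (h z hz x hx).2 e.symm⟩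

theorem Tr.sapA [Finite W] {y l1 l2 l3 : W} {X1 X2 X3 : Set W}
    (h12 : Anti G X1 X2) (h13 : Anti G X1 X3) (h23 : Anti G X2 X3)
    (c1 : Cn G X1) (c2 : Cn G X2) (c3 : Cn G X3) (m1 : l1 ∈ X1) (m2 : l2 ∈ X2) (m3 : l3 ∈ X3)
    (y1 : y ∉ X1) (y2 : y ∉ X2) (y3 : y ∉ X3) (a1 : ∃ x ∈ X1, G.Adj y x)
    (a2 : ∃ x ∈ X2, G.Adj y x) (a3 : ∃ x ∈ X3, G.Adj y x) :
    ∃ T, T ⊆ insert y (X1 ∪ X2 ∪ X3) ∧ Tr G T ∧ l1 ∈ T ∧ l2 ∈ T ∧ l3 ∈ T := by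
  obtain ⟨D1, s1, n1, t1⟩ := (Tr.single (G := G) y).attach (a := y) rfl
    (fun x hx (e : x = y) => y1 (e ▸ hx)) c1 m1 a1 (fun x hx _ _ _ => hx)
  obtain ⟨D2, s2, n2, t2⟩ := t1.attach (a := y) (Or.inl rfl) (by
      rintro x hx (e | e)
      · exact y2 (e ▸ hx)
      · exact (h12 x (s1 e) x hx).1 rfl) c2 m2 a2 (by
      rintro x (hx | hx) d hd hxd
      · exact hx
      · exact absurd hxd (h12 x (s1 hx) d hd).2)
  obtain ⟨D3, s3, n3, t3⟩ := t2.attach (a := y) (Or.inl (Or.inl rfl)) (by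
      rintro x hx ((e | e) | e)
      · exact y3 (e ▸ hx)
      · exact (h13 x (s1 e) x hx).1 rfl
      · exact (h23 x (s2 e) x hx).1 rfl) c3 m3 a3 (by
      rintro x ((hx | hx) | hx) d hd hxd
      · exact hx
      · exact absurd hxd (h13 x (s1 hx) d hd).2
      · exact absurd hxd (h23 x (s2 hx) d hd).2)
  refine ⟨_, ?_, t3, Or.inl (Or.inl (Or.inr n1)), Or.inl (Or.inr n2), Or.inr n3⟩
  rintro x (((hx | hx) | hx) | hx)
  · exact Or.inl hx
  · exact Or.inr (Or.inl (Or.inl (s1 hx)))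
  · exact Or.inr (Or.inl (Or.inr (s2 hx)))
  · exact Or.inr (Or.inr (s3 hx))

theorem Tr.sapB [Finite W] {y h l1 l2 l3 : W} {X1 X2 X3 : Set W}
    (h12 : Anti G X1 X2) (h13 : Anti G X1 X3) (h23 : Anti G X2 X3)
    (c1 : Cn G X1) (c2 : Cn G X2) (c3 : Cn G X3) (m1 : l1 ∈ X1) (m2 : l2 ∈ X2) (m3 : l3 ∈ X3)
    (y1 : y ∉ X1) (y2 : y ∉ X2) (y3 : y ∉ X3) (hX1 : h ∉ X1) (hX2 : h ∉ X2)
    (hX3 : ∀ x ∈ X3, x ≠ h ∧ ¬ G.Adj h x)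
    (hy : G.Adj h y) (a1 : ∃ x ∈ X1, G.Adj h x) (a2 : ∃ x ∈ X2, G.Adj h x)
    (f1 : ∀ x ∈ X1, ¬ G.Adj y x) (f2 : ∀ x ∈ X2, ¬ G.Adj y x)
    (a3 : ∃ x ∈ X3, G.Adj y x) :
    ∃ T, T ⊆ insert y (insert h (X1 ∪ X2 ∪ X3)) ∧ Tr G T ∧ l1 ∈ T ∧ l2 ∈ T ∧ l3 ∈ T := by
  obtain ⟨D1, s1, n1, t1⟩ := (Tr.single (G := G) h).attach (a := h) rfl
    (fun x hx (e : x = h) => hX1 (e ▸ hx)) c1 m1 a1 (fun x hx _ _ _ => hx)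
  obtain ⟨D2, s2, n2, t2⟩ := t1.attach (a := h) (Or.inl rfl) (by
      rintro x hx (e | e)
      · exact hX2 (e ▸ hx)
      · exact (h12 x (s1 e) x hx).1 rfl) c2 m2 a2 (by
      rintro x (hx | hx) d hd hxd
      · exact hx
      · exact absurd hxd (h12 x (s1 hx) d hd).2)
  have t2' := t2.leaf (x := y) (u := h) (by
      rintro ((e | e) | e)
      · exact hy.ne e.symm
      · exact y1 (s1 e)
      · exact y2 (s2 e)) (Or.inl (Or.inl rfl)) hy (by
      rintro z ((hz | hz) | hz) hzy
      · exact hz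
      · exact absurd hzy.symm (f1 z (s1 hz))
      · exact absurd hzy.symm (f2 z (s2 hz)))
  obtain ⟨D3, s3, n3, t3⟩ := t2'.attach (a := y) (Or.inl rfl) (by
      rintro x hx (e | (e | e) | e)
      · exact y3 (e ▸ hx)
      · exact (hX3 x hx).1 e
      · exact (h13 x (s1 e) x hx).1 rfl
      · exact (h23 x (s2 e) x hx).1 rfl) c3 m3 a3 (by
      rintro x (hx | (hx | hx) | hx) d hd hxd
      · exact hx
      · exact absurd (hx ▸ hxd) (hX3 d hd).2
      · exact absurd hxd (h13 x (s1 hx) d hd).2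
      · exact absurd hxd (h23 x (s2 hx) d hd).2)
  refine ⟨_, ?_, t3, Or.inl (Or.inr (Or.inl (Or.inr n1))), Or.inl (Or.inr (Or.inr n2)), Or.inr n3⟩
  rintro x ((hx | (hx | hx) | hx) | hx)
  · exact Or.inl hx
  · exact Or.inr (Or.inl hx)
  · exact Or.inr (Or.inr (Or.inl (Or.inl (s1 hx))))
  · exact Or.inr (Or.inr (Or.inl (Or.inr (s2 hx))))
  · exact Or.inr (Or.inr (Or.inr (s3 hx)))

end TreeLemmas

section KStruct
variable {V : Type*} {G : SimpleGraph V} {X : Set V} {KK : Set (Set V)}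

structure KS (G : SimpleGraph V) (X : Set V) (KK : Set (Set V)) : Prop where
  sub : ∀ P ∈ KK, P ⊆ X
  two : ∀ x ∈ X, ∃ P ∈ KK, ∃ Q ∈ KK, P ≠ Q ∧ x ∈ P ∧ x ∈ Q ∧ ∀ R ∈ KK, x ∈ R → R = P ∨ R = Q
  adj : ∀ x ∈ X, ∀ z ∈ X, x ≠ z → (G.Adj x z ↔ ∃ P ∈ KK, x ∈ P ∧ z ∈ P)
  k3 : ∀ P ∈ KK, ∀ Q ∈ KK, P ≠ Q → ∀ x z, x ∈ P → x ∈ Q → z ∈ P → z ∈ Q → x = z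

theorem KS.three (k : KS G X KK) {P Q R : Set V} (hP : P ∈ KK) (hQ : Q ∈ KK) (hR : R ∈ KK)
    (hPQ : P ≠ Q) {x : V} (xP : x ∈ P) (xQ : x ∈ Q) (xR : x ∈ R) : R = P ∨ R = Q := by
  obtain ⟨A, -, B, -, -, -, -, h⟩ := k.two x (k.sub P hP xP)
  have h1 := h P hP xP
  have h2 := h Q hQ xQ
  have h3 := h R hR xR
  clear h k
  grind

def kGraph (KK : Set (Set V)) : SimpleGraph (Set V) where
  Adj P Q := P ≠ Q ∧ P ∈ KK ∧ Q ∈ KK ∧ (P ∩ Q).Nonempty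
  symm := ⟨by
    rintro P Q ⟨h1, h2, h3, h4⟩
    exact ⟨h1.symm, h3, h2, by rwa [Set.inter_comm]⟩⟩
  loopless := ⟨by
    rintro P ⟨h, -⟩
    exact h rfl⟩

def fGraph (G : SimpleGraph V) (KK : Set (Set V)) (y : V) : SimpleGraph (Set V) where
  Adj P Q := P ≠ Q ∧ P ∈ KK ∧ Q ∈ KK ∧ ∃ x, x ∈ P ∧ x ∈ Q ∧ G.Adj y x
  symm := ⟨by
    rintro P Q ⟨h1, h2, h3, x, h4, h5, h6⟩
    exact ⟨h1.symm, h3, h2, x, h5, h4, h6⟩⟩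
  loopless := ⟨by
    rintro P ⟨h, -⟩
    exact h rfl⟩

theorem fGraph_le (y : V) : fGraph G KK y ≤ kGraph KK := by
  rintro P Q ⟨h1, h2, h3, x, h4, h5, h6⟩
  exact ⟨h1, h2, h3, x, h4, h5⟩

def XN (N : SimpleGraph (Set V)) (C : Set (Set V)) : Set V :=
  {x | ∃ P ∈ C, ∃ Q ∈ C, N.Adj P Q ∧ x ∈ P ∧ x ∈ Q}

theorem KS.mem_XN (k : KS G X KK) {N : SimpleGraph (Set V)} (hN : N ≤ kGraph KK)
    {C : Set (Set V)} {x : V} (hx : x ∈ XN N C) : x ∈ X ∧ ∀ R ∈ KK, x ∈ R → R ∈ C := by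
  obtain ⟨P, hP, Q, hQ, hPQ, xP, xQ⟩ := hx
  have h := hN hPQ
  refine ⟨k.sub P h.2.1 xP, fun R hR xR => ?_⟩
  rcases k.three h.2.1 h.2.2.1 hR h.1 xP xQ xR with rfl | rfl <;> assumption

theorem KS.anti (k : KS G X KK) {N N' : SimpleGraph (Set V)} (hN : N ≤ kGraph KK)
    (hN' : N' ≤ kGraph KK) {C C' : Set (Set V)} (hd : ∀ x ∈ C, x ∉ C') :
    Anti G (XN N C) (XN N' C') := by
  intro x hx z hz
  obtain ⟨h1, h2⟩ := k.mem_XN hN hx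
  obtain ⟨h3, h4⟩ := k.mem_XN hN' hz
  have hne : x ≠ z := by
    rintro rfl
    obtain ⟨P, hP, -, -, -, xP, -⟩ := k.two x h1
    exact hd P (h2 P hP xP) (h4 P hP xP)
  refine ⟨hne, fun ha => ?_⟩
  obtain ⟨P, hP, xP, zP⟩ := (k.adj x h1 z h3 hne).1 ha
  exact hd P (h2 P hP xP) (h4 P hP zP)

theorem KS.step (k : KS G X KK) {P : Set V} (hP : P ∈ KK) {S : Set V} {x z : V} (xP : x ∈ P)
    (zP : z ∈ P) (xS : x ∈ S) (zS : z ∈ S) : Rc G S x z := by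
  by_cases h : x = z
  · subst h; exact Rc.rfl
  · exact Rc.rfl.step ((k.adj x (k.sub P hP xP) z (k.sub P hP zP) h).2 ⟨P, hP, xP, zP⟩) xS zS

theorem KS.cn (k : KS G X KK) {N : SimpleGraph (Set V)} (hN : N ≤ kGraph KK)
    {C : Set (Set V)} (hC : Cn N C) : Cn G (XN N C) := by
  have key : ∀ P R, Rc N C P R → P ∈ KK → ∀ x ∈ XN N C, x ∈ P → ∀ z ∈ XN N C, z ∈ R →
      Rc G (XN N C) x z := by
    intro P R h hP x hx xP
    induction h with
    | refl => intro z hz zP; exact k.step hP xP zP hx hz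
    | tail h1 h2 ih =>
      rename_i R R'
      intro z hz zR
      obtain ⟨e1, e2, e3, w, w1, w2⟩ := hN h2.1
      have hw : w ∈ XN N C := ⟨R, h2.2.1, R', h2.2.2, h2.1, w1, w2⟩
      exact (ih w hw w1).trans (k.step e3 w2 zR hw hz)
  intro x hx z hz
  obtain ⟨P, hP, Q, hQ, hPQ, xP, xQ⟩ := id hx
  obtain ⟨P', hP', Q', hQ', hPQ', xP', xQ'⟩ := id hz
  exact key P P' (hC P hP P' hP') (hN hPQ).2.1 x hx xP z hz xP'

theorem KS.nbr {N : SimpleGraph (Set V)} {C : Set (Set V)} (hC : Cn N C) {a b : Set V} (ha : a ∈ C)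
    (hb : b ∈ C) (hab : a ≠ b) : ∃ q ∈ C, N.Adj a q := by
  obtain ⟨p, q, hpq, hp, hq, -, hqC⟩ := (hC a ha b hb).exit {a} rfl (fun h => hab h.symm)
  rw [Set.mem_singleton_iff] at hp
  subst hp
  exact ⟨q, hqC, hpq⟩

theorem KS.leaf_mem {N : SimpleGraph (Set V)} (hN : N ≤ kGraph KK) {C : Set (Set V)} (hC : Cn N C)
    {l : V} {b : Set V} (ha : {l} ∈ C) (hb : b ∈ C) (hab : {l} ≠ b) : l ∈ XN N C := by
  obtain ⟨q, hq, h⟩ := KS.nbr hC ha hb hab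
  obtain ⟨-, -, -, w, w1, w2⟩ := hN h
  rw [Set.mem_singleton_iff] at w1
  subst w1
  exact ⟨_, ha, q, hq, h, rfl, w2⟩

structure LfH (G : SimpleGraph V) (KK : Set (Set V)) (Lf : Set V → Prop) (y : V) : Prop where
  mem : ∀ P, Lf P → P ∈ KK
  single : ∀ P, Lf P → ∃ l, IsLeaf G l ∧ P = {l}
  noF : ∀ P Q, Lf P → ¬ (fGraph G KK y).Adj P Q

theorem leaves_all [Finite V] (hl : {v | IsLeaf G v}.ncard = 3) {l1 l2 l3 : V} (h1 : IsLeaf G l1)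
    (h2 : IsLeaf G l2) (h3 : IsLeaf G l3) (h12 : l1 ≠ l2) (h13 : l1 ≠ l3) (h23 : l2 ≠ l3)
    (v : V) (hv : IsLeaf G v) : v = l1 ∨ v = l2 ∨ v = l3 := by
  obtain ⟨a, b, c, hab, hac, hbc, he⟩ := Set.ncard_eq_three.1 hl
  have key : ∀ v, IsLeaf G v → v = a ∨ v = b ∨ v = c := by
    intro v hv
    have : v ∈ {v | IsLeaf G v} := hv
    rw [he] at this
    simpa using this
  have e1 := key _ h1
  have e2 := key _ h2
  have e3 := key _ h3
  have e4 := key _ hv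
  clear key he hl
  grind

theorem KS.sapA [Finite V] (k : KS G X KK) {Lf : Set V → Prop} {y : V} (hL : LfH G KK Lf y)
    (hl : {v | IsLeaf G v}.ncard = 3) (hy : y ∉ X)
    (hfree : ¬ ∃ T, T ⊆ X ∪ {y} ∧ IsSapling G T) {L M P : Set (Set V)}
    (t : Tri (kGraph KK) Lf L M P) (f1 : Fb (fGraph G KK y) L L) (f2 : Fb (fGraph G KK y) M M)
    (f3 : Fb (fGraph G KK y) P P) : False := by
  have lf : ∀ C : Set (Set V), Cn (kGraph KK) C → (∃ a ∈ C, Lf a) → Fb (fGraph G KK y) C C →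
      (∃ l, {l} ∈ C ∧ IsLeaf G l ∧ l ∈ XN (kGraph KK) C) ∧ ∃ x ∈ XN (kGraph KK) C, G.Adj y x := by
    rintro C hC ⟨a, ha, hla⟩ ⟨p, hp, q, hq, hpq⟩
    obtain ⟨l, hl, rfl⟩ := hL.single a hla
    have hne : {l} ≠ p := by rintro rfl; exact hL.noF _ _ hla hpq
    have hK := fGraph_le y hpq
    obtain ⟨-, -, -, x, xp, xq, yx⟩ := hpq
    exact ⟨⟨l, ha, hl, KS.leaf_mem le_rfl hC ha hp hne⟩, x, ⟨p, hp, q, hq, hK, xp, xq⟩, yx⟩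
  obtain ⟨⟨l1, d1, i1, m1⟩, a1⟩ := lf L t.cL t.lL f1
  obtain ⟨⟨l2, d2, i2, m2⟩, a2⟩ := lf M t.cM t.lM f2
  obtain ⟨⟨l3, d3, i3, m3⟩, a3⟩ := lf P t.cP t.lP f3
  have hyX : ∀ C : Set (Set V), y ∉ XN (kGraph KK) C := fun C h => hy (k.mem_XN le_rfl h).1
  obtain ⟨T, hT, tT, n1, n2, n3⟩ := Tr.sapA (y := y) (k.anti le_rfl le_rfl t.dLM)
    (k.anti le_rfl le_rfl t.dLP) (k.anti le_rfl le_rfl t.dMP) (k.cn le_rfl t.cL) (k.cn le_rfl t.cM)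
    (k.cn le_rfl t.cP) m1 m2 m3 (hyX _) (hyX _) (hyX _) a1 a2 a3
  refine hfree ⟨T, ?_, tT.isTree, fun v hv => ?_⟩
  · intro z hz
    rcases hT hz with h | (h | h) | h
    · exact Or.inr h
    · exact Or.inl (k.mem_XN le_rfl h).1
    · exact Or.inl (k.mem_XN le_rfl h).1
    · exact Or.inl (k.mem_XN le_rfl h).1
  · rcases leaves_all hl i1 i2 i3 (by rintro rfl; exact t.dLM _ d1 d2)
      (by rintro rfl; exact t.dLP _ d1 d3) (by rintro rfl; exact t.dMP _ d2 d3) v hv with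
      rfl | rfl | rfl <;> assumption

theorem KS.sapB [Finite V] (k : KS G X KK) {Lf : Set V → Prop} {y : V} (hL : LfH G KK Lf y)
    (hl : {v | IsLeaf G v}.ncard = 3) (hy : y ∉ X)
    (hfree : ¬ ∃ T, T ⊆ X ∪ {y} ∧ IsSapling G T) {L M P : Set (Set V)}
    (t : Tri (kGraph KK) Lf L M P) (c1 : Cn (kGraph KK \ fGraph G KK y) L)
    (c2 : Cn (kGraph KK \ fGraph G KK y) M) (f : Fb (fGraph G KK y) L M)
    (f3 : Fb (fGraph G KK y) P P) : False := by
  set N := kGraph KK \ fGraph G KK y with hN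
  have hNK : N ≤ kGraph KK := sdiff_le
  obtain ⟨p, hp, q, hq, hpq⟩ := f
  have hpq' := hpq.symm
  obtain ⟨hpqn, hpK, hqK, h, hhp, hhq, yh⟩ := id hpq
  have hhX : h ∈ X := k.sub p hpK hhp
  have lf : ∀ C : Set (Set V), Cn N C → (∃ a ∈ C, Lf a) → ∀ p ∈ C, ∀ q, q ∉ C →
      (fGraph G KK y).Adj p q → h ∈ p → h ∈ q →
      (∃ l, {l} ∈ C ∧ IsLeaf G l ∧ l ∈ XN N C) ∧ h ∉ XN N C ∧ ∃ x ∈ XN N C, G.Adj h x := by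
    rintro C hC ⟨a, ha, hla⟩ p hp q hq hpq hhp hhq
    obtain ⟨l, hl, rfl⟩ := hL.single a hla
    have hne : {l} ≠ p := by rintro rfl; exact hL.noF _ _ hla hpq
    have hn : h ∉ XN N C := fun e => hq ((k.mem_XN hNK e).2 q hpq.2.2.1 hhq)
    refine ⟨⟨l, ha, hl, KS.leaf_mem hNK hC ha hp hne⟩, hn, ?_⟩
    obtain ⟨r, hr, hpr⟩ := KS.nbr hC hp ha hne.symm
    obtain ⟨-, hpK, -, w, w1, w2⟩ := hNK hpr
    have hw : w ∈ XN N C := ⟨p, hp, r, hr, hpr, w1, w2⟩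
    refine ⟨w, hw, (k.adj h hhX w (k.mem_XN hNK hw).1 ?_).2 ⟨p, hpK, hhp, w1⟩⟩
    rintro rfl
    exact hn hw
  obtain ⟨⟨l1, d1, i1, m1⟩, o1, a1⟩ := lf L c1 t.lL p hp q (fun e => t.dLM _ e hq) hpq hhp hhq
  obtain ⟨⟨l2, d2, i2, m2⟩, o2, a2⟩ := lf M c2 t.lM q hq p (fun e => t.dLM _ hp e) hpq' hhq hhp
  obtain ⟨l3, d3, i3, m3, a3⟩ : ∃ l, {l} ∈ P ∧ IsLeaf G l ∧ l ∈ XN (kGraph KK) P ∧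
      ∃ x ∈ XN (kGraph KK) P, G.Adj y x := by
    obtain ⟨a, ha, hla⟩ := t.lP
    obtain ⟨p, hp, q, hq, hpq⟩ := f3
    obtain ⟨l, hl, rfl⟩ := hL.single a hla
    have hne : {l} ≠ p := by rintro rfl; exact hL.noF _ _ hla hpq
    have hK := fGraph_le y hpq
    obtain ⟨-, -, -, x, xp, xq, yx⟩ := hpq
    exact ⟨l, ha, hl, KS.leaf_mem le_rfl t.cP ha hp hne, x, ⟨p, hp, q, hq, hK, xp, xq⟩, yx⟩
  have hf : ∀ C : Set (Set V), ∀ x ∈ XN N C, ¬ G.Adj y x := by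
    rintro C x ⟨A, hA, B, hB, hAB, xA, xB⟩ hyx
    have := hNK hAB
    exact hAB.2 ⟨this.1, this.2.1, this.2.2.1, x, xA, xB, hyx⟩
  have hX3 : ∀ x ∈ XN (kGraph KK) P, x ≠ h ∧ ¬ G.Adj h x := by
    intro x hx
    obtain ⟨e1, e2⟩ := k.mem_XN le_rfl hx
    have hne : x ≠ h := by
      rintro rfl
      exact t.dLP p hp (e2 p hpK hhp)
    refine ⟨hne, fun ha => ?_⟩
    obtain ⟨R, hR, hhR, hxR⟩ := (k.adj h hhX x e1 hne.symm).1 ha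
    have hRP := e2 R hR hxR
    rcases k.three hpK hqK hR hpqn hhp hhq hhR with rfl | rfl
    · exact t.dLP _ hp hRP
    · exact t.dMP _ hq hRP
  have hyX : ∀ C : Set (Set V), y ∉ XN (kGraph KK) C := fun C h => hy (k.mem_XN le_rfl h).1
  have hyX' : ∀ C : Set (Set V), y ∉ XN N C := fun C h => hy (k.mem_XN hNK h).1
  obtain ⟨T, hT, tT, n1, n2, n3⟩ := Tr.sapB (y := y) (h := h) (k.anti hNK hNK t.dLM)
    (k.anti hNK le_rfl t.dLP) (k.anti hNK le_rfl t.dMP) (k.cn hNK c1) (k.cn hNK c2)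
    (k.cn le_rfl t.cP) m1 m2 m3 (hyX' _) (hyX' _) (hyX _) o1 o2 hX3 yh.symm a1 a2 (hf _) (hf _) a3
  refine hfree ⟨T, ?_, tT.isTree, fun v hv => ?_⟩
  · intro z hz
    rcases hT hz with h | h | (h | h) | h
    · exact Or.inr h
    · exact Or.inl (h ▸ hhX)
    · exact Or.inl (k.mem_XN hNK h).1
    · exact Or.inl (k.mem_XN hNK h).1
    · exact Or.inl (k.mem_XN le_rfl h).1
  · rcases leaves_all hl i1 i2 i3 (by rintro rfl; exact t.dLM _ d1 d2)
      (by rintro rfl; exact t.dLP _ d1 d3) (by rintro rfl; exact t.dMP _ d2 d3) v hv with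
      rfl | rfl | rfl <;> assumption

end KStruct

section ArcSeqs
variable {V : Type*} {G : SimpleGraph V}

structure PSeq (G : SimpleGraph V) (n : ℕ) (x : ℕ → V) : Prop where
  inj : ∀ i j, i ≤ n → j ≤ n → x i = x j → i = j
  adj : ∀ i j, i ≤ n → j ≤ n → (G.Adj (x i) (x j) ↔ j = i + 1 ∨ i = j + 1)

structure ArcSeq (G : SimpleGraph V) (U W E : Set V) (n : ℕ) (x : ℕ → V) : Prop extends PSeq G n x where
  mem : ∀ v, v ∈ E ↔ ∃ i, i ≤ n ∧ x i = v
  fst : ∀ i, i ≤ n → (x i ∈ U ↔ i = 0)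
  snd : ∀ i, i ≤ n → (x i ∈ W ↔ i = n)

def itv (x : ℕ → V) (l m : ℕ) : Set V := {v | ∃ j, l ≤ j ∧ j ≤ m ∧ x j = v}

theorem PSeq.tr {n : ℕ} {x : ℕ → V} (h : PSeq G n x) (l m : ℕ) (hlm : l ≤ m) (hm : m ≤ n) :
    Tr G (itv x l m) := by
  induction m, hlm using Nat.le_induction with
  | base =>
    have : itv x l l = {x l} := by
      ext v
      constructor
      · rintro ⟨j, h1, h2, rfl⟩
        have : j = l := by omega
        subst this; rfl
      · rintro rfl
        exact ⟨l, le_rfl, le_rfl, rfl⟩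
    rw [this]
    exact Tr.single _
  | succ m hlm ih =>
    have : itv x l (m + 1) = insert (x (m + 1)) (itv x l m) := by
      ext v
      constructor
      · rintro ⟨j, h1, h2, rfl⟩
        by_cases hj : j = m + 1
        · subst hj; exact Or.inl rfl
        · exact Or.inr ⟨j, h1, by omega, rfl⟩
      · rintro (rfl | ⟨j, h1, h2, rfl⟩)
        · exact ⟨m + 1, by omega, le_rfl, rfl⟩
        · exact ⟨j, h1, by omega, rfl⟩
    rw [this]
    refine (ih (by omega)).leaf (u := x m) ?_ ⟨m, hlm, le_rfl, rfl⟩ ?_ ?_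
    · rintro ⟨j, h1, h2, h3⟩
      have := h.inj _ _ (by omega) (by omega) h3
      omega
    · exact (h.adj _ _ (by omega) hm).2 (Or.inl rfl)
    · rintro z ⟨j, h1, h2, rfl⟩ hz
      have := (h.adj _ _ (by omega) hm).1 hz
      have : j = m := by omega
      rw [this]

theorem PSeq.uw {n : ℕ} {x : ℕ → V} (h : PSeq G n x) {U W : Set V} (l m : ℕ) (hlm : l ≤ m)
    (hm : m ≤ n) (hU : x l ∈ U) (hW : x m ∈ W) : IsUWPath G U W (itv x l m) := by
  by_cases hl : l = m
  · subst hl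
    refine Or.inl ⟨x l, hU, hW, ?_⟩
    ext v
    constructor
    · rintro ⟨j, h1, h2, rfl⟩
      have : j = l := by omega
      subst this; rfl
    · rintro rfl
      exact ⟨l, le_rfl, le_rfl, rfl⟩
  · refine Or.inr ⟨⟨(h.tr l m hlm hm).isTree, ?_⟩, x l, x m, ?_, hU, hW, ⟨⟨l, le_rfl, hlm, rfl⟩, ?_⟩, ⟨⟨m, hlm, le_rfl, rfl⟩, ?_⟩⟩
    · rintro v ⟨i, i1, i2, rfl⟩ a ⟨ja, a1, a2, rfl⟩ b ⟨jb, b1, b2, rfl⟩ c ⟨jc, c1, c2, rfl⟩ ha hb hc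
      have ha := (h.adj _ _ (by omega) (by omega)).1 ha
      have hb := (h.adj _ _ (by omega) (by omega)).1 hb
      have hc := (h.adj _ _ (by omega) (by omega)).1 hc
      have : ja = jb ∨ ja = jc ∨ jb = jc := by omega
      rcases this with rfl | rfl | rfl <;> simp
    · intro he
      exact hl (h.inj _ _ (by omega) hm he)
    · rintro a ⟨ja, a1, a2, rfl⟩ b ⟨jb, b1, b2, rfl⟩ ha hb
      have ha := (h.adj _ _ (by omega) (by omega)).1 ha
      have hb := (h.adj _ _ (by omega) (by omega)).1 hb
      have : ja = jb := by omega
      rw [this]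
    · rintro a ⟨ja, a1, a2, rfl⟩ b ⟨jb, b1, b2, rfl⟩ ha hb
      have ha := (h.adj _ _ (by omega) (by omega)).1 ha
      have hb := (h.adj _ _ (by omega) (by omega)).1 hb
      have : ja = jb := by omega
      rw [this]

theorem PSeq.arc [Finite V] {n : ℕ} {x : ℕ → V} (h : PSeq G n x) {U W E : Set V}
    (hE : IsRungIn G E U W E) (mem : ∀ v, v ∈ E ↔ ∃ i, i ≤ n ∧ x i = v) (hU : x 0 ∈ U)
    (hW : x n ∈ W) : ArcSeq G U W E n x := by
  have sub : ∀ l m, l ≤ m → m ≤ n → x l ∈ U → x m ∈ W → l = 0 ∧ m = n := by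
    intro l m hlm hm h1 h2
    have hs : itv x l m ⊆ E := by
      rintro v ⟨j, h1, h2, rfl⟩
      exact (mem _).2 ⟨j, by omega, rfl⟩
    have hc := hE.2.2 _ hs (h.uw l m hlm hm h1 h2)
    have he : itv x l m = E := Set.eq_of_subset_of_ncard_le hs hc
    have m0 : x 0 ∈ itv x l m := by rw [he]; exact (mem _).2 ⟨0, by omega, rfl⟩
    have mn : x n ∈ itv x l m := by rw [he]; exact (mem _).2 ⟨n, by omega, rfl⟩
    obtain ⟨j, j1, j2, j3⟩ := m0
    obtain ⟨k, k1, k2, k3⟩ := mn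
    have := h.inj _ _ (by omega) (by omega) j3
    have := h.inj _ _ (by omega) (by omega) k3
    omega
  refine ⟨h, mem, fun i hi => ⟨fun hu => (sub i n hi le_rfl hu hW).1, ?_⟩,
    fun i hi => ⟨fun hu => (sub 0 i (Nat.zero_le _) hi hU hu).2, ?_⟩⟩
  · rintro rfl; exact hU
  · rintro rfl; exact hW

theorem exists_arcSeq [Finite V] {U W E : Set V} (hE : IsRungIn G E U W E) :
    ∃ n x, ArcSeq G U W E n x := by
  rcases hE.2.1 with ⟨x, hU, hW, rfl⟩ | ⟨⟨hT, hd⟩, u, w, huw, hu, hw, ⟨huE, eu⟩, ⟨hwE, ew⟩⟩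
  · refine ⟨0, fun _ => x, PSeq.arc ⟨?_, ?_⟩ hE ?_ hU hW⟩
    · intros; omega
    · intro i j hi hj
      simp; omega
    · intro v
      constructor
      · rintro rfl; exact ⟨0, le_rfl, rfl⟩
      · rintro ⟨-, -, h⟩; exact h.symm
  · obtain ⟨p, hp⟩ := (hT.isConnected ⟨u, huE⟩ ⟨w, hwE⟩).exists_isPath
    have hinj : ∀ i j, i ≤ p.length → j ≤ p.length → (p.getVert i : V) = p.getVert j → i = j := by
      intro i j hi hj he
      exact hp.getVert_injOn hi hj (Subtype.ext he)
    have hadj : ∀ i, i < p.length → G.Adj (p.getVert i : V) (p.getVert (i + 1)) := by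
      intro i hi
      exact p.adj_getVert_succ hi
    have h0 : (p.getVert 0 : V) = u := by simp
    have hn : (p.getVert p.length : V) = w := by simp
    have hpos : 0 < p.length := by
      rcases Nat.eq_zero_or_pos p.length with h | h
      · rw [h, h0] at hn; exact absurd hn huw
      · exact h
    have hnb : ∀ i, i ≤ p.length → ∀ z ∈ E, G.Adj (p.getVert i : V) z →
        ∃ j, j ≤ p.length ∧ z = p.getVert j ∧ (j = i + 1 ∨ i = j + 1) := by
      intro i hi z hz haz
      by_cases i0 : i = 0
      · subst i0
        refine ⟨1, hpos, ?_, Or.inl rfl⟩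
        have := hadj 0 hpos
        rw [h0] at this haz
        exact eu _ hz _ (p.getVert 1).2 haz this
      by_cases i1 : i = p.length
      · subst i1
        refine ⟨p.length - 1, by omega, ?_, by omega⟩
        have := hadj (p.length - 1) (by omega)
        rw [show p.length - 1 + 1 = p.length by omega] at this
        rw [hn] at this haz
        exact ew _ hz _ (p.getVert (p.length - 1)).2 haz this.symm
      obtain ⟨k, rfl⟩ : ∃ k, i = k + 1 := ⟨i - 1, by omega⟩
      have a1 := (hadj k (by omega)).symm
      have a2 := hadj (k + 1) (by omega)
      rcases hd _ (p.getVert (k + 1)).2 _ hz _ (p.getVert k).2 _ (p.getVert (k + 1 + 1)).2 haz a1 a2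
        with h | h | h
      · exact ⟨k, by omega, h, by omega⟩
      · exact ⟨k + 1 + 1, by omega, h, by omega⟩
      · have := hinj _ _ (by omega) (by omega) h
        omega
    refine ⟨p.length, fun i => p.getVert i, PSeq.arc ⟨hinj, ?_⟩ hE ?_ (by rwa [h0]) (by rwa [hn])⟩
    · intro i j hi hj
      constructor
      · intro h
        obtain ⟨k, k1, k2, k3⟩ := hnb i hi _ (p.getVert j).2 h
        have := hinj _ _ hj k1 k2
        omega
      · rintro (rfl | rfl)
        · exact hadj _ (by omega)
        · exact (hadj _ (by omega)).symm
    · intro v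
      constructor
      · intro hv
        by_contra hcon
        have hc := (connected_iff_cn.1 hT.isConnected).2
        obtain ⟨a, b, hab, ha, hb, haE, hbE⟩ := (hc u huE v hv).exit
          {v | ∃ i, i ≤ p.length ∧ (p.getVert i : V) = v} ⟨0, by omega, h0⟩ hcon
        obtain ⟨i, hi, rfl⟩ := ha
        obtain ⟨j, hj, hj2, -⟩ := hnb i hi b hbE hab
        exact hb ⟨j, hj, hj2.symm⟩
      · rintro ⟨i, hi, rfl⟩
        exact (p.getVert i).2

end ArcSeqs

section NetFacts
variable {V : Type*} {G : SimpleGraph V} {X : Set V} {H : Net V}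

theorem arc_sub (hn : IsNet G X H) {E : Set V} (hE : E ∈ H.arcs) : E ⊆ X := by
  rw [← hn.arcs_cover]
  exact Set.subset_sUnion_of_mem hE

theorem arc_nonempty (hn : IsNet G X H) {E : Set V} (hE : E ∈ H.arcs) : E.Nonempty := by
  have := (hn.meets_iff E hE _ (hn.fst_mem E hE)).2 (Or.inl rfl)
  exact this.mono Set.inter_subset_left

theorem arc_eq (hn : IsNet G X H) {E F : Set V} (hE : E ∈ H.arcs) (hF : F ∈ H.arcs) {x : V}
    (h1 : x ∈ E) (h2 : x ∈ F) : E = F := by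
  by_contra h
  have := hn.arcs_disjoint E hE F hF h
  have h3 : x ∈ E ∩ F := ⟨h1, h2⟩
  rw [this] at h3
  exact h3

theorem arc_chunk {E U W : Set V} (hE : E ∈ H.arcs)
    (h : (H.fst E = U ∧ H.snd E = W) ∨ (H.fst E = W ∧ H.snd E = U)) : IsChunk H U W E := by
  refine ⟨{{E}}, ⟨_, rfl⟩, ?_, by simp⟩
  rintro A rfl
  exact Or.inl ⟨E, hE, rfl, h⟩

theorem max_arc (hsa : H.aiding = H) {E : Set V} (hE : E ∈ H.arcs) : IsMaxChunk H E := by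
  rw [← hsa] at hE
  exact hE

theorem nopar_of (hn : IsNet G X H) (hsa : H.aiding = H) {E F : Set V} (hE : E ∈ H.arcs)
    (hF : F ∈ H.arcs)
    (h : (H.fst E = H.fst F ∧ H.snd E = H.snd F) ∨ (H.fst E = H.snd F ∧ H.snd E = H.fst F)) :
    E = F := by
  have hc : IsChunkOf H (E ∪ F) := by
    refine ⟨H.fst E, H.snd E, {{E}, {F}}, ⟨_, Or.inl rfl⟩, ?_, ?_⟩
    · rintro A (rfl | rfl)
      · exact Or.inl ⟨E, hE, rfl, Or.inl ⟨rfl, rfl⟩⟩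
      · refine Or.inl ⟨F, hF, rfl, ?_⟩
        rcases h with ⟨h1, h2⟩ | ⟨h1, h2⟩
        · exact Or.inl ⟨h1.symm, h2.symm⟩
        · exact Or.inr ⟨h2.symm, h1.symm⟩
    · ext z; simp [or_comm]
  have h1 := (max_arc hsa hE).2 _ hc Set.subset_union_left
  obtain ⟨z, hz⟩ := arc_nonempty hn hF
  have : z ∈ E := by rw [← h1]; exact Or.inr hz
  exact arc_eq hn hE hF this hz

theorem split_exists [Finite V] (hn : IsNet G X H) {U W : Set V} (hc : H.CutPairNabla U W)
    {E : Set V} (hE : E ∈ H.arcs) : ∃ A, IsSplitCompArcs H U W A ∧ E ∈ A := by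
  by_cases hends : (H.fst E = U ∧ H.snd E = W) ∨ (H.fst E = W ∧ H.snd E = U)
  · exact ⟨{E}, Or.inl ⟨E, hE, rfl, hends⟩, rfl⟩
  have hadj : H.nabla.Adj (H.fst E) (H.snd E) := by
    refine (SimpleGraph.fromRel_adj _ _ _).2 ⟨hn.ends_ne E hE, Or.inl (Or.inl ⟨hn.fst_mem E hE, hn.snd_mem E hE, hn.ends_ne E hE, E, hE, Or.inl ⟨rfl, rfl⟩⟩)⟩
  let Gs0 : (H.nabla).Subgraph :=
    { verts := {U, W, H.fst E, H.snd E}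
      Adj := fun a b => (a = H.fst E ∧ b = H.snd E) ∨ (a = H.snd E ∧ b = H.fst E)
      adj_sub := by
        rintro a b (⟨rfl, rfl⟩ | ⟨rfl, rfl⟩)
        · exact hadj
        · exact hadj.symm
      edge_vert := by
        rintro a b (⟨rfl, rfl⟩ | ⟨rfl, rfl⟩) <;> simp
      symm := by
        try constructor
        rintro a b (⟨rfl, rfl⟩ | ⟨rfl, rfl⟩) <;> simp }
  have hno : NoCutPair Gs0 U W := by
    unfold NoCutPair
    have h1 : (Gs0.deleteVerts {U, W}).coe.Preconnected := by
      have key : ∀ a ∈ (Gs0.deleteVerts {U, W}).verts, a = H.fst E ∨ a = H.snd E := by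
        rintro a ⟨h1, h2⟩
        simp only [Set.mem_insert_iff, Set.mem_singleton_iff, not_or] at h2
        rcases h1 with h | h | h | h
        · exact absurd h h2.1
        · exact absurd h h2.2
        · exact Or.inl h
        · exact Or.inr h
      rintro ⟨a, ha⟩ ⟨b, hb⟩
      by_cases hab : a = b
      · subst hab; exact SimpleGraph.Reachable.refl _
      · apply SimpleGraph.Adj.reachable
        rw [SimpleGraph.Subgraph.coe_adj, SimpleGraph.Subgraph.deleteVerts_adj]
        refine ⟨ha.1, ha.2, hb.1, hb.2, ?_⟩
        rcases key a ha with rfl | rfl <;> rcases key b hb with rfl | rfl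
        · exact absurd rfl hab
        · exact Or.inl ⟨rfl, rfl⟩
        · exact Or.inr ⟨rfl, rfl⟩
        · exact absurd rfl hab
    have := h1.subsingleton_connectedComponent
    have h2 : Nat.card ((Gs0.deleteVerts {U, W}).coe.ConnectedComponent) ≤ 1 :=
      Finite.card_le_one_iff_subsingleton.2 this
    have h3 : 0 < Nat.card (Gs0.coe.ConnectedComponent) := by
      have : Nonempty (Gs0.coe.ConnectedComponent) :=
        ⟨Gs0.coe.connectedComponentMk ⟨U, Or.inl rfl⟩⟩
      exact Nat.card_pos
    omega
  have hmem : Gs0 ∈ {Gs : (H.nabla).Subgraph | U ∈ Gs.verts ∧ W ∈ Gs.verts ∧ ¬ Gs.Adj U W ∧ NoCutPair Gs U W} := by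
    refine ⟨Or.inl rfl, Or.inr (Or.inl rfl), ?_, hno⟩
    rintro (⟨rfl, rfl⟩ | ⟨rfl, rfl⟩)
    · exact hends (Or.inl ⟨rfl, rfl⟩)
    · exact hends (Or.inr ⟨rfl, rfl⟩)
  obtain ⟨Gs, hle, hmax⟩ := (Set.toFinite {Gs : (H.nabla).Subgraph | U ∈ Gs.verts ∧ W ∈ Gs.verts ∧ ¬ Gs.Adj U W ∧ NoCutPair Gs U W}).exists_le_maximal hmem
  obtain ⟨m1, m2, m3, m4⟩ := hmax.1
  refine ⟨{E | E ∈ H.arcs ∧ Gs.Adj (H.fst E) (H.snd E)}, Or.inr ⟨hc, Gs, m1, m2, m3, m4, ?_, rfl⟩,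
    hE, hle.2 (Or.inl ⟨rfl, rfl⟩)⟩
  intro Gs' h1 h2 h3 h4 h5
  exact le_antisymm (hmax.2 ⟨h2, h3, h4, h5⟩ h1) h1

theorem no_cut [Finite V] (hn : IsNet G X H) (hsa : H.aiding = H) (U W : Set V) :
    ¬ H.CutPairNabla U W := by
  intro hc
  have hX : IsChunkOf H X := by
    refine ⟨U, W, {A | IsSplitCompArcs H U W A}, ?_, fun A h => h, ?_⟩
    · obtain ⟨E, hE⟩ := hn.arcs_nonempty
      obtain ⟨A, hA, -⟩ := split_exists hn hc hE
      exact ⟨A, hA⟩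
    · ext z
      constructor
      · intro hz
        rw [← hn.arcs_cover] at hz
        obtain ⟨E, hE, hz⟩ := hz
        obtain ⟨A, hA, hEA⟩ := split_exists hn hc hE
        exact ⟨E, ⟨A, hA, hEA⟩, hz⟩
      · rintro ⟨E, ⟨A, hA, hEA⟩, hz⟩
        have : E ∈ H.arcs := by
          rcases hA with ⟨F, hF, rfl, -⟩ | ⟨-, Gs, -, -, -, -, -, rfl⟩
          · rw [Set.mem_singleton_iff] at hEA; rwa [hEA]
          · exact hEA.1
        exact arc_sub hn this hz
  have hone : ∀ E ∈ H.arcs, E = X := fun E hE =>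
    ((max_arc hsa hE).2 X hX (arc_sub hn hE)).symm
  have hsub : {N | H.IsLeafNode N} ⊆ {H.fst X, H.snd X} := by
    rintro N ⟨-, E, ⟨hE, hEN⟩, -⟩
    rw [hone E hE] at hEN
    rcases hEN with rfl | rfl <;> simp
  have h1 := Set.ncard_le_ncard hsub (Set.toFinite _)
  have h2 := Set.ncard_insert_le (H.fst X) {H.snd X}
  rw [Set.ncard_singleton] at h2
  rw [hn.leaf_count] at h1
  omega

theorem cn_two [Finite V] (hn : IsNet G X H) (hsa : H.aiding = H) {U W : Set V}
    (hU : U ∈ H.nodes) (hW : W ∈ H.nodes) (hUW : U ≠ W) : Cn H.nabla (H.nodes \ {U, W}) := by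
  have h := no_cut hn hsa U W
  have h1 : Nat.card ((H.nabla.induce H.nodes).ConnectedComponent) ≤ 1 :=
    Finite.card_le_one_iff_subsingleton.2 hn.bicon.1.preconnected.subsingleton_connectedComponent
  have h2 : Nat.card ((H.nabla.induce (H.nodes \ {U, W})).ConnectedComponent) ≤ 1 := by
    by_contra hcon
    exact h ⟨hU, hW, hUW, by omega⟩
  have h3 := Finite.card_le_one_iff_subsingleton.1 h2
  intro a ha b hb
  apply (rc_iff_reachable (⟨a, ha⟩ : ↥(H.nodes \ {U, W})) ⟨b, hb⟩).1
  exact SimpleGraph.ConnectedComponent.exact (Subsingleton.elim _ _)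

theorem node_arc (hn : IsNet G X H) {N : Set V} (hN : N ∈ H.nodes) :
    ∃ E ∈ H.arcs, H.EndsAt E N := by
  obtain ⟨E, hE⟩ := hn.arcs_nonempty
  by_cases h : H.fst E = N
  · exact ⟨E, hE, Or.inl h⟩
  have hc := (connected_iff_cn.1 hn.conn).2
  obtain ⟨p, q, hpq, hp, hq, -, -⟩ := (hc N hN _ (hn.fst_mem E hE)).exit {N} rfl h
  rw [Set.mem_singleton_iff] at hp
  subst hp
  rw [Net.graph, SimpleGraph.fromRel_adj] at hpq
  obtain ⟨-, ⟨-, -, -, F, hF, h⟩ | ⟨-, -, -, F, hF, h⟩⟩ := hpq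
  · rcases h with ⟨h, -⟩ | ⟨-, h⟩
    · exact ⟨F, hF, Or.inl h⟩
    · exact ⟨F, hF, Or.inr h⟩
  · rcases h with ⟨-, h⟩ | ⟨h, -⟩
    · exact ⟨F, hF, Or.inr h⟩
    · exact ⟨F, hF, Or.inl h⟩

end NetFacts

section KNet
variable {V : Type*} {G : SimpleGraph V} {X : Set V} {H : Net V} {n : Set V → ℕ}
  {x : Set V → ℕ → V}

def kk (H : Net V) (n : Set V → ℕ) (x : Set V → ℕ → V) (E : Set V) (j : ℕ) : Set V :=
  if j = 0 then H.fst E else if j = n E + 1 then H.snd E else {x E (j - 1), x E j}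

def KN (H : Net V) (n : Set V → ℕ) (x : Set V → ℕ → V) : Set (Set V) :=
  {P | ∃ E ∈ H.arcs, ∃ j, j ≤ n E + 1 ∧ P = kk H n x E j}

structure NF (G : SimpleGraph V) (X : Set V) (H : Net V) (n : Set V → ℕ) (x : Set V → ℕ → V) :
    Prop where
  net : IsNet G X H
  seq : ∀ E ∈ H.arcs, ArcSeq G (H.fst E) (H.snd E) E (n E) (x E)
  nopar : ∀ E ∈ H.arcs, ∀ F ∈ H.arcs,
    ((H.fst E = H.fst F ∧ H.snd E = H.snd F) ∨ (H.fst E = H.snd F ∧ H.snd E = H.fst F)) → E = F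
  cut : ∀ U ∈ H.nodes, ∀ W ∈ H.nodes, U ≠ W → Cn H.nabla (H.nodes \ {U, W})

theorem kk_zero (E : Set V) : kk H n x E 0 = H.fst E := by simp [kk]

theorem kk_last (E : Set V) : kk H n x E (n E + 1) = H.snd E := by simp [kk]

theorem kk_int (E : Set V) {j : ℕ} (h1 : 1 ≤ j) (h2 : j ≤ n E) :
    kk H n x E j = {x E (j - 1), x E j} := by
  rw [kk, if_neg (by omega), if_neg (by omega)]

theorem jcase {m j : ℕ} (h : j ≤ m + 1) : j = 0 ∨ j = m + 1 ∨ (1 ≤ j ∧ j ≤ m) := by omega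

namespace NF

theorem mem_kk (f : NF G X H n x) {E : Set V} (hE : E ∈ H.arcs) {k j : ℕ} (hk : k ≤ n E)
    (hj : j ≤ n E + 1) : x E k ∈ kk H n x E j ↔ k = j ∨ k + 1 = j := by
  have s := f.seq E hE
  rcases jcase hj with rfl | rfl | ⟨h1, h2⟩
  · rw [kk_zero, s.fst k hk]; omega
  · rw [kk_last, s.snd k hk]; omega
  · rw [kk_int E h1 h2]
    simp only [Set.mem_insert_iff, Set.mem_singleton_iff]
    constructor
    · rintro (h | h)
      · have := s.inj _ _ hk (by omega) h; omega
      · have := s.inj _ _ hk (by omega) h; omega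
    · rintro (rfl | rfl)
      · exact Or.inr rfl
      · exact Or.inl rfl

theorem kk_inj (f : NF G X H n x) {E : Set V} (hE : E ∈ H.arcs) {i j : ℕ} (hi : i ≤ n E + 1)
    (hj : j ≤ n E + 1) (h : kk H n x E i = kk H n x E j) : i = j := by
  have key : ∀ i j, i < j → j ≤ n E + 1 → kk H n x E i ≠ kk H n x E j := by
    intro i j hij hj h
    have h1 := (f.mem_kk hE (k := i) (j := i) (by omega) (by omega)).2 (Or.inl rfl)
    rw [h, f.mem_kk hE (by omega) hj] at h1
    by_cases hi : i = 0
    · subst hi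
      by_cases hn : n E = 0
      · have : j = n E + 1 := by omega
        subst this
        rw [kk_zero, kk_last] at h
        exact f.net.ends_ne E hE h
      · have h2 := (f.mem_kk hE (k := 1) (j := j) (by omega) (by omega)).2 (by omega)
        rw [← h, f.mem_kk hE (by omega) (by omega)] at h2
        omega
    · have h2 := (f.mem_kk hE (k := i - 1) (j := i) (by omega) (by omega)).2 (by omega)
      rw [h, f.mem_kk hE (by omega) hj] at h2
      omega
  rcases lt_trichotomy i j with h1 | h1 | h1
  · exact absurd h (key i j h1 hj)
  · exact h1
  · exact absurd h.symm (key j i h1 hi)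

theorem kk_mem {E : Set V} (hE : E ∈ H.arcs) {j : ℕ} (hj : j ≤ n E + 1) :
    kk H n x E j ∈ KN H n x := ⟨E, hE, j, hj, rfl⟩

theorem ends_kk {E N : Set V} : H.EndsAt E N ↔ N = kk H n x E 0 ∨ N = kk H n x E (n E + 1) := by
  rw [kk_zero, kk_last, Net.EndsAt]
  constructor <;> rintro (h | h) <;> simp [h]

theorem node_mem (f : NF G X H n x) {N : Set V} (hN : N ∈ H.nodes) : N ∈ KN H n x := by
  obtain ⟨E, hE, h⟩ := node_arc f.net hN
  rcases (ends_kk (n := n) (x := x)).1 h with rfl | rfl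
  · exact kk_mem hE (by omega)
  · exact kk_mem hE (by omega)

theorem int_sub (f : NF G X H n x) {E : Set V} (hE : E ∈ H.arcs) {j : ℕ} (h1 : 1 ≤ j)
    (h2 : j ≤ n E) : kk H n x E j ⊆ E := by
  rw [kk_int E h1 h2]
  rintro v (rfl | rfl)
  · exact ((f.seq E hE).mem _).2 ⟨j - 1, by omega, rfl⟩
  · exact ((f.seq E hE).mem _).2 ⟨j, by omega, rfl⟩

theorem KN_case (f : NF G X H n x) {P : Set V} (hP : P ∈ KN H n x) :
    P ∈ H.nodes ∨ ∃ E ∈ H.arcs, P ⊆ E := by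
  obtain ⟨E, hE, j, hj, rfl⟩ := hP
  rcases jcase hj with rfl | rfl | ⟨h1, h2⟩
  · left; rw [kk_zero]; exact f.net.fst_mem E hE
  · left; rw [kk_last]; exact f.net.snd_mem E hE
  · right; exact ⟨E, hE, f.int_sub hE h1 h2⟩

theorem xmem (f : NF G X H n x) {v : V} (hv : v ∈ X) : ∃ E ∈ H.arcs, ∃ i, i ≤ n E ∧ v = x E i := by
  rw [← f.net.arcs_cover] at hv
  obtain ⟨E, hE, h⟩ := hv
  obtain ⟨i, hi, rfl⟩ := ((f.seq E hE).mem v).1 h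
  exact ⟨E, hE, i, hi, rfl⟩

theorem x_arc (f : NF G X H n x) {E : Set V} (hE : E ∈ H.arcs) {i : ℕ} (hi : i ≤ n E) : x E i ∈ E :=
  ((f.seq E hE).mem _).2 ⟨i, hi, rfl⟩

/-- nodes containing a vertex of an arc -/
theorem node_x (f : NF G X H n x) {E : Set V} (hE : E ∈ H.arcs) {i : ℕ} (hi : i ≤ n E) {N : Set V}
    (hN : N ∈ H.nodes) (h : x E i ∈ N) :
    (N = kk H n x E 0 ∧ i = 0) ∨ (N = kk H n x E (n E + 1) ∧ i = n E) := by
  have := (f.net.meets_iff E hE N hN).1 ⟨x E i, f.x_arc hE hi, h⟩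
  rcases (ends_kk (n := n) (x := x)).1 this with rfl | rfl
  · rw [f.mem_kk hE hi (by omega)] at h
    exact Or.inl ⟨rfl, by omega⟩
  · rw [f.mem_kk hE hi (by omega)] at h
    exact Or.inr ⟨rfl, by omega⟩

theorem K_x (f : NF G X H n x) {E : Set V} (hE : E ∈ H.arcs) {i : ℕ} (hi : i ≤ n E) {P : Set V}
    (hP : P ∈ KN H n x) (h : x E i ∈ P) : P = kk H n x E i ∨ P = kk H n x E (i + 1) := by
  have node : P ∈ H.nodes → P = kk H n x E i ∨ P = kk H n x E (i + 1) := by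
    intro hN
    rcases f.node_x hE hi hN h with ⟨h1, rfl⟩ | ⟨h1, rfl⟩
    · exact Or.inl h1
    · exact Or.inr h1
  obtain ⟨F, hF, j, hj, rfl⟩ := hP
  rcases jcase hj with rfl | rfl | ⟨h1, h2⟩
  · apply node; rw [kk_zero]; exact f.net.fst_mem F hF
  · apply node; rw [kk_last]; exact f.net.snd_mem F hF
  · have : E = F := arc_eq f.net hE hF (f.x_arc hE hi) (f.int_sub hF h1 h2 h)
    subst this
    rw [f.mem_kk hE hi hj] at h
    rcases h with rfl | rfl <;> simp

theorem node_of_two (f : NF G X H n x) {E F : Set V} (hE : E ∈ H.arcs) (hF : F ∈ H.arcs)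
    (hEF : E ≠ F) {u v : V} (hu : u ∈ E) (hv : v ∈ F) {P : Set V} (hP : P ∈ KN H n x) (uP : u ∈ P)
    (vP : v ∈ P) : P ∈ H.nodes := by
  rcases f.KN_case hP with h | ⟨E', hE', h⟩
  · exact h
  · have h1 := arc_eq f.net hE hE' hu (h uP)
    have h2 := arc_eq f.net hF hE' hv (h vP)
    exact absurd (h1.trans h2.symm) hEF

theorem ks (f : NF G X H n x) : KS G X (KN H n x) where
  sub := by
    intro P hP
    rcases f.KN_case hP with h | ⟨E, hE, h⟩
    · exact f.net.nodes_sub P h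
    · exact h.trans (arc_sub f.net hE)
  two := by
    intro v hv
    obtain ⟨E, hE, i, hi, rfl⟩ := f.xmem hv
    refine ⟨kk H n x E i, kk_mem hE (by omega), kk H n x E (i + 1), kk_mem hE (by omega), ?_, ?_, ?_, ?_⟩
    · intro h
      have := f.kk_inj hE (by omega) (by omega) h
      omega
    · exact (f.mem_kk hE hi (by omega)).2 (by omega)
    · exact (f.mem_kk hE hi (by omega)).2 (by omega)
    · intro R hR hv
      exact f.K_x hE hi hR hv
  adj := by
    intro u hu v hv huv
    obtain ⟨E, hE, i, hi, rfl⟩ := f.xmem hu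
    obtain ⟨F, hF, k, hk, rfl⟩ := f.xmem hv
    by_cases hEF : E = F
    · subst hEF
      rw [(f.seq E hE).adj i k hi hk]
      constructor
      · rintro (rfl | rfl)
        · exact ⟨kk H n x E (i + 1), kk_mem hE (by omega), (f.mem_kk hE hi (by omega)).2 (by omega),
            (f.mem_kk hE hk (by omega)).2 (by omega)⟩
        · exact ⟨kk H n x E (k + 1), kk_mem hE (by omega), (f.mem_kk hE hi (by omega)).2 (by omega),
            (f.mem_kk hE hk (by omega)).2 (by omega)⟩
      · rintro ⟨P, hP, uP, vP⟩
        have hik : i ≠ k := by rintro rfl; exact huv rfl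
        rcases f.K_x hE hi hP uP with rfl | rfl
        · rw [f.mem_kk hE hk (by omega)] at vP
          omega
        · rw [f.mem_kk hE hk (by omega)] at vP
          omega
    · rw [f.net.adj_iff E hE F hF hEF _ (f.x_arc hE hi) _ (f.x_arc hF hk)]
      constructor
      · rintro ⟨N, hN, -, -, h1, h2⟩
        exact ⟨N, f.node_mem hN, h1, h2⟩
      · rintro ⟨P, hP, h1, h2⟩
        have hN := f.node_of_two hE hF hEF (f.x_arc hE hi) (f.x_arc hF hk) hP h1 h2
        exact ⟨P, hN, (f.net.meets_iff E hE P hN).1 ⟨_, f.x_arc hE hi, h1⟩,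
          (f.net.meets_iff F hF P hN).1 ⟨_, f.x_arc hF hk, h2⟩, h1, h2⟩
  k3 := by
    intro P hP Q hQ hPQ u v uP uQ vP vQ
    have hu : u ∈ X := by
      rcases f.KN_case hP with h | ⟨E, hE, h⟩
      · exact f.net.nodes_sub P h uP
      · exact arc_sub f.net hE (h uP)
    have hv : v ∈ X := by
      rcases f.KN_case hP with h | ⟨E, hE, h⟩
      · exact f.net.nodes_sub P h vP
      · exact arc_sub f.net hE (h vP)
    obtain ⟨E, hE, i, hi, rfl⟩ := f.xmem hu
    obtain ⟨F, hF, k, hk, rfl⟩ := f.xmem hv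
    by_cases hEF : E = F
    · subst hEF
      have hik : i = k := by
        rcases f.K_x hE hi hP uP with rfl | rfl <;> rcases f.K_x hE hi hQ uQ with rfl | rfl
        · exact absurd rfl hPQ
        · rw [f.mem_kk hE hk (by omega)] at vP vQ; omega
        · rw [f.mem_kk hE hk (by omega)] at vP vQ; omega
        · exact absurd rfl hPQ
      rw [hik]
    · exfalso
      have hN := f.node_of_two hE hF hEF (f.x_arc hE hi) (f.x_arc hF hk) hP uP vP
      have hM := f.node_of_two hE hF hEF (f.x_arc hE hi) (f.x_arc hF hk) hQ uQ vQ
      have e1 := (f.net.meets_iff E hE P hN).1 ⟨_, f.x_arc hE hi, uP⟩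
      have e2 := (f.net.meets_iff F hF P hN).1 ⟨_, f.x_arc hF hk, vP⟩
      have e3 := (f.net.meets_iff E hE Q hM).1 ⟨_, f.x_arc hE hi, uQ⟩
      have e4 := (f.net.meets_iff F hF Q hM).1 ⟨_, f.x_arc hF hk, vQ⟩
      apply hEF
      apply f.nopar E hE F hF
      unfold Net.EndsAt at e1 e2 e3 e4
      clear uP vP uQ vQ hu hv
      grind

theorem kk_node (f : NF G X H n x) {E : Set V} (hE : E ∈ H.arcs) {j : ℕ} (hj : j ≤ n E + 1)
    (h : kk H n x E j ∈ H.nodes) : j = 0 ∨ j = n E + 1 := by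
  by_contra hcon
  have h1 : j ≤ n E := by omega
  rcases f.node_x hE h1 h ((f.mem_kk hE h1 hj).2 (Or.inl rfl)) with ⟨h2, h3⟩ | ⟨h2, h3⟩
  · omega
  · have := f.kk_inj hE hj le_rfl h2
    omega

theorem int_unique (f : NF G X H n x) {E F : Set V} (hE : E ∈ H.arcs) (hF : F ∈ H.arcs) {a c : ℕ}
    (hc : c ≤ n F + 1) (h1 : 1 ≤ a) (h2 : a ≤ n E) (h : kk H n x E a = kk H n x F c) : E = F := by
  have hx : x E a ∈ kk H n x E a := (f.mem_kk hE h2 (by omega)).2 (Or.inl rfl)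
  have hnn : kk H n x E a ∉ H.nodes := by
    intro h
    rcases f.kk_node hE (by omega) h with h | h <;> omega
  rcases jcase hc with rfl | rfl | ⟨h3, h4⟩
  · rw [h, kk_zero] at hnn
    exact absurd (f.net.fst_mem F hF) hnn
  · rw [h, kk_last] at hnn
    exact absurd (f.net.snd_mem F hF) hnn
  · rw [h] at hx
    exact arc_eq f.net hE hF (f.x_arc hE h2) (f.int_sub hF h3 h4 hx)

theorem arc_unique (f : NF G X H n x) {E F : Set V} (hE : E ∈ H.arcs) (hF : F ∈ H.arcs)
    {a b c d : ℕ} (ha : a ≤ n E + 1) (hb : b ≤ n E + 1) (hc : c ≤ n F + 1) (hd : d ≤ n F + 1)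
    (hab : a ≠ b) (h1 : kk H n x E a = kk H n x F c) (h2 : kk H n x E b = kk H n x F d) :
    E = F := by
  by_cases a1 : 1 ≤ a ∧ a ≤ n E
  · exact f.int_unique hE hF hc a1.1 a1.2 h1
  by_cases b1 : 1 ≤ b ∧ b ≤ n E
  · exact f.int_unique hE hF hd b1.1 b1.2 h2
  by_cases c1 : 1 ≤ c ∧ c ≤ n F
  · exact (f.int_unique hF hE ha c1.1 c1.2 h1.symm).symm
  by_cases d1 : 1 ≤ d ∧ d ≤ n F
  · exact (f.int_unique hF hE hb d1.1 d1.2 h2.symm).symm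
  have hcd : c ≠ d := by
    rintro rfl
    exact hab (f.kk_inj hE ha hb (h1.trans h2.symm))
  apply f.nopar E hE F hF
  rcases jcase ha with rfl | rfl | h
  · obtain rfl : b = n E + 1 := by omega
    rcases jcase hc with rfl | rfl | h
    · obtain rfl : d = n F + 1 := by omega
      simp only [kk_zero, kk_last] at h1 h2
      exact Or.inl ⟨h1, h2⟩
    · obtain rfl : d = 0 := by omega
      simp only [kk_zero, kk_last] at h1 h2
      exact Or.inr ⟨h1, h2⟩
    · exact absurd h c1
  · obtain rfl : b = 0 := by omega
    rcases jcase hc with rfl | rfl | h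
    · obtain rfl : d = n F + 1 := by omega
      simp only [kk_zero, kk_last] at h1 h2
      exact Or.inr ⟨h2, h1⟩
    · obtain rfl : d = 0 := by omega
      simp only [kk_zero, kk_last] at h1 h2
      exact Or.inl ⟨h2, h1⟩
    · exact absurd h c1
  · exact absurd h a1

/-- if `u` is in two members of the sequence of `E` then it is in `E` -/
theorem mem_of_two (f : NF G X H n x) {E : Set V} (hE : E ∈ H.arcs) {a b : ℕ} (ha : a ≤ n E + 1)
    (hb : b ≤ n E + 1) (hab : a ≠ b) {u : V} (h1 : u ∈ kk H n x E a) (h2 : u ∈ kk H n x E b) :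
    u ∈ E := by
  obtain ⟨F, hF, i, hi, rfl⟩ := f.xmem (f.ks.sub _ (kk_mem hE ha) h1)
  have e : ∀ a, a ≤ n E + 1 → x F i ∈ kk H n x E a → ∃ c, c ≤ n F + 1 ∧ kk H n x E a = kk H n x F c := by
    intro a ha h
    rcases f.K_x hF hi (kk_mem hE ha) h with h | h
    · exact ⟨i, by omega, h⟩
    · exact ⟨i + 1, by omega, h⟩
  obtain ⟨c, hc, e1⟩ := e a ha h1
  obtain ⟨d, hd, e2⟩ := e b hb h2
  rw [f.arc_unique hE hF ha hb hc hd hab e1 e2]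
  exact f.x_arc hF hi

theorem adj_kk (f : NF G X H n x) {E : Set V} (hE : E ∈ H.arcs) {i : ℕ} (hi : i ≤ n E) :
    (kGraph (KN H n x)).Adj (kk H n x E i) (kk H n x E (i + 1)) := by
  refine ⟨?_, kk_mem hE (by omega), kk_mem hE (by omega), x E i, (f.mem_kk hE hi (by omega)).2 (by omega),
    (f.mem_kk hE hi (by omega)).2 (by omega)⟩
  intro h
  have := f.kk_inj hE (by omega) (by omega) h
  omega

theorem lfH (f : NF G X H n x) {y : V} (hy : y ∉ X) : LfH G (KN H n x) H.IsLeafNode y where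
  mem := fun P h => f.node_mem h.1
  single := fun P h => f.net.leaf_single P h
  noF := by
    rintro P Q hP ⟨hne, hPK, hQK, u, uP, uQ, hyu⟩
    obtain ⟨l, hl, rfl⟩ := f.net.leaf_single P hP
    rw [Set.mem_singleton_iff] at uP
    subst uP
    have : ∃ m ∈ Q, m ≠ u := by
      by_contra hcon
      push Not at hcon
      apply hne
      ext z
      constructor
      · rintro rfl; exact uQ
      · intro hz; exact hcon z hz
    obtain ⟨m, hm, hmu⟩ := this
    have h1 := (f.ks.adj u (f.ks.sub _ hQK uQ) m (f.ks.sub _ hQK hm) hmu.symm).2 ⟨Q, hQK, uQ, hm⟩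
    have := hl.unique h1 hyu.symm
    exact hy (this ▸ f.ks.sub _ hQK hm)

end NF
end KNet

section KFinal
variable {V : Type*} {G : SimpleGraph V} {X : Set V} {H : Net V} {n : Set V → ℕ}
  {x : Set V → ℕ → V}

theorem switch_idx (p : ℕ → Prop) : ∀ m l : ℕ, l ≤ m → ¬ (p l ↔ p m) →
    ∃ j, l ≤ j ∧ j < m ∧ ¬ (p j ↔ p (j + 1)) := by
  intro m l h
  induction m, h using Nat.le_induction with
  | base => intro h; exact absurd Iff.rfl h
  | succ m hm ih =>
    intro h
    by_cases h1 : p m ↔ p (m + 1)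
    · rw [← h1] at h
      obtain ⟨j, h2, h3, h4⟩ := ih h
      exact ⟨j, h2, by omega, h4⟩
    · exact ⟨m, hm, by omega, h1⟩

namespace NF

theorem switch (f : NF G X H n x) {Lf : Set V → Prop} {s1 s2 : Set V} {D : Set (Set V)}
    (hD : ClosedD (kGraph (KN H n x)) Lf s1 s2 D) {E : Set V} (hE : E ∈ H.arcs) {l m : ℕ}
    (hlm : l ≤ m) (hm : m ≤ n E + 1) (h : ¬ (kk H n x E l ∈ D ↔ kk H n x E m ∈ D)) :
    ∃ j, l ≤ j ∧ j ≤ m ∧ kk H n x E j ∉ D ∧ (kk H n x E j = s1 ∨ kk H n x E j = s2) := by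
  obtain ⟨j, h1, h2, h3⟩ := switch_idx (fun j => kk H n x E j ∈ D) m l hlm h
  have ha := f.adj_kk hE (i := j) (by omega)
  by_cases hj : kk H n x E j ∈ D
  · have hj' : kk H n x E (j + 1) ∉ D := fun h => h3 ⟨fun _ => h, fun _ => hj⟩
    exact ⟨j + 1, by omega, by omega, hj', (hD.2.2.2 _ hj _ ha).resolve_left hj'⟩
  · have hj' : kk H n x E (j + 1) ∈ D := by
      by_contra h
      exact h3 ⟨fun h' => absurd h' hj, fun h' => absurd h' h⟩
    exact ⟨j, by omega, by omega, hj, (hD.2.2.2 _ hj' _ ha.symm).resolve_left hj⟩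

/-- an arc from an inside node to an outside node `q` -/
def Cr (H : Net V) (D : Set (Set V)) (E q : Set V) : Prop :=
  E ∈ H.arcs ∧ q ∉ D ∧ H.EndsAt E q ∧ ∃ p, p ∈ D ∧ H.EndsAt E p

theorem cr_s (f : NF G X H n x) {Lf : Set V → Prop} {s1 s2 : Set V} {D : Set (Set V)}
    (hD : ClosedD (kGraph (KN H n x)) Lf s1 s2 D) {E q : Set V} (hc : Cr H D E q) :
    ∃ j, j ≤ n E + 1 ∧ kk H n x E j ∉ D ∧ (kk H n x E j = s1 ∨ kk H n x E j = s2) := by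
  obtain ⟨hE, hq, eq, p, hp, ep⟩ := hc
  rw [ends_kk (n := n) (x := x)] at eq ep
  have : ¬ (kk H n x E 0 ∈ D ↔ kk H n x E (n E + 1) ∈ D) := by
    rcases eq with rfl | rfl <;> rcases ep with rfl | rfl <;> tauto
  obtain ⟨j, h1, h2, h3⟩ := f.switch hD hE (Nat.zero_le _) le_rfl this
  exact ⟨j, h2, h3⟩

theorem cr_unique (f : NF G X H n x) {D : Set (Set V)} {E F q r : Set V} (h1 : Cr H D E q)
    (h2 : Cr H D F r) {j k : ℕ} (hj : j ≤ n E + 1) (hk : k ≤ n F + 1) (hjD : kk H n x E j ∉ D)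
    (h : kk H n x E j = kk H n x F k) : q = r := by
  obtain ⟨hE, hq, eq, p, hp, ep⟩ := h1
  obtain ⟨hF, hr, er, p', hp', ep'⟩ := h2
  by_cases hint : 1 ≤ j ∧ j ≤ n E
  · have := f.int_unique hE hF hk hint.1 hint.2 h
    subst this
    unfold Net.EndsAt at *
    clear h hint hjD
    rcases eq with rfl | rfl <;> rcases ep with rfl | rfl <;> rcases er with rfl | rfl <;>
      rcases ep' with rfl | rfl <;> first | rfl | contradiction
  by_cases hint' : 1 ≤ k ∧ k ≤ n F
  · exact absurd (f.int_unique hF hE hj hint'.1 hint'.2 h.symm).symm (by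
      intro e
      subst e
      have := f.kk_inj hE hj hk h
      omega)
  have e1 : ∀ {E q p : Set V} {j : ℕ}, j ≤ n E + 1 → ¬ (1 ≤ j ∧ j ≤ n E) → kk H n x E j ∉ D → q ∉ D →
      p ∈ D → H.EndsAt E q → H.EndsAt E p → q = kk H n x E j := by
    intro E q p j hj hint hjD hq hp eq ep
    rw [ends_kk (n := n) (x := x)] at eq ep
    rcases jcase hj with rfl | rfl | h
    · rcases eq with rfl | rfl
      · rfl
      · rcases ep with rfl | rfl <;> contradiction
    · rcases eq with rfl | rfl
      · rcases ep with rfl | rfl <;> contradiction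
      · rfl
    · exact absurd h hint
  rw [e1 hj hint hjD hq hp eq ep, e1 hk hint' (h ▸ hjD) hr hp' er ep', h]

theorem leaf3 (f : NF G X H n x) : ∃ a b c, a ≠ b ∧ a ≠ c ∧ b ≠ c ∧
    ∀ d, H.IsLeafNode d ↔ d = a ∨ d = b ∨ d = c := by
  obtain ⟨a, b, c, h1, h2, h3, h4⟩ := Set.ncard_eq_three.1 f.net.leaf_count
  refine ⟨a, b, c, h1, h2, h3, fun d => ?_⟩
  have : d ∈ {N | H.IsLeafNode N} ↔ d ∈ ({a, b, c} : Set (Set V)) := by rw [h4]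
  simpa using this

theorem no_node (f : NF G X H n x) {s1 s2 : Set V} {D : Set (Set V)}
    (hD : ClosedD (kGraph (KN H n x)) H.IsLeafNode s1 s2 D) {N : Set V} (hN : N ∈ H.nodes) :
    N ∉ D := by
  intro hND
  obtain ⟨a, b, c, hab, hac, hbc, hl⟩ := f.leaf3
  have ha := (hl a).2 (Or.inl rfl)
  have hb := (hl b).2 (Or.inr (Or.inl rfl))
  have hc := (hl c).2 (Or.inr (Or.inr rfl))
  have hex : ∀ s : Set V, ∃ U, U ∈ H.nodes ∧ U ∉ D ∧ ∀ E q j, Cr H D E q → j ≤ n E + 1 →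
      kk H n x E j ∉ D → kk H n x E j = s → q = U := by
    intro s
    by_cases h : ∃ E q j, Cr H D E q ∧ j ≤ n E + 1 ∧ kk H n x E j ∉ D ∧ kk H n x E j = s
    · obtain ⟨E, q, j, h1, h2, h3, h4⟩ := h
      refine ⟨q, ?_, h1.2.1, ?_⟩
      · rcases h1.2.2.1 with h | h
        · rw [← h]; exact f.net.fst_mem E h1.1
        · rw [← h]; exact f.net.snd_mem E h1.1
      · intro F r k g1 g2 g3 g4
        exact f.cr_unique g1 h1 g2 h2 g3 (g4.trans h4.symm)
    · exact ⟨a, ha.1, hD.2.2.1 a ha, fun E q j h1 h2 h3 h4 => absurd ⟨E, q, j, h1, h2, h3, h4⟩ h⟩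
  obtain ⟨U1, u1, u2, u3⟩ := hex s1
  obtain ⟨U2, v1, v2, v3⟩ := hex s2
  have hpad : ∃ U W, U ∈ H.nodes ∧ W ∈ H.nodes ∧ U ≠ W ∧ U ∉ D ∧ W ∉ D ∧ (U1 = U ∨ U1 = W) ∧
      (U2 = U ∨ U2 = W) := by
    by_cases h : U1 = U2
    · by_cases h' : U1 = a
      · exact ⟨U1, b, u1, hb.1, by rw [h']; exact hab, u2, hD.2.2.1 b hb, Or.inl rfl, Or.inl h.symm⟩
      · exact ⟨U1, a, u1, ha.1, h', u2, hD.2.2.1 a ha, Or.inl rfl, Or.inl h.symm⟩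
    · exact ⟨U1, U2, u1, v1, h, u2, v2, Or.inl rfl, Or.inr rfl⟩
  obtain ⟨U, W, hU, hW, hUW, hUD, hWD, hU1, hU2⟩ := hpad
  have hcr : ∀ E q, Cr H D E q → q = U ∨ q = W := by
    intro E q h
    obtain ⟨j, h1, h2, h3 | h3⟩ := f.cr_s hD h
    · rw [u3 E q j h h1 h2 h3]; exact hU1
    · rw [v3 E q j h h1 h2 h3]; exact hU2
  have hl3 : ∃ l, H.IsLeafNode l ∧ l ≠ U ∧ l ≠ W := by
    by_contra hcon
    push Not at hcon
    have h1 := hcon a ha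
    have h2 := hcon b hb
    have h3 := hcon c hc
    clear hcon hcr hex u3 v3 hl hD
    by_cases h4 : a = U
    · subst h4
      have := h2 hab.symm
      have := h3 hac.symm
      exact hbc (by simp_all)
    · by_cases h5 : b = U
      · subst h5
        have := h1 h4
        have := h3 hbc.symm
        exact hac (by simp_all)
      · exact hab ((h1 h4).trans (h2 h5).symm)
  obtain ⟨l, hl1, hl2, hl3⟩ := hl3
  have hcn := f.cut U hU W hW hUW N ⟨hN, by
    rintro (rfl | rfl)
    · exact hUD hND
    · exact hWD hND⟩ l ⟨hl1.1, by
    rintro (h | h)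
    · exact hl2 h
    · exact hl3 h⟩
  obtain ⟨p, q, hpq, hp, hq, hp', hq'⟩ := hcn.exit D hND (hD.2.2.1 l hl1)
  rw [Net.nabla, SimpleGraph.fromRel_adj] at hpq
  have hcrx : ∃ E, Cr H D E q := by
    rcases hpq.2 with (h | h) | (h | h)
    · obtain ⟨-, -, -, F, hF, ⟨h1, h2⟩ | ⟨h1, h2⟩⟩ := h
      · exact ⟨F, hF, hq, Or.inr h2, p, hp, Or.inl h1⟩
      · exact ⟨F, hF, hq, Or.inl h1, p, hp, Or.inr h2⟩
    · exact absurd hp (hD.2.2.1 p h.1)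
    · obtain ⟨-, -, -, F, hF, ⟨h1, h2⟩ | ⟨h1, h2⟩⟩ := h
      · exact ⟨F, hF, hq, Or.inl h1, p, hp, Or.inr h2⟩
      · exact ⟨F, hF, hq, Or.inr h2, p, hp, Or.inl h1⟩
    · exact absurd hp (hD.2.2.1 p h.2)
  obtain ⟨E, hE⟩ := hcrx
  exact hq'.2 (hcr E q hE)

theorem closed1 (f : NF G X H n x) {s1 s2 : Set V} {D : Set (Set V)}
    (hD : ClosedD (kGraph (KN H n x)) H.IsLeafNode s1 s2 D) {P : Set V} (hP : P ∈ KN H n x)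
    (hPD : P ∈ D) : ∃ E ∈ H.arcs, ∃ a b j, a ≤ n E + 1 ∧ b ≤ n E + 1 ∧ a ≠ b ∧ s1 = kk H n x E a ∧
      s2 = kk H n x E b ∧ j ≤ n E + 1 ∧ P = kk H n x E j := by
  obtain ⟨E, hE, j, hj, rfl⟩ := hP
  have h0 : kk H n x E 0 ∉ D := f.no_node hD (by rw [kk_zero]; exact f.net.fst_mem E hE)
  have h1 : kk H n x E (n E + 1) ∉ D := f.no_node hD (by rw [kk_last]; exact f.net.snd_mem E hE)
  obtain ⟨a, a1, a2, a3, a4⟩ := f.switch hD hE (Nat.zero_le j) hj (by tauto)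
  obtain ⟨b, b1, b2, b3, b4⟩ := f.switch hD hE hj le_rfl (by tauto)
  have haj : a ≠ j := by rintro rfl; exact a3 hPD
  have hbj : b ≠ j := by rintro rfl; exact b3 hPD
  have hab : kk H n x E a ≠ kk H n x E b := by
    intro h
    have := f.kk_inj hE (by omega) b2 h
    omega
  rcases a4 with a4 | a4 <;> rcases b4 with b4 | b4
  · exact absurd (a4.trans b4.symm) hab
  · exact ⟨E, hE, a, b, j, by omega, b2, by omega, a4.symm, b4.symm, hj, rfl⟩
  · exact ⟨E, hE, b, a, j, b2, by omega, by omega, b4.symm, a4.symm, hj, rfl⟩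
  · exact absurd (a4.trans b4.symm) hab

theorem closed (f : NF G X H n x) {s1 s2 : Set V} {D : Set (Set V)}
    (hD : ClosedD (kGraph (KN H n x)) H.IsLeafNode s1 s2 D) (hne : ∃ P ∈ KN H n x, P ∈ D) :
    ∃ E ∈ H.arcs, ∃ a b, a ≤ n E + 1 ∧ b ≤ n E + 1 ∧ a ≠ b ∧ s1 = kk H n x E a ∧
      s2 = kk H n x E b ∧ ∀ P ∈ KN H n x, P ∈ D → ∃ j, j ≤ n E + 1 ∧ P = kk H n x E j := by
  obtain ⟨P, hP, hPD⟩ := hne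
  obtain ⟨E, hE, a, b, -, ha, hb, hab, h1, h2, -⟩ := f.closed1 hD hP hPD
  refine ⟨E, hE, a, b, ha, hb, hab, h1, h2, fun Q hQ hQD => ?_⟩
  obtain ⟨F, hF, c, d, j, hc, hd, hcd, h3, h4, h5, h6⟩ := f.closed1 hD hQ hQD
  have := f.arc_unique hE hF ha hb hc hd hab (h1.symm.trans h3) (h2.symm.trans h4)
  subst this
  exact ⟨j, h5, h6⟩

end NF

theorem ell_le_two {Y A B : Set V} (hA : Tamed H A) (hB : Tamed H B) (h : NX G X Y ⊆ A ∪ B) :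
    ell G X H Y ≤ 2 := by
  let S1 := NX G X Y ∩ A
  let S2 := NX G X Y ∩ B
  have h1 : ell G X H Y ≤ ({S1, S2} : Finset (Set V)).card := by
    refine Nat.sInf_le ⟨{S1, S2}, rfl, ?_, ?_⟩
    · intro S hS
      simp only [Finset.mem_insert, Finset.mem_singleton] at hS
      rcases hS with rfl | rfl
      · exact ⟨fun z hz => hz.1.1, fun u hu v hv => hA u hu.2 v hv.2⟩
      · exact ⟨fun z hz => hz.1.1, fun u hu v hv => hB u hu.2 v hv.2⟩
    · ext z
      simp only [Finset.coe_insert, Finset.coe_singleton, Set.sUnion_insert, Set.sUnion_singleton]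
      constructor
      · rintro (h | h) <;> exact h.1
      · intro hz
        rcases h hz with h' | h'
        · exact Or.inl ⟨hz, h'⟩
        · exact Or.inr ⟨hz, h'⟩
  exact h1.trans Finset.card_le_two

namespace NF

theorem tamedK (f : NF G X H n x) (P : Set V) : Tamed H {u | P ∈ KN H n x ∧ u ∈ P} := by
  rintro u ⟨hP, hu⟩ v ⟨-, hv⟩
  rcases f.KN_case hP with h | ⟨E, hE, h⟩
  · exact Or.inr ⟨P, h, hu, hv⟩
  · exact Or.inl ⟨E, hE, h hu, h hv⟩

theorem tamedE {E : Set V} (hE : E ∈ H.arcs) : Tamed H E :=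
  fun _ hu _ hv => Or.inl ⟨E, hE, hu, hv⟩

theorem fedge (f : NF G X H n x) {y u : V} (hu : u ∈ NX G X {y}) : ∃ E ∈ H.arcs, ∃ i, i ≤ n E ∧
    u = x E i ∧ u ∈ kk H n x E i ∧ u ∈ kk H n x E (i + 1) ∧
    (fGraph G (KN H n x) y).Adj (kk H n x E i) (kk H n x E (i + 1)) := by
  obtain ⟨hX, y', rfl, hy⟩ := hu
  obtain ⟨E, hE, i, hi, rfl⟩ := f.xmem hX
  have h1 := (f.mem_kk hE hi (j := i) (by omega)).2 (by omega)
  have h2 := (f.mem_kk hE hi (j := i + 1) (by omega)).2 (by omega)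
  have ha := f.adj_kk hE hi
  exact ⟨E, hE, i, hi, rfl, h1, h2, ha.1, ha.2.1, ha.2.2.1, _, h1, h2, hy⟩

theorem coreHyp [Finite V] (f : NF G X H n x) (hleaves : {v | IsLeaf G v}.ncard = 3) {y : V}
    (hy : y ∉ X) (hfree : ¬ ∃ T, T ⊆ X ∪ {y} ∧ IsSapling G T) (hunt : ¬ TamedOut G X H {y})
    (hell : 3 ≤ ell G X H {y}) :
    CoreHyp (kGraph (KN H n x)) (fGraph G (KN H n x) y) H.IsLeafNode where
  hle := fGraph_le y
  h3 := f.leaf3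
  leafF := fun a z h => (f.lfH hy).noF a z h
  sapA := fun L M P t f1 f2 f3 => f.ks.sapA (f.lfH hy) hleaves hy hfree t f1 f2 f3
  sapB := fun L M P t c1 c2 f1 f2 => f.ks.sapB (f.lfH hy) hleaves hy hfree t c1 c2 f1 f2
  hH1 := by
    intro s1 s2 D hD hF
    by_cases hne : ∃ P ∈ KN H n x, P ∈ D
    · obtain ⟨E, hE, a, b, ha, hb, hab, h1, h2, h3⟩ := f.closed hD hne
      have := ell_le_two (G := G) (X := X) (Y := {y}) (f.tamedK s1) (tamedE hE) (by
        intro u hu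
        obtain ⟨F, hF', i, hi, -, m1, m2, hadj⟩ := f.fedge hu
        rcases hF _ _ hadj with h | h | ⟨g1, g2⟩
        · exact Or.inl ⟨h ▸ hadj.2.1, h ▸ m1⟩
        · exact Or.inl ⟨h ▸ hadj.2.2.1, h ▸ m2⟩
        · have key : ∀ P ∈ KN H n x, P ∈ insert s2 D → ∃ j, j ≤ n E + 1 ∧ P = kk H n x E j := by
            rintro P hP (rfl | h)
            · exact ⟨b, hb, h2⟩
            · exact h3 P hP h
          obtain ⟨c, hc, e1⟩ := key _ hadj.2.1 g1
          obtain ⟨d, hd, e2⟩ := key _ hadj.2.2.1 g2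
          rw [e1] at m1
          rw [e2] at m2
          refine Or.inr (f.mem_of_two hE hc hd ?_ m1 m2)
          rintro rfl
          exact hadj.1 (e1.trans e2.symm))
      omega
    · have := ell_le_two (G := G) (X := X) (Y := {y}) (f.tamedK s1) (f.tamedK s2) (by
        intro u hu
        obtain ⟨F, hF', i, hi, -, m1, m2, hadj⟩ := f.fedge hu
        rcases hF _ _ hadj with h | h | ⟨g1 | g1, -⟩
        · exact Or.inl ⟨h ▸ hadj.2.1, h ▸ m1⟩
        · exact Or.inl ⟨h ▸ hadj.2.2.1, h ▸ m2⟩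
        · exact Or.inr ⟨g1 ▸ hadj.2.1, g1 ▸ m1⟩
        · exact absurd ⟨_, hadj.2.1, g1⟩ hne)
      omega
  hH2 := by
    unfold TamedOut Tamed at hunt
    push Not at hunt
    obtain ⟨u, hu, v, hv, h1, h2⟩ := hunt
    obtain ⟨E, hE, i, hi, rfl, u1, u2, uadj⟩ := f.fedge hu
    obtain ⟨F, hF, j, hj, rfl, v1, v2, vadj⟩ := f.fedge hv
    have hEF : E ≠ F := by
      rintro rfl
      exact h1 E hE (f.x_arc hE hi) (f.x_arc hE hj)
    have key : ∀ P ∈ KN H n x, ∀ Q, x E i ∈ P → x F j ∈ Q → P ≠ Q := by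
      rintro P hP Q hu hv rfl
      exact h2 P (f.node_of_two hE hF hEF (f.x_arc hE hi) (f.x_arc hF hj) hP hu hv) hu hv
    have d1 := key _ uadj.2.1 _ u1 v1
    have d2 := key _ uadj.2.1 _ u1 v2
    have d3 := key _ uadj.2.2.1 _ u2 v1
    have d4 := key _ uadj.2.2.1 _ u2 v2
    refine ⟨_, _, _, _, uadj, vadj, d1, d2, d3, d4, ?_⟩
    intro s1 s2 D hD
    by_contra hcon
    push Not at hcon
    have z1 := hcon _ (Or.inl rfl)
    have z2 := hcon _ (Or.inr (Or.inl rfl))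
    have z3 := hcon _ (Or.inr (Or.inr (Or.inl rfl)))
    have z4 := hcon _ (Or.inr (Or.inr (Or.inr rfl)))
    by_cases hne : ∃ P ∈ KN H n x, P ∈ D
    · obtain ⟨E0, hE0, a, b, ha, hb, hab, h1, h2, h3⟩ := f.closed hD hne
      have key : ∀ P ∈ KN H n x, (P ∉ D → P ≠ s1 → P = s2) → ∃ j, j ≤ n E0 + 1 ∧ P = kk H n x E0 j := by
        intro P hP h
        by_cases g1 : P ∈ D
        · exact h3 P hP g1
        by_cases g2 : P = s1
        · exact ⟨a, ha, g2.trans h1⟩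
        · exact ⟨b, hb, (h g1 g2).trans h2⟩
      obtain ⟨c1, k1, e1⟩ := key _ uadj.2.1 z1
      obtain ⟨c2, k2, e2⟩ := key _ uadj.2.2.1 z2
      obtain ⟨c3, k3, e3⟩ := key _ vadj.2.1 z3
      obtain ⟨c4, k4, e4⟩ := key _ vadj.2.2.1 z4
      have q1 := f.arc_unique hE hE0 (by omega) (by omega) k1 k2 (by omega) e1 e2
      have q2 := f.arc_unique hF hE0 (by omega) (by omega) k3 k4 (by omega) e3 e4
      exact hEF (q1.trans q2.symm)
    · have w1 := z1 (fun h => hne ⟨_, uadj.2.1, h⟩)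
      have w2 := z2 (fun h => hne ⟨_, uadj.2.2.1, h⟩)
      have w3 := z3 (fun h => hne ⟨_, vadj.2.1, h⟩)
      have d5 := uadj.1
      clear z1 z2 z3 z4 hcon hne hD key
      generalize kk H n x E i = A at *
      generalize kk H n x E (i + 1) = B at *
      generalize kk H n x F j = C at *
      by_cases q1 : A = s1
      · have q2 := w2 (fun h => d5 (q1.trans h.symm))
        have q3 := w3 (fun h => d1 (q1.trans h.symm))
        exact d3 (q2.trans q3.symm)
      · have q1 := w1 q1
        by_cases q2 : B = s1
        · have q3 := w3 (fun h => d3 (q2.trans h.symm))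
          exact d1 (q1.trans q3.symm)
        · exact d5 (q1.trans (w2 q2).symm)

theorem podded1 [Finite V] (f : NF G X H n x) (hleaves : {v | IsLeaf G v}.ncard = 3) {y : V}
    (hy : y ∉ X) (hfree : ¬ ∃ T, T ⊆ X ∪ {y} ∧ IsSapling G T) (hunt : ¬ TamedOut G X H {y})
    (hell : 3 ≤ ell G X H {y}) : Podded G X H {y} := by
  obtain ⟨v, w, D, hvw, hD, hF, hv, hw⟩ := core (f.coreHyp hleaves hy hfree hunt hell)
  by_cases hne : ∃ P ∈ KN H n x, P ∈ D
  · obtain ⟨E, hE, a, b, ha, hb, hab, h1, h2, h3⟩ := f.closed hD hne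
    have hNX : ∀ u ∈ NX G X {y}, u ∈ v ∨ u ∈ w ∨ u ∈ E := by
      intro u hu
      obtain ⟨F, hF', i, hi, -, m1, m2, hadj⟩ := f.fedge hu
      rcases hF _ _ hadj with h | h | h | h | ⟨g1, g2⟩
      · exact Or.inl (h ▸ m1)
      · exact Or.inr (Or.inl (h ▸ m1))
      · exact Or.inl (h ▸ m2)
      · exact Or.inr (Or.inl (h ▸ m2))
      · obtain ⟨c, hc, e1⟩ := h3 _ hadj.2.1 g1
        obtain ⟨d, hd, e2⟩ := h3 _ hadj.2.2.1 g2
        rw [e1] at m1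
        rw [e2] at m2
        refine Or.inr (Or.inr (f.mem_of_two hE hc hd ?_ m1 m2))
        rintro rfl
        exact hadj.1 (e1.trans e2.symm)
    have hvK : v ∈ KN H n x := h1 ▸ kk_mem hE ha
    have hwK : w ∈ KN H n x := h2 ▸ kk_mem hE hb
    have aend : a = 0 ∨ a = n E + 1 := by
      by_contra hcon
      have hs : v ⊆ E := h1 ▸ f.int_sub hE (j := a) (by omega) (by omega)
      have := ell_le_two (G := G) (X := X) (Y := {y}) (f.tamedK w) (tamedE hE) (by
        intro u hu
        rcases hNX u hu with h | h | h
        · exact Or.inr (hs h)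
        · exact Or.inl ⟨hwK, h⟩
        · exact Or.inr h)
      omega
    have bend : b = 0 ∨ b = n E + 1 := by
      by_contra hcon
      have hs : w ⊆ E := h2 ▸ f.int_sub hE (j := b) (by omega) (by omega)
      have := ell_le_two (G := G) (X := X) (Y := {y}) (f.tamedK v) (tamedE hE) (by
        intro u hu
        rcases hNX u hu with h | h | h
        · exact Or.inl ⟨hvK, h⟩
        · exact Or.inr (hs h)
        · exact Or.inr h)
      omega
    have hends : (H.fst E = v ∧ H.snd E = w) ∨ (H.fst E = w ∧ H.snd E = v) := by
      rcases aend with rfl | rfl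
      · obtain rfl : b = n E + 1 := by omega
        rw [kk_zero] at h1
        rw [kk_last] at h2
        exact Or.inl ⟨h1.symm, h2.symm⟩
      · obtain rfl : b = 0 := by omega
        rw [kk_last] at h1
        rw [kk_zero] at h2
        exact Or.inr ⟨h2.symm, h1.symm⟩
    have hend : IsEndOf G {y} y := by
      refine ⟨rfl, ?_⟩
      rintro a rfl b rfl - -
      rfl
    have cover : ∀ s t : Set V, ∀ c d, c ≤ n E + 1 → d ≤ n E + 1 → c ≠ d → s = kk H n x E c →
        t = kk H n x E d →
        (∀ z, (kGraph (KN H n x)).Adj s z → ¬ (fGraph G (KN H n x) y).Adj s z → z ∈ D ∨ z = t) →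
        s ⊆ E ∪ {z | G.Adj y z} := by
      intro s t c d hc hd hcd e1 e2 h u hu
      have hsK : s ∈ KN H n x := e1 ▸ kk_mem hE hc
      obtain ⟨P, hP, Q, hQ, hPQ, uP, uQ, hall⟩ := f.ks.two u (f.ks.sub s hsK hu)
      have : ∃ R ∈ KN H n x, s ≠ R ∧ u ∈ R := by
        rcases hall s hsK hu with rfl | rfl
        · exact ⟨Q, hQ, hPQ, uQ⟩
        · exact ⟨P, hP, hPQ.symm, uP⟩
      obtain ⟨R, hR, hsR, uR⟩ := this
      by_cases hf : (fGraph G (KN H n x) y).Adj s R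
      · obtain ⟨-, -, -, u', q1, q2, q3⟩ := hf
        have := f.ks.k3 s hsK R hR hsR u u' hu uR q1 q2
        subst this
        exact Or.inr q3
      · left
        have hRk : ∃ j, j ≤ n E + 1 ∧ R = kk H n x E j := by
          rcases h R ⟨hsR, hsK, hR, u, hu, uR⟩ hf with h | h
          · exact h3 R hR h
          · exact ⟨d, hd, h.trans e2⟩
        obtain ⟨j, hj, e3⟩ := hRk
        rw [e1] at hu
        rw [e3] at uR
        refine f.mem_of_two hE hc hj ?_ hu uR
        rintro rfl
        exact hsR (e1.trans e3.symm)
    refine ⟨E, v, w, arc_chunk hE hends, ?_, ⟨y, hend, Or.inr ?_⟩, ⟨y, hend, Or.inr ?_⟩⟩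
    · intro u hu
      rcases hNX u hu with h | h | h
      · exact Or.inl (Or.inl h)
      · exact Or.inr h
      · exact Or.inl (Or.inr h)
    · exact cover v w a b ha hb hab h1 h2 hv
    · exact cover w v b a hb ha hab.symm h2 h1 hw
  · have := ell_le_two (G := G) (X := X) (Y := {y}) (f.tamedK v) (f.tamedK w) (by
      intro u hu
      obtain ⟨F, hF', i, hi, -, m1, m2, hadj⟩ := f.fedge hu
      rcases hF _ _ hadj with h | h | h | h | ⟨g1, g2⟩
      · exact Or.inl ⟨h ▸ hadj.2.1, h ▸ m1⟩
      · exact Or.inr ⟨h ▸ hadj.2.1, h ▸ m1⟩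
      · exact Or.inl ⟨h ▸ hadj.2.2.1, h ▸ m2⟩
      · exact Or.inr ⟨h ▸ hadj.2.2.1, h ▸ m2⟩
      · exact absurd ⟨_, hadj.2.1, g1⟩ hne)
    omega

end NF

theorem final_aux [Finite V] (hleaves : {v | IsLeaf G v}.ncard = 3) (hnet : IsNet G X H)
    (hsimple : ∀ E ∈ H.arcs, SimpleArc G H E) (hsa : H.aiding = H)
    {Y : Set V} (hwild : Wild G X H Y) (hell : 3 ≤ ell G X H Y)
    (hfree : ¬ ∃ T, T ⊆ X ∪ Y ∧ IsSapling G T) :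
    Podded G X H Y := by
  have hseq : ∀ E : Set V, ∃ p : ℕ × (ℕ → V), E ∈ H.arcs →
      ArcSeq G (H.fst E) (H.snd E) E p.1 p.2 := by
    intro E
    by_cases hE : E ∈ H.arcs
    · obtain ⟨n, x, h⟩ := exists_arcSeq (hsimple E hE)
      exact ⟨(n, x), fun _ => h⟩
    · obtain ⟨F, hF⟩ := hnet.arcs_nonempty
      obtain ⟨v, -⟩ := arc_nonempty hnet hF
      exact ⟨(0, fun _ => v), fun h => absurd h hE⟩
  choose p hp using hseq
  have f : NF G X H (fun E => (p E).1) (fun E => (p E).2) :=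
    ⟨hnet, hp, fun E hE F hF h => nopar_of hnet hsa hE hF h,
      fun U hU W hW h => cn_two hnet hsa hU hW h⟩
  obtain ⟨hYX, hYp, hunt, hmin⟩ := hwild
  obtain ⟨⟨y, hy⟩⟩ := hYp.1.connected.nonempty
  have hYy : Y = {y} := by
    by_contra hcon
    have : ∃ z ∈ Y, z ≠ y := by
      by_contra h
      push Not at h
      apply hcon
      ext z
      exact ⟨fun hz => h z hz, by rintro rfl; exact hy⟩
    obtain ⟨z, hz, hzy⟩ := this
    have t1 := hmin (Y \ {y}) ⟨Set.diff_subset, fun h => (h hy).2 rfl⟩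
    have t2 := hmin (Y \ {z}) ⟨Set.diff_subset, fun h => (h hz).2 rfl⟩
    have := ell_le_two (G := G) (X := X) (Y := Y) t1 t2 (by
      rintro u ⟨hu, q, hq, hqu⟩
      by_cases h : q = y
      · subst h
        exact Or.inr ⟨hu, q, ⟨hq, fun h => hzy h.symm⟩, hqu⟩
      · exact Or.inl ⟨hu, q, ⟨hq, h⟩, hqu⟩)
    omega
  subst hYy
  exact f.podded1 hleaves (hYX rfl) hfree hunt hell

end KFinal

/-- For a simple self-aiding `X`-net `ℍ` and an `ℍ`-wild set
`Y` with `ℓ(Y,ℍ,G) ≥ 3`, if `G[X ∪ Y]` is sapling-free then `Y` is `ℍ`-podded. -/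
theorem simple_self_aiding_ell_ge_three_podded
    {V : Type*} [Fintype V] (G : SimpleGraph V)
    (hconn : G.Connected) (hleaves : {v | IsLeaf G v}.ncard = 3)
    (X : Set V) (H : Net V) (hnet : IsNet G X H)
    (hsimple : ∀ E ∈ H.arcs, SimpleArc G H E) (hsa : H.aiding = H)
    (Y : Set V) (hwild : Wild G X H Y) (hell : 3 ≤ ell G X H Y)
    (hfree : ¬ ∃ T, T ⊆ X ∪ Y ∧ IsSapling G T) :
    Podded G X H Y := by
  exact final_aux hleaves hnet hsimple hsa hwild hell hfree

end ThreeInATree
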